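/- arXiv:1801.07898 — 2 statements merged into one kernel-verified Lean document; each statement's English description precedes it below -/
import Mathlib

section
/- Let k be an algebraically closed field and let A be a finite-dimensional unital associative k-algebra with J(A)² = 0. Then A is of finite representation type if and only if the 6 × 6 matrix algebra M_6(A) has finitely many conjugacy classes of left ideals. -/
/-- Two left ideals `L, L'` of a ring `A` are conjugate if `L' = u L u⁻¹` for a unit `u`. -/
def ConjLeftIdeal (A : Type) [Ring A] (L L' : Submodule A A) : Prop :=
  ∃ u : Aˣ, (L' : Set A) = (fun x => (u : A) * x * ((u⁻¹ : Aˣ) : A)) '' (L : Set A)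

/-- `A` has finitely many conjugacy classes of left ideals. -/
def HasFinitelyManyConjClassesOfLeftIdeals (A : Type) [Ring A] : Prop :=
  Finite (Quot (ConjLeftIdeal A))

/-- An `A`-module is indecomposable if it is nonzero and admits no pair of nonzero
complementary submodules. -/
def IsIndecomposableModule (A : Type) [Ring A] (N : Type) [AddCommGroup N] [Module A N] : Prop :=
  (∃ v : N, v ≠ 0) ∧
    ∀ N₁ N₂ : Submodule A N, IsCompl N₁ N₂ → N₁ = ⊥ ∨ N₂ = ⊥

/-- `A` is of finite representation type: there are only finitely many isomorphism classes of
finite(-dimensional) indecomposable left `A`-modules. -/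
def FiniteRepresentationType (A : Type) [Ring A] : Prop :=
  ∃ (ι : Type) (_ : Finite ι) (M : ι → ModuleCat.{0} A),
    ∀ (N : ModuleCat.{0} A), Module.Finite A N → IsIndecomposableModule A N →
      ∃ i, Nonempty (N ≃ₗ[A] M i)

namespace RadSquareZero

section

section Combinatorics

open Finset Classical

variable {V : Type*} [Fintype V]

/-- A labelling of the vertices of a graph by natural numbers is subharmonic if twice the label of
each vertex is at most the sum of the labels of its neighbours. -/
def Subharmonic (G : SimpleGraph V) (y : V → ℕ) : Prop :=
  ∀ v, 2 * y v ≤ ∑ w ∈ G.neighborFinset v, y w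

/-- `Arm G k i j` says that `i` is the last vertex of an unbranched path with `k` vertices starting
at a leaf, and that `j` is the vertex following `i`. -/
inductive Arm (G : SimpleGraph V) : ℕ → V → V → Prop
  | leaf (i j : V) : G.neighborFinset i = {j} → Arm G 1 i j
  | step (k : ℕ) (i j l : V) : Arm G k i j → i ≠ l → G.neighborFinset j = {i, l} →
      Arm G (k + 1) j l

variable {G : SimpleGraph V}

lemma Arm.adj {k : ℕ} {i j : V} (h : Arm G k i j) : G.Adj i j := by
  cases h with
  | leaf _ _ h => rw [← G.mem_neighborFinset, h]; simp
  | step k i _ _ _ _ h => rw [← G.mem_neighborFinset, h]; simp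

lemma Arm.pos {k : ℕ} {i j : V} (h : Arm G k i j) : 1 ≤ k := by
  cases h <;> omega

lemma Arm.growth {x : V → ℕ} (hx : Subharmonic G x) {k : ℕ} {i j : V} (h : Arm G k i j) :
    (k + 1) * x i ≤ k * x j := by
  induction h with
  | leaf i j h => simpa [h] using hx i
  | step k i j l _ hil hN ih =>
    have := hx j
    rw [hN, sum_pair hil] at this
    nlinarith

lemma Arm.exists_labelling {k : ℕ} {i j : V} (h : Arm G k i j) :
    ∀ m, m + 1 ≤ k → ∀ s, ∃ f : V → ℕ, f i = (m + 1) * s ∧ (∀ v, f v ≤ (m + 1) * s) ∧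
      (∀ v, v ≠ i → 2 * f v ≤ ∑ w ∈ G.neighborFinset v, f w) ∧
      m * s ≤ ∑ w ∈ (G.neighborFinset i).erase j, f w := by
  have base : ∀ i j : V, ∀ s, ∃ f : V → ℕ, f i = (0 + 1) * s ∧ (∀ v, f v ≤ (0 + 1) * s) ∧
      (∀ v, v ≠ i → 2 * f v ≤ ∑ w ∈ G.neighborFinset v, f w) ∧
      0 * s ≤ ∑ w ∈ (G.neighborFinset i).erase j, f w := by
    intro i j s
    refine ⟨fun v => if v = i then s else 0, by simp, fun v => ?_, fun v hv => by simp [hv],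
      by simp⟩
    dsimp only
    split_ifs <;> simp
  induction h with
  | leaf i j h =>
    intro m hm s
    obtain rfl : m = 0 := by omega
    exact base i j s
  | step k i j l hA hil hN ih =>
    intro m hm s
    rcases m with _ | m
    · exact base j l s
    obtain ⟨f, hfi, hf, hsub, hs⟩ := ih m (by omega) s
    have hle : ∀ v, f v ≤ Function.update f j ((m + 1 + 1) * s) v := by
      intro v
      by_cases hv : v = j
      · subst hv
        rw [Function.update_self]
        exact (hf v).trans (Nat.mul_le_mul_right _ (by omega))
      · rw [Function.update_of_ne hv]
    have hij : i ≠ j := hA.adj.ne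
    refine ⟨Function.update f j ((m + 1 + 1) * s), by simp, fun v => ?_, fun v hv => ?_, ?_⟩
    · by_cases hv : v = j
      · subst hv; simp
      · rw [Function.update_of_ne hv]
        exact (hf v).trans (Nat.mul_le_mul_right _ (by omega))
    · rw [Function.update_of_ne hv]
      by_cases hvi : v = i
      · subst hvi
        rw [← add_sum_erase _ _ ((G.mem_neighborFinset _ _).2 hA.adj), Function.update_self, hfi]
        have := sum_le_sum (fun w (_ : w ∈ (G.neighborFinset v).erase j) => hle w)
        nlinarith
      · exact (hsub v hvi).trans (sum_le_sum fun w _ => hle w)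
    · have : (G.neighborFinset j).erase l = {i} := by
        rw [hN]; ext w; simp only [mem_erase, mem_insert, mem_singleton]
        constructor
        · rintro ⟨h1, h2 | h2⟩
          · exact h2
          · exact absurd h2 h1
        · rintro rfl; exact ⟨hil, Or.inl rfl⟩
      rw [this, sum_singleton, Function.update_of_ne hij, hfi]

lemma exists_subharmonic_of_three_arms {c u₁ u₂ u₃ : V} {k₁ k₂ k₃ : ℕ}
    (h₁ : Arm G k₁ u₁ c) (h₂ : Arm G k₂ u₂ c) (h₃ : Arm G k₃ u₃ c)
    (h₁₂ : u₁ ≠ u₂) (h₁₃ : u₁ ≠ u₃) (h₂₃ : u₂ ≠ u₃) (m₁ m₂ m₃ s₁ s₂ s₃ M : ℕ)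
    (hk₁ : m₁ + 1 ≤ k₁) (hk₂ : m₂ + 1 ≤ k₂) (hk₃ : m₃ + 1 ≤ k₃)
    (hM₁ : (m₁ + 2) * s₁ = M) (hM₂ : (m₂ + 2) * s₂ = M) (hM₃ : (m₃ + 2) * s₃ = M)
    (hM : 2 * M ≤ (m₁ + 1) * s₁ + (m₂ + 1) * s₂ + (m₃ + 1) * s₃) (hM0 : 0 < M) (hM6 : M ≤ 6) :
    ∃ y, y ≠ 0 ∧ (∀ v, y v ≤ 6) ∧ Subharmonic G y := by
  obtain ⟨f₁, hfu₁, hf₁, hsub₁, hs₁⟩ := h₁.exists_labelling m₁ hk₁ s₁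
  obtain ⟨f₂, hfu₂, hf₂, hsub₂, hs₂⟩ := h₂.exists_labelling m₂ hk₂ s₂
  obtain ⟨f₃, hfu₃, hf₃, hsub₃, hs₃⟩ := h₃.exists_labelling m₃ hk₃ s₃
  set y : V → ℕ := fun v => max (max (f₁ v) (f₂ v)) (max (f₃ v) (if v = c then M else 0)) with hy
  have hy₁ : ∀ v, f₁ v ≤ y v := fun v => by simp [hy]
  have hy₂ : ∀ v, f₂ v ≤ y v := fun v => by simp [hy]
  have hy₃ : ∀ v, f₃ v ≤ y v := fun v => by simp [hy]
  have hyc : M ≤ y c := by simp [hy]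
  have key : ∀ {k u m s} {f : V → ℕ}, Arm G k u c → (m + 2) * s = M → f u = (m + 1) * s →
      (∀ v, v ≠ u → 2 * f v ≤ ∑ w ∈ G.neighborFinset v, f w) →
      m * s ≤ ∑ w ∈ (G.neighborFinset u).erase c, f w → (∀ v, f v ≤ y v) →
      ∀ v, 2 * f v ≤ ∑ w ∈ G.neighborFinset v, y w := by
    intro k u m s f hA hM hfu hsub hs hfy v
    by_cases hv : v = u
    · subst hv
      rw [← add_sum_erase _ _ ((G.mem_neighborFinset _ _).2 hA.adj), hfu]
      have := sum_le_sum (fun w (_ : w ∈ (G.neighborFinset v).erase c) => hfy w)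
      nlinarith
    · exact (hsub v hv).trans (sum_le_sum fun w _ => hfy w)
  have hc : 2 * M ≤ ∑ w ∈ G.neighborFinset c, y w := by
    have hsubset : ({u₁, u₂, u₃} : Finset V) ⊆ G.neighborFinset c := by
      intro w hw
      simp only [mem_insert, mem_singleton] at hw
      rw [G.mem_neighborFinset]
      rcases hw with rfl | rfl | rfl
      exacts [h₁.adj.symm, h₂.adj.symm, h₃.adj.symm]
    refine le_trans ?_ (sum_le_sum_of_subset hsubset)
    rw [sum_insert (by simp [h₁₂, h₁₃]), sum_pair h₂₃]
    have a₁ := hy₁ u₁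
    have a₂ := hy₂ u₂
    have a₃ := hy₃ u₃
    omega
  refine ⟨y, fun h => ?_, fun v => ?_, fun v => ?_⟩
  · rw [h] at hyc; simp at hyc; omega
  · have a₁ := hf₁ v
    have a₂ := hf₂ v
    have a₃ := hf₃ v
    have b₁ : (m₁ + 1) * s₁ ≤ M := hM₁ ▸ Nat.mul_le_mul_right _ (by omega)
    have b₂ : (m₂ + 1) * s₂ ≤ M := hM₂ ▸ Nat.mul_le_mul_right _ (by omega)
    have b₃ : (m₃ + 1) * s₃ ≤ M := hM₃ ▸ Nat.mul_le_mul_right _ (by omega)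
    simp only [hy, max_le_iff]
    refine ⟨⟨by omega, by omega⟩, by omega, ?_⟩
    split_ifs <;> omega
  · have e₁ := key h₁ hM₁ hfu₁ hsub₁ hs₁ hy₁ v
    have e₂ := key h₂ hM₂ hfu₂ hsub₂ hs₂ hy₂ v
    have e₃ := key h₃ hM₃ hfu₃ hsub₃ hs₃ hy₃ v
    have e₄ : 2 * (if v = c then M else 0) ≤ ∑ w ∈ G.neighborFinset v, y w := by
      split_ifs with hv
      · rw [hv]; exact hc
      · simp
    have : y v = f₁ v ∨ y v = f₂ v ∨ y v = f₃ v ∨ y v = (if v = c then M else 0) := by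
      simp only [hy]; omega
    rcases this with h | h | h | h <;> rw [h] <;> assumption

lemma exists_subharmonic_of_core {W : Finset V} (hW : W.Nonempty)
    (h : ∀ w ∈ W, 4 ≤ #(G.neighborFinset w) + #(G.neighborFinset w ∩ W)) :
    ∃ y, y ≠ 0 ∧ (∀ v, y v ≤ 6) ∧ Subharmonic G y := by
  set y : V → ℕ := fun v => if v ∈ W then 2 else if ∃ w ∈ W, G.Adj v w then 1 else 0 with hy
  have hy2 : ∀ v ∈ W, y v = 2 := fun v hv => by simp [hy, hv]
  obtain ⟨w₀, hw₀⟩ := hW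
  refine ⟨y, fun h => ?_, fun v => ?_, fun v => ?_⟩
  · have := hy2 w₀ hw₀
    simp [h] at this
  · simp only [hy]; split_ifs <;> omega
  · by_cases hv : v ∈ W
    · rw [hy2 v hv]
      have : ∀ w ∈ G.neighborFinset v, y w = 1 + if w ∈ W then 1 else 0 := by
        intro w hw
        rw [G.mem_neighborFinset] at hw
        have : ∃ u ∈ W, G.Adj w u := ⟨v, hv, hw.symm⟩
        simp only [hy, this, if_true]
        split_ifs <;> rfl
      rw [sum_congr rfl this, sum_add_distrib, sum_boole]
      have h' := h v hv
      rw [← filter_mem_eq_inter] at h'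
      simpa using h'
    · by_cases hv' : ∃ w ∈ W, G.Adj v w
      · obtain ⟨w, hw, hvw⟩ := hv'
        have : y v = 1 := by simp only [hy, hv, if_false]; exact if_pos ⟨w, hw, hvw⟩
        rw [this]
        calc 2 * 1 = y w := (hy2 w hw).symm
          _ ≤ _ := single_le_sum (f := y) (fun _ _ => Nat.zero_le _)
            ((G.mem_neighborFinset v w).2 hvw)
      · simp [hy, hv, hv']

lemma exists_subharmonic_le_six_of_graph {x : V → ℕ} (hx0 : x ≠ 0) (hx : Subharmonic G x)
    (hG : ∀ i j, G.Adj i j → x i ≠ 0) : ∃ y, y ≠ 0 ∧ (∀ v, y v ≤ 6) ∧ Subharmonic G y := by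
  by_contra hno
  set W : Finset V := univ.filter fun v => x v ≠ 0 ∧ ∀ k j, ¬ Arm G k v j with hWdef
  have hWne : W.Nonempty := by
    obtain ⟨v₀, hv₀⟩ := Function.ne_iff.1 hx0
    obtain ⟨v, -, hv⟩ := exists_max_image univ x ⟨v₀, mem_univ _⟩
    refine ⟨v, ?_⟩
    have hxv : x v ≠ 0 := by
      have := hv v₀ (mem_univ _)
      simp only [Pi.zero_apply] at hv₀
      omega
    simp only [hWdef, mem_filter, mem_univ, true_and]
    refine ⟨hxv, fun k j hA => ?_⟩
    have h1 := hA.growth hx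
    have h2 := hv j (mem_univ _)
    have : 0 < x v := by omega
    nlinarith
  obtain ⟨c, hcW, hc⟩ : ∃ w ∈ W, #(G.neighborFinset w) + #(G.neighborFinset w ∩ W) < 4 := by
    by_contra! h
    exact hno (exists_subharmonic_of_core hWne h)
  obtain ⟨hxc, hcA⟩ : x c ≠ 0 ∧ ∀ k j, ¬ Arm G k c j := by simpa [hWdef] using hcW
  have harm : ∀ u, G.Adj c u → u ∉ W → ∃ k, Arm G k u c := by
    intro u hcu huW
    obtain ⟨k, j, hA⟩ : ∃ k j, Arm G k u j := by
      by_contra! h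
      exact huW (by simpa [hWdef] using ⟨hG u c hcu.symm, h⟩)
    have hmem : c ∈ G.neighborFinset u := (G.mem_neighborFinset _ _).2 hcu.symm
    cases hA with
    | leaf _ _ h =>
      rw [h, mem_singleton] at hmem
      subst hmem
      exact ⟨1, Arm.leaf _ _ h⟩
    | step k i _ _ hA hil hN =>
      rw [hN, mem_insert, mem_singleton] at hmem
      rcases hmem with rfl | rfl
      · exact absurd hA (hcA _ _)
      · exact ⟨_, Arm.step k i _ _ hA hil hN⟩
  have hsub : G.neighborFinset c ∩ W ⊆ G.neighborFinset c := inter_subset_left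
  have hcard := card_le_card hsub
  have hW0 : G.neighborFinset c ∩ W = ∅ := by
    by_contra hne
    have h1 : #(G.neighborFinset c ∩ W) = 1 := by
      have := card_pos.2 (nonempty_iff_ne_empty.2 hne)
      omega
    obtain ⟨l, hl⟩ := card_eq_one.1 h1
    have hlN : l ∈ G.neighborFinset c := hsub (hl ▸ mem_singleton_self l)
    have : #(G.neighborFinset c) = 1 ∨ #(G.neighborFinset c) = 2 := by omega
    rcases this with h | h
    · obtain ⟨j, hj⟩ := card_eq_one.1 h
      exact hcA _ _ (Arm.leaf _ _ hj)
    · have h3 : #((G.neighborFinset c).erase l) = 1 := by rw [card_erase_of_mem hlN, h]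
      obtain ⟨i, hi⟩ := card_eq_one.1 h3
      have hN : G.neighborFinset c = {i, l} := by
        rw [← insert_erase hlN, hi, pair_comm]
      have hi' : i ∈ (G.neighborFinset c).erase l := hi ▸ mem_singleton_self i
      rw [mem_erase] at hi'
      obtain ⟨k, hk⟩ := harm i ((G.mem_neighborFinset _ _).1 hi'.2) (fun hiW => hi'.1 (by
        have : i ∈ G.neighborFinset c ∩ W := mem_inter.2 ⟨hi'.2, hiW⟩
        rwa [hl, mem_singleton] at this))
      exact hcA _ _ (Arm.step k i c l hk hi'.1 hN)
  have harm' : ∀ u ∈ G.neighborFinset c, ∃ k, Arm G k u c := fun u hu =>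
    harm u ((G.mem_neighborFinset _ _).1 hu) fun huW => by
      have : u ∈ G.neighborFinset c ∩ W := mem_inter.2 ⟨hu, huW⟩
      simp [hW0] at this
  have hlt : ∀ u ∈ G.neighborFinset c, x u < x c := by
    intro u hu
    obtain ⟨k, hk⟩ := harm' u hu
    have := hk.growth hx
    have : 0 < x c := by omega
    by_contra! h
    nlinarith
  have h2 := hx c
  have : #(G.neighborFinset c) ≤ 3 := by omega
  interval_cases hn : #(G.neighborFinset c)
  · rw [card_eq_zero.1 hn] at h2
    simp at h2; omega
  · obtain ⟨u, hu⟩ := card_eq_one.1 hn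
    have := hlt u (by simp [hu])
    rw [hu, sum_singleton] at h2
    omega
  · obtain ⟨u, v, huv, hu⟩ := card_eq_two.1 hn
    have := hlt u (by simp [hu])
    have := hlt v (by simp [hu])
    rw [hu, sum_pair huv] at h2
    omega
  · obtain ⟨u₁, u₂, u₃, h₁₂, h₁₃, h₂₃, hu⟩ := card_eq_three.1 hn
    obtain ⟨k₁, hk₁⟩ := harm' u₁ (by simp [hu])
    obtain ⟨k₂, hk₂⟩ := harm' u₂ (by simp [hu])
    obtain ⟨k₃, hk₃⟩ := harm' u₃ (by simp [hu])
    rw [hu, sum_insert (by simp [h₁₂, h₁₃]), sum_pair h₂₃, ← add_assoc] at h2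
    clear hu hn this hlt harm' hW0 hcard hsub harm
    have main : ∀ {u₁ u₂ u₃ : V} {k₁ k₂ k₃ : ℕ}, u₁ ≠ u₂ → u₁ ≠ u₃ → u₂ ≠ u₃ → Arm G k₁ u₁ c →
        Arm G k₂ u₂ c → Arm G k₃ u₃ c → 2 * x c ≤ x u₁ + x u₂ + x u₃ → k₁ ≤ k₂ → k₂ ≤ k₃ →
        False := by
      intro u₁ u₂ u₃ k₁ k₂ k₃ h₁₂ h₁₃ h₂₃ hk₁ hk₂ hk₃ h2 hle₁ hle₂
      have p₁ := hk₁.pos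
      have p : 0 < x c := by omega
      have g₁ := hk₁.growth hx
      have g₂ := hk₂.growth hx
      have g₃ := hk₃.growth hx
      by_cases c₁ : 2 ≤ k₁
      · exact hno (exists_subharmonic_of_three_arms hk₁ hk₂ hk₃ h₁₂ h₁₃ h₂₃ 1 1 1 1 1 1 3
          (by omega) (by omega) (by omega) rfl rfl rfl (by norm_num) (by norm_num) (by norm_num))
      obtain rfl : k₁ = 1 := by omega
      by_cases c₂ : 3 ≤ k₂
      · exact hno (exists_subharmonic_of_three_arms hk₁ hk₂ hk₃ h₁₂ h₁₃ h₂₃ 0 2 2 2 1 1 4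
          (by omega) (by omega) (by omega) rfl rfl rfl (by norm_num) (by norm_num) (by norm_num))
      by_cases c₃ : 2 ≤ k₂ ∧ 5 ≤ k₃
      · exact hno (exists_subharmonic_of_three_arms hk₁ hk₂ hk₃ h₁₂ h₁₃ h₂₃ 0 1 4 3 2 1 6
          (by omega) (by omega) (by omega) rfl rfl rfl (by norm_num) (by norm_num) (by norm_num))
      have c₄ : k₂ = 1 ∨ k₂ = 2 ∧ k₃ ≤ 4 := by omega
      rcases c₄ with rfl | ⟨rfl, c₅⟩
      · have : x u₃ < x c := by
          by_contra! h
          nlinarith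
        omega
      · interval_cases k₃ <;> omega
    rcases le_total k₁ k₂ with a | a <;> rcases le_total k₂ k₃ with b | b <;>
      rcases le_total k₁ k₃ with d | d
    · exact main h₁₂ h₁₃ h₂₃ hk₁ hk₂ hk₃ h2 a b
    · exact main h₁₂ h₁₃ h₂₃ hk₁ hk₂ hk₃ h2 a b
    · exact main h₁₃ h₁₂ h₂₃.symm hk₁ hk₃ hk₂ (by omega) d b
    · exact main h₁₃.symm h₂₃.symm h₁₂ hk₃ hk₁ hk₂ (by omega) d a
    · exact main h₁₂.symm h₂₃ h₁₃ hk₂ hk₁ hk₃ (by omega) a d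
    · exact main h₂₃ h₁₂.symm h₁₃.symm hk₂ hk₃ hk₁ (by omega) b d
    · exact main h₂₃.symm h₁₃.symm h₁₂.symm hk₃ hk₂ hk₁ (by omega) b a
    · exact main h₂₃.symm h₁₃.symm h₁₂.symm hk₃ hk₂ hk₁ (by omega) b a

/-- Twice the unit form of the multigraph with adjacency matrix `a`. -/
def form (a : V → V → ℕ) (d : V → ℕ) : ℤ :=
  2 * ∑ x, (d x : ℤ) ^ 2 - ∑ x, ∑ y, (a x y : ℤ) * d x * d y

/-- The partial derivatives of the unit form of the multigraph with adjacency matrix `a`. -/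
def grad (a : V → V → ℕ) (d : V → ℕ) (x : V) : ℤ := 2 * d x - ∑ y, (a x y : ℤ) * d y

lemma form_eq_sum_grad (a : V → V → ℕ) (d : V → ℕ) : form a d = ∑ x, (d x : ℤ) * grad a d x := by
  simp only [form, grad, mul_sub, sum_sub_distrib, mul_sum]
  congr 1
  · exact sum_congr rfl fun x _ => by ring
  · exact sum_congr rfl fun x _ => sum_congr rfl fun y _ => by ring

lemma form_add {a : V → V → ℕ} (ha : ∀ x y, a x y = a y x) (d z : V → ℕ) :
    form a (d + z) = form a d + form a z + 2 * ∑ x, (z x : ℤ) * grad a d x := by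
  have h1 : ∑ x, ∑ y, (a x y : ℤ) * d x * z y = ∑ x, ∑ y, (a x y : ℤ) * z x * d y := by
    rw [sum_comm]
    exact sum_congr rfl fun x _ => sum_congr rfl fun y _ => by rw [ha]; ring
  have h2 : ∑ x, (z x : ℤ) * grad a d x =
      2 * ∑ x, (d x : ℤ) * z x - ∑ x, ∑ y, (a x y : ℤ) * z x * d y := by
    simp only [grad, mul_sub, sum_sub_distrib, mul_sum]
    congr 1
    · exact sum_congr rfl fun x _ => by ring
    · exact sum_congr rfl fun x _ => sum_congr rfl fun y _ => by ring
  have h3 : ∑ x, (((d + z) x : ℕ) : ℤ) ^ 2 =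
      ∑ x, (d x : ℤ) ^ 2 + ∑ x, (z x : ℤ) ^ 2 + 2 * ∑ x, (d x : ℤ) * z x := by
    rw [mul_sum, ← sum_add_distrib, ← sum_add_distrib]
    exact sum_congr rfl fun x _ => by simp only [Pi.add_apply]; push_cast; ring
  have h4 : ∑ x, ∑ y, (a x y : ℤ) * ((d + z) x : ℕ) * ((d + z) y : ℕ) =
      ∑ x, ∑ y, (a x y : ℤ) * d x * d y + ∑ x, ∑ y, (a x y : ℤ) * z x * z y +
      (∑ x, ∑ y, (a x y : ℤ) * d x * z y + ∑ x, ∑ y, (a x y : ℤ) * z x * d y) := by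
    simp only [← sum_add_distrib]
    exact sum_congr rfl fun x _ => sum_congr rfl fun y _ => by
      simp only [Pi.add_apply]; push_cast; ring
  rw [form, h3, h4, h1, h2, form, form]
  ring

lemma form_single {a : V → V → ℕ} (ha : ∀ x, a x x = 0) (x : V) :
    form a (Pi.single x 1) = 2 := by
  rw [form_eq_sum_grad, sum_eq_single x]
  · rw [grad, sum_eq_single x]
    · simp [ha]
    · intro y _ hy; simp [hy]
    · simp
  · intro y _ hy; simp [hy]
  · simp

lemma form_add_single {a : V → V → ℕ} (hs : ∀ x y, a x y = a y x) (ha : ∀ x, a x x = 0)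
    (d : V → ℕ) (x : V) : form a (d + Pi.single x 1) = form a d + 2 + 2 * grad a d x := by
  rw [form_add hs, form_single ha, sum_eq_single x]
  · simp
  · intro y _ hy; simp [hy]
  · simp

lemma grad_add_single {a : V → V → ℕ} (ha : ∀ x, a x x = 0)
    (d : V → ℕ) (x : V) : grad a (d + Pi.single x 1) x = grad a d x + 2 := by
  have : ∑ y, (a x y : ℤ) * ((d + Pi.single x 1 : V → ℕ) y : ℕ) = ∑ y, (a x y : ℤ) * d y := by
    refine sum_congr rfl fun y _ => ?_
    by_cases hy : y = x
    · subst hy; simp [ha]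
    · simp [hy]
  rw [grad, this, grad]
  simp; ring

omit [Fintype V] in
lemma eq_add_single {d : V → ℕ} {x : V} (hx : d x ≠ 0) :
    ∃ d' : V → ℕ, d = d' + Pi.single x 1 := by
  refine ⟨fun y => d y - (Pi.single x 1 : V → ℕ) y, funext fun y => ?_⟩
  by_cases hy : y = x
  · subst hy; simp; omega
  · simp [hy]

lemma exists_subharmonic_le_six {a : V → V → ℕ} (hs : ∀ x y, a x y = a y x)
    (ha : ∀ x, a x x = 0) {x : V → ℕ} (hx0 : x ≠ 0) (hx : ∀ v, x v ≠ 0 → grad a x v ≤ 0) :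
    ∃ y : V → ℕ, y ≠ 0 ∧ (∀ v, y v ≤ 6) ∧ ∀ v, y v ≠ 0 → grad a y v ≤ 0 := by
  by_cases hmul : ∃ i j, 2 ≤ a i j
  · obtain ⟨i, j, hij⟩ := hmul
    have hne : i ≠ j := by rintro rfl; simp [ha] at hij
    set y : V → ℕ := fun v => if v = i ∨ v = j then 1 else 0 with hy
    refine ⟨y, fun h => ?_, fun v => ?_, fun v hv => ?_⟩
    · have := congrFun h i
      simp [hy] at this
    · simp only [hy]; split_ifs <;> omega
    · have key : ∀ u w : V, 2 ≤ a u w → y w = 1 → y u = 1 → grad a y u ≤ 0 := by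
        intro u w h1 h2 h3
        have := single_le_sum (f := fun z => (a u z : ℤ) * y z) (fun z _ => by positivity)
          (mem_univ w)
        simp only [h2] at this
        rw [grad, h3]
        push_cast at this ⊢
        have h1' : (2 : ℤ) ≤ a u w := by exact_mod_cast h1
        linarith
      have hv' : v = i ∨ v = j := by
        by_contra h; exact hv (by simp [hy, h])
      rcases hv' with rfl | rfl
      · exact key v j hij (by simp [hy]) (by simp [hy])
      · exact key v i (hs i v ▸ hij) (by simp [hy]) (by simp [hy])
  · push Not at hmul
    obtain ⟨G, hadj⟩ : ∃ G : SimpleGraph V, ∀ i j, G.Adj i j ↔ a i j ≠ 0 ∧ x i ≠ 0 ∧ x j ≠ 0 :=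
      ⟨{ Adj := fun i j => a i j ≠ 0 ∧ x i ≠ 0 ∧ x j ≠ 0
         symm := ⟨fun i j h => ⟨hs i j ▸ h.1, h.2.2, h.2.1⟩⟩
         loopless := ⟨fun i h => h.1 (ha i)⟩ }, fun _ _ => Iff.rfl⟩
    have hsum : ∀ (y : V → ℕ) i, ((∑ j ∈ G.neighborFinset i, y j : ℕ) : ℤ) ≤
        ∑ j, (a i j : ℤ) * y j := by
      intro y i
      push_cast
      calc ∑ j ∈ G.neighborFinset i, (y j : ℤ) ≤ ∑ j ∈ G.neighborFinset i, (a i j : ℤ) * y j := by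
            refine sum_le_sum fun j hj => ?_
            rw [G.mem_neighborFinset, hadj] at hj
            have : (1 : ℤ) ≤ a i j := by have := hj.1; omega
            nlinarith [Int.natCast_nonneg (y j)]
        _ ≤ _ := sum_le_sum_of_subset_of_nonneg (subset_univ _) fun j _ _ => by positivity
    obtain ⟨y, hy0, hy6, hy⟩ := exists_subharmonic_le_six_of_graph (G := G) hx0 (fun i => by
      by_cases hi : x i = 0
      · simp [hi]
      have h1 := hx i hi
      have h2 : ∑ j, (a i j : ℤ) * x j = ∑ j ∈ G.neighborFinset i, (x j : ℤ) := by
        rw [← sum_subset (subset_univ (G.neighborFinset i))]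
        · refine sum_congr rfl fun j hj => ?_
          rw [G.mem_neighborFinset, hadj] at hj
          have : a i j = 1 := by have := hmul i j; omega
          simp [this]
        · intro j _ hj
          rw [G.mem_neighborFinset, hadj] at hj
          by_cases h : a i j = 0
          · simp [h]
          · have : x j = 0 := by
              by_contra h'
              exact hj ⟨h, hi, h'⟩
            simp [this]
      rw [grad, h2] at h1
      zify
      linarith) (fun i j h => ((hadj i j).1 h).2.1)
    refine ⟨y, hy0, hy6, fun v _ => ?_⟩
    have h1 := hsum y v
    have h2 : ((2 * y v : ℕ) : ℤ) ≤ _ := Nat.cast_le.2 (hy v)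
    rw [grad]
    push_cast at h1 h2
    linarith

/-- A unit form that is positive on all nonzero vectors with entries at most six is weakly
positive. -/
theorem form_pos_of_le_six {a : V → V → ℕ} (hs : ∀ x y, a x y = a y x) (ha : ∀ x, a x x = 0)
    (h6 : ∀ d : V → ℕ, d ≠ 0 → (∀ v, d v ≤ 6) → 0 < form a d) (d : V → ℕ) (hd : d ≠ 0) :
    0 < form a d := by
  induction hn : ∑ v, d v using Nat.strong_induction_on generalizing d with
  | _ n ih =>
  by_contra! hneg
  obtain ⟨y, hy0, hy6, hy⟩ := exists_subharmonic_le_six hs ha hd (fun v hv => by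
    obtain ⟨d', rfl⟩ := eq_add_single hv
    rw [grad_add_single ha]
    rw [form_add_single hs ha] at hneg
    by_cases hd' : d' = 0
    · subst hd'
      simp [form, grad] at hneg
    · have := ih (∑ v, d' v) (by rw [← hn]; simp [sum_add_distrib]) d' hd' rfl
      omega)
  have := h6 y hy0 hy6
  rw [form_eq_sum_grad] at this
  refine absurd this (not_lt.2 (sum_nonpos fun v _ => ?_))
  by_cases hv : y v = 0
  · simp [hv]
  · exact mul_nonpos_of_nonneg_of_nonpos (by positivity) (hy v hv)

/-- A weakly positive unit form has only finitely many positive roots. -/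
theorem finite_roots {a : V → V → ℕ} (hs : ∀ x y, a x y = a y x) (ha : ∀ x, a x x = 0)
    (hpos : ∀ d : V → ℕ, d ≠ 0 → 0 < form a d) : {d : V → ℕ | form a d = 2}.Finite := by
  have hgrad : ∀ d : V → ℕ, form a d = 2 → ∀ x, grad a d x ∈ Set.Icc (-2 : ℤ) 2 := by
    intro d hd x
    have h1 : 0 < form a (d + Pi.single x 1) := hpos _ fun h => by
      have := congrFun h x; simp at this
    rw [form_add_single hs ha, hd] at h1
    refine ⟨by omega, ?_⟩
    by_cases hx : d x = 0
    · rw [grad, hx]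
      have : 0 ≤ ∑ y, (a x y : ℤ) * d y := sum_nonneg fun _ _ => by positivity
      push_cast
      linarith
    · obtain ⟨d', rfl⟩ := eq_add_single hx
      rw [form_add_single hs ha] at hd
      rw [grad_add_single ha]
      have : 0 ≤ form a d' := by
        by_cases h : d' = 0
        · subst h; simp [form]
        · exact (hpos _ h).le
      omega
  refine Set.Finite.of_finite_fibers (grad a) ?_ fun g _ => ?_
  · refine (Set.Finite.pi fun _ : V => Set.finite_Icc (-2 : ℤ) 2).subset ?_
    rintro _ ⟨d, hd, rfl⟩ x -
    exact hgrad d hd x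
  · refine WellQuasiOrderedLE.finite_of_isAntichain fun d hd d' hd' hne hle => ?_
    obtain ⟨z, rfl⟩ : ∃ z, d' = d + z := ⟨d' - d, (add_tsub_cancel_of_le hle).symm⟩
    have hz : z ≠ 0 := by rintro rfl; simp at hne
    have h3 : grad a d = grad a (d + z) := hd.2.trans hd'.2.symm
    have h7 : ∀ x, grad a (d + z) x = grad a d x + grad a z x := by
      intro x
      simp only [grad, Pi.add_apply]
      push_cast
      simp only [mul_add, sum_add_distrib]
      ring
    have h8 : grad a z = 0 := funext fun x => by
      have := h7 x
      rw [← h3] at this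
      simpa using this
    have := hpos z hz
    rw [form_eq_sum_grad, h8] at this
    simp at this

end Combinatorics

end

section

section Quiver

open Finset

variable {k : Type} [Field k]

/-- A finite-dimensional algebra over an algebraically closed field in which `0` and `1` are the
only idempotents either consists of scalars or contains a nonzero element of square zero. -/
lemma exists_sq_eq_zero_of_idempotents_trivial [IsAlgClosed k] {D : Type*} [Ring D] [Algebra k D]
    [FiniteDimensional k D] (hid : ∀ p : D, p * p = p → p = 0 ∨ p = 1) (a : D)
    (ha : ∀ c : k, a ≠ algebraMap k D c) : ∃ b : D, b ≠ 0 ∧ b * b = 0 := by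
  have hint : IsIntegral k a := Algebra.IsIntegral.isIntegral a
  have : Nontrivial D := ⟨a, algebraMap k D 0, ha 0⟩
  obtain ⟨l, hl⟩ := IsAlgClosed.exists_root (minpoly k a) (minpoly.degree_pos hint).ne'
  obtain ⟨g, hg⟩ := Polynomial.dvd_iff_isRoot.2 hl
  set b := Polynomial.aeval a g with hb
  have hg0 : g ≠ 0 := by
    rintro rfl
    exact minpoly.ne_zero hint (by rw [hg, mul_zero])
  have hb0 : b ≠ 0 := fun h => by
    have h1 := minpoly.degree_le_of_ne_zero k a hg0 h
    rw [hg, Polynomial.degree_mul, Polynomial.degree_X_sub_C,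
      Polynomial.degree_eq_natDegree hg0] at h1
    have h2 : 1 + g.natDegree ≤ g.natDegree := by exact_mod_cast h1
    omega
  have hab : (a - algebraMap k D l) * b = 0 := by
    have := minpoly.aeval k a
    rw [hg, map_mul] at this
    simpa using this
  have hfb : ∀ f : Polynomial k, Polynomial.aeval a f * b = algebraMap k D (f.eval l) * b := by
    intro f
    obtain ⟨f', hf'⟩ := Polynomial.X_sub_C_dvd_sub_C_eval (p := f) (a := l)
    have h1 : Polynomial.aeval a f = algebraMap k D (f.eval l) +
        Polynomial.aeval a f' * (a - algebraMap k D l) := by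
      have := congrArg (Polynomial.aeval a) hf'
      rw [mul_comm, map_mul, map_sub] at this
      simp only [Polynomial.aeval_C, map_sub, Polynomial.aeval_X] at this
      rw [← this]; abel
    rw [h1, add_mul, mul_assoc, hab, mul_zero, add_zero]
  by_cases hgl : g.eval l = 0
  · exact ⟨b, hb0, by rw [hb, ← hb, hfb g, hgl, map_zero, zero_mul]⟩
  · exfalso
    have hbb : b * b = algebraMap k D (g.eval l) * b := hfb g
    rcases hid (algebraMap k D (g.eval l)⁻¹ * b) (by
      rw [mul_assoc, ← mul_assoc b, ← Algebra.commutes, mul_assoc, hbb, ← mul_assoc, ← mul_assoc,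
        ← map_mul, ← map_mul, inv_mul_cancel_right₀ hgl]) with h | h
    · apply hb0
      rw [← one_mul b, ← map_one (algebraMap k D), ← mul_inv_cancel₀ hgl, map_mul, mul_assoc, h,
        mul_zero]
    · have hb' : b = algebraMap k D (g.eval l) := by
        rw [← one_mul b, ← map_one (algebraMap k D), ← mul_inv_cancel₀ hgl, map_mul, mul_assoc, h,
          mul_one]
      apply ha l
      rw [hb'] at hab
      have := congrArg (· * algebraMap k D (g.eval l)⁻¹) hab
      simp only [mul_assoc, ← map_mul, mul_inv_cancel₀ hgl, map_one, mul_one, zero_mul] at this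
      exact sub_eq_zero.1 this

lemma exists_comp_eq_of_ker_le {U V W : Type*} [AddCommGroup U] [Module k U] [AddCommGroup V]
    [Module k V] [AddCommGroup W] [Module k W] (f : U →ₗ[k] V) (g : U →ₗ[k] W)
    (h : LinearMap.ker f ≤ LinearMap.ker g) : ∃ c : V →ₗ[k] W, c ∘ₗ f = g := by
  obtain ⟨c, hc⟩ := LinearMap.exists_extend
    (((LinearMap.ker f).liftQ g h) ∘ₗ f.quotKerEquivRange.symm.toLinearMap)
  refine ⟨c, LinearMap.ext fun u => ?_⟩
  have h1 := LinearMap.congr_fun hc ⟨f u, LinearMap.mem_range_self f u⟩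
  have h2 : f.quotKerEquivRange.symm ⟨f u, LinearMap.mem_range_self f u⟩ =
      (LinearMap.ker f).mkQ u := by
    rw [LinearEquiv.symm_apply_eq]; rfl
  simpa [h2] using h1

variable {X E : Type} {s t : E → X}

variable (k s t) in
/-- A finite-dimensional representation of the quiver with vertices `X` and arrows `E`. -/
structure QuiverRep where
  /-- The vector spaces at the vertices. -/
  V : X → Type
  [addCommGroup : ∀ x, AddCommGroup (V x)]
  [module : ∀ x, Module k (V x)]
  [finiteDimensional : ∀ x, FiniteDimensional k (V x)]
  /-- The linear maps along the arrows. -/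
  φ : ∀ e, V (s e) →ₗ[k] V (t e)

namespace QuiverRep

attribute [instance] addCommGroup module finiteDimensional

/-- The map whose kernel is the space of homomorphisms and whose cokernel is `Ext¹`. -/
def coboundary (M N : QuiverRep k s t) :
    (∀ x, M.V x →ₗ[k] N.V x) →ₗ[k] (∀ e, M.V (s e) →ₗ[k] N.V (t e)) where
  toFun η e := N.φ e ∘ₗ η (s e) - η (t e) ∘ₗ M.φ e
  map_add' η η' := by
    ext e v
    simp only [Pi.add_apply, LinearMap.sub_apply, LinearMap.comp_apply, LinearMap.add_apply,
      map_add]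
    abel
  map_smul' c η := by
    ext e v
    simp [smul_sub]

lemma coboundary_apply (M N : QuiverRep k s t) (η : ∀ x, M.V x →ₗ[k] N.V x) (e : E) :
    coboundary M N η e = N.φ e ∘ₗ η (s e) - η (t e) ∘ₗ M.φ e := rfl

/-- A family of linear maps is a homomorphism if it commutes with all arrows. -/
def IsHom (M N : QuiverRep k s t) (h : ∀ x, M.V x →ₗ[k] N.V x) : Prop :=
  ∀ e v, N.φ e (h (s e) v) = h (t e) (M.φ e v)

lemma isHom_iff {M N : QuiverRep k s t} {h : ∀ x, M.V x →ₗ[k] N.V x} :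
    IsHom M N h ↔ coboundary M N h = 0 := by
  simp only [IsHom, funext_iff, LinearMap.ext_iff, coboundary_apply, LinearMap.comp_apply,
    Pi.zero_apply, sub_eq_zero]

/-- A representation is indecomposable if it is nonzero and its only idempotent endomorphisms are
zero and the identity. -/
def Indecomposable (M : QuiverRep k s t) : Prop :=
  (∃ x, ∃ v : M.V x, v ≠ 0) ∧ ∀ p : ∀ x, M.V x →ₗ[k] M.V x, IsHom M M p →
    (∀ x v, p x (p x v) = p x v) → (∀ x v, p x v = 0) ∨ ∀ x v, p x v = v

/-- A representation is rigid if it has no self-extensions. -/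
def Rigid (M : QuiverRep k s t) : Prop := Function.Surjective (coboundary M M)

/-- The dimension vector of a representation. -/
noncomputable def dim (M : QuiverRep k s t) (x : X) : ℕ := Module.finrank k (M.V x)

/-- The kernel of a homomorphism. -/
def kernel {M N : QuiverRep k s t} {θ : ∀ x, M.V x →ₗ[k] N.V x} (hθ : IsHom M N θ) :
    QuiverRep k s t where
  V x := LinearMap.ker (θ x)
  φ e := (M.φ e).restrict fun v hv => by
    rw [LinearMap.mem_ker] at hv ⊢
    rw [← hθ, hv, map_zero]

/-- The image of a homomorphism. -/
def image {M N : QuiverRep k s t} {θ : ∀ x, M.V x →ₗ[k] N.V x} (hθ : IsHom M N θ) :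
    QuiverRep k s t where
  V x := LinearMap.range (θ x)
  φ e := (N.φ e).restrict fun v hv => by
    obtain ⟨w, rfl⟩ := hv
    exact ⟨M.φ e w, (hθ e w).symm⟩

variable (s t) in
/-- The number of arrows connecting two vertices. -/
noncomputable def adjacency (x y : X) : ℕ :=
  Nat.card {e : E // s e = x ∧ t e = y} + Nat.card {e : E // s e = y ∧ t e = x}

lemma adjacency_comm (x y : X) : adjacency s t x y = adjacency s t y x := add_comm _ _

lemma adjacency_self (hst : ∀ e, s e ≠ t e) (x : X) : adjacency s t x x = 0 := by
  have : IsEmpty {e : E // s e = x ∧ t e = x} := ⟨fun e => hst e.1 (e.2.1.trans e.2.2.symm)⟩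
  simp [adjacency]

variable [Fintype X] [Fintype E]

lemma form_adjacency (d : X → ℕ) :
    form (adjacency s t) d = 2 * (∑ x, (d x : ℤ) ^ 2 - ∑ e, (d (s e) : ℤ) * d (t e)) := by
  classical
  have key : ∀ (s t : E → X), ∑ x, ∑ y, (Nat.card {e : E // s e = x ∧ t e = y} : ℤ) * d x * d y =
      ∑ e, (d (s e) : ℤ) * d (t e) := by
    intro s t
    have : ∀ x y, (Nat.card {e : E // s e = x ∧ t e = y} : ℤ) * d x * d y =
        ∑ e, if s e = x then (if t e = y then (d x : ℤ) * d y else 0) else 0 := by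
      intro x y
      rw [Nat.card_eq_fintype_card, Fintype.card_subtype, mul_assoc, ← nsmul_eq_mul,
        ← sum_const, sum_filter]
      exact sum_congr rfl fun e _ => by split_ifs <;> simp_all
    simp only [this]
    rw [sum_congr rfl fun x _ => sum_comm, sum_comm]
    refine sum_congr rfl fun e _ => ?_
    simp
  rw [form]
  simp only [adjacency, Nat.cast_add, add_mul, sum_add_distrib, key s t]
  have : ∑ x, ∑ y, (Nat.card {e : E // s e = y ∧ t e = x} : ℤ) * d x * d y =
      ∑ e, (d (s e) : ℤ) * d (t e) := by
    have := key t s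
    simp only [and_comm (a := t _ = _)] at this
    rw [this]
    exact sum_congr rfl fun _ _ => mul_comm _ _
  rw [this]
  ring

/-- A nonzero representation with only scalar endomorphisms is rigid if the Tits form is positive
on its dimension vector. -/
lemma rigid_of_brick {M : QuiverRep k s t}
    (hpos : 0 < form (adjacency s t) M.dim)
    (hbrick : ∀ h, IsHom M M h → ∃ c : k, ∀ x v, h x v = c • v) :
    M.Rigid ∧ form (adjacency s t) M.dim = 2 := by
  have h1 := (coboundary M M).finrank_range_add_finrank_ker
  have h2 : Module.finrank k (LinearMap.ker (coboundary M M)) ≤ 1 := by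
    have : LinearMap.ker (coboundary M M) ≤ Submodule.span k
        ({fun x => (LinearMap.id : M.V x →ₗ[k] M.V x)} : Set (∀ x, M.V x →ₗ[k] M.V x)) := by
      intro h hh
      obtain ⟨c, hc⟩ := hbrick h (isHom_iff.2 hh)
      refine Submodule.mem_span_singleton.2 ⟨c, ?_⟩
      ext x v
      simp [hc]
    exact (Submodule.finrank_mono this).trans ((finrank_span_le_card _).trans (by simp))
  have h3 := (LinearMap.range (coboundary M M)).finrank_le
  have h4 : Module.finrank k (∀ x, M.V x →ₗ[k] M.V x) = ∑ x, M.dim x ^ 2 := by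
    rw [Module.finrank_pi_fintype]
    exact sum_congr rfl fun x _ => by rw [Module.finrank_linearMap, sq, dim]
  have h5 : Module.finrank k (∀ e, M.V (s e) →ₗ[k] M.V (t e)) =
      ∑ e, M.dim (s e) * M.dim (t e) := by
    rw [Module.finrank_pi_fintype]
    exact sum_congr rfl fun x _ => by rw [Module.finrank_linearMap, dim, dim]
  rw [form_adjacency] at hpos ⊢
  have h6 : (0 : ℤ) < (∑ x, M.dim x ^ 2 : ℕ) - (∑ e, M.dim (s e) * M.dim (t e) : ℕ) := by
    push_cast; linarith
  rw [← h4, ← h5] at h6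
  have h7 : (2 * (∑ x, (M.dim x : ℤ) ^ 2 - ∑ e, (M.dim (s e) : ℤ) * M.dim (t e))) =
    2 * ((∑ x, M.dim x ^ 2 : ℕ) - (∑ e, M.dim (s e) * M.dim (t e) : ℕ)) := by push_cast; rfl
  rw [h7, ← h4, ← h5]
  refine ⟨?_, by omega⟩
  rw [Rigid, ← LinearMap.range_eq_top]
  exact Submodule.eq_top_of_finrank_eq (by omega)

end QuiverRep

end Quiver

end

section

section Quiver

open Finset

lemma exists_forall_le_of_exists {α : Type*} {P : α → Prop} (f : α → ℕ) (h : ∃ a, P a) :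
    ∃ a, P a ∧ ∀ b, P b → f a ≤ f b := by
  obtain ⟨a, ha, hmin⟩ := WellFounded.has_min (measure f).wf {a | P a} h
  exact ⟨a, ha, fun b hb => not_lt.1 (hmin b hb)⟩

variable {k : Type} [Field k]

lemma eq_of_sum_finrank_le {X : Type*} [Fintype X] {V : X → Type*} [∀ x, AddCommGroup (V x)]
    [∀ x, Module k (V x)] [∀ x, FiniteDimensional k (V x)] {R S : ∀ x, Submodule k (V x)}
    (h : ∀ x, R x ≤ S x)
    (hle : ∑ x, Module.finrank k (S x) ≤ ∑ x, Module.finrank k (R x)) (x : X) : R x = S x := by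
  refine Submodule.eq_of_le_of_finrank_le (h x) ?_
  have h1 : ∀ x ∈ univ, Module.finrank k (R x) ≤ Module.finrank k (S x) := fun x _ =>
    Submodule.finrank_mono (h x)
  exact ((sum_eq_sum_iff_of_le h1).1 (le_antisymm (sum_le_sum h1) hle) x (mem_univ x)).ge

namespace QuiverRep

variable {X E : Type} {s t : E → X}

lemma IsHom.comp {M N L : QuiverRep k s t} {g : ∀ x, N.V x →ₗ[k] L.V x}
    {f : ∀ x, M.V x →ₗ[k] N.V x} (hg : IsHom N L g) (hf : IsHom M N f) :
    IsHom M L fun x => g x ∘ₗ f x := fun e v => by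
  simp only [LinearMap.comp_apply]
  rw [hg, hf]

lemma IsHom.sub {M N : QuiverRep k s t} {g f : ∀ x, M.V x →ₗ[k] N.V x} (hg : IsHom M N g)
    (hf : IsHom M N f) : IsHom M N fun x => g x - f x := fun e v => by
  simp only [LinearMap.sub_apply, map_sub]
  rw [hg, hf]

lemma isHom_id (M : QuiverRep k s t) : IsHom M M fun _ => LinearMap.id := fun _ _ => rfl

/-- The endomorphism algebra of a representation. -/
def endAlgebra (M : QuiverRep k s t) : Subalgebra k (∀ x, Module.End k (M.V x)) where
  carrier := {h | IsHom M M h}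
  mul_mem' hg hf := hg.comp hf
  add_mem' {g f} hg hf e v := by
    simp only [Pi.add_apply, LinearMap.add_apply, map_add]
    rw [hg, hf]
  algebraMap_mem' c e v := by
    simp [Pi.algebraMap_apply, Module.algebraMap_end_apply]

variable [Fintype X] [Fintype E]

omit [Fintype E] in
lemma Indecomposable.exists_sq_eq_zero [IsAlgClosed k] {M : QuiverRep k s t}
    (hM : Indecomposable M) {h : ∀ x, M.V x →ₗ[k] M.V x} (hh : IsHom M M h)
    (hc : ∀ c : k, ∃ x v, h x v ≠ c • v) :
    ∃ θ : ∀ x, M.V x →ₗ[k] M.V x, IsHom M M θ ∧ (∃ x v, θ x v ≠ 0) ∧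
      ∀ x v, θ x (θ x v) = 0 := by
  obtain ⟨b, hb0, hb⟩ := exists_sq_eq_zero_of_idempotents_trivial (k := k) (D := M.endAlgebra)
    (fun p hp => by
      rcases hM.2 p.1 p.2 fun x v =>
        LinearMap.congr_fun (congrFun (congrArg Subtype.val hp) x) v with h | h
      · exact Or.inl (Subtype.ext (funext fun x => LinearMap.ext (h x)))
      · exact Or.inr (Subtype.ext (funext fun x => LinearMap.ext (h x))))
    ⟨h, hh⟩ (fun c hc' => by
      obtain ⟨x, v, hxv⟩ := hc c
      apply hxv
      have := LinearMap.congr_fun (congrFun (congrArg Subtype.val hc') x) v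
      simpa [Pi.algebraMap_apply, Module.algebraMap_end_apply] using this)
  refine ⟨b.1, b.2, ?_, fun x v =>
    LinearMap.congr_fun (congrFun (congrArg Subtype.val hb) x) v⟩
  by_contra! hcon
  exact hb0 (Subtype.ext (funext fun x => LinearMap.ext (hcon x)))

/-- If the Tits form is weakly positive, every indecomposable representation is rigid, and its
dimension vector is a root. -/
theorem Indecomposable.rigid [IsAlgClosed k]
    (hpos : ∀ d : X → ℕ, d ≠ 0 → 0 < form (adjacency s t) d) {M : QuiverRep k s t}
    (hM : Indecomposable M) : M.Rigid ∧ form (adjacency s t) M.dim = 2 := by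
  induction hn : ∑ x, M.dim x using Nat.strong_induction_on generalizing M with
  | _ n ih =>
  subst hn
  by_cases hbrick : ∀ h, IsHom M M h → ∃ c : k, ∀ x v, h x v = c • v
  · refine rigid_of_brick (hpos _ fun h0 => ?_) hbrick
    obtain ⟨x, v, hv⟩ := hM.1
    have : Subsingleton (M.V x) := Module.finrank_zero_iff.1 (congrFun h0 x)
    exact hv (Subsingleton.elim _ _)
  exfalso
  push Not at hbrick
  obtain ⟨h, hh, hc⟩ := hbrick
  obtain ⟨θ, ⟨hθ, hθ0, hθθ⟩, hθmin⟩ := exists_forall_le_of_exists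
    (fun θ : ∀ x, M.V x →ₗ[k] M.V x => ∑ x, Module.finrank k (LinearMap.range (θ x))) (hM.exists_sq_eq_zero hh hc)
  let K := kernel hθ
  let i : ∀ x, K.V x →ₗ[k] M.V x := fun x => (LinearMap.ker (θ x)).subtype
  have hi : IsHom K M i := fun _ _ => rfl
  let τ : ∀ x, M.V x →ₗ[k] K.V x := fun x => (θ x).codRestrict _ (hθθ x)
  have hτ : IsHom M K τ := fun e v => Subtype.ext (hθ e v)
  obtain ⟨p, ⟨hp, hpp, hpτ⟩, hpmin⟩ := exists_forall_le_of_exists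
    (P := fun p : ∀ x, K.V x →ₗ[k] K.V x => IsHom K K p ∧ (∀ x v, p x (p x v) = p x v) ∧
      ∃ x v, p x (τ x v) ≠ 0)
    (fun p => ∑ x, Module.finrank k (LinearMap.range (p x)))
    ⟨fun _ => LinearMap.id, isHom_id K, fun _ _ => rfl, by
      obtain ⟨x, v, hv⟩ := hθ0
      exact ⟨x, v, fun h => hv (congrArg Subtype.val h)⟩⟩
  let U := image hp
  let j : ∀ x, U.V x →ₗ[k] K.V x := fun x => (LinearMap.range (p x)).subtype
  have hj : IsHom U K j := fun _ _ => rfl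
  let π : ∀ x, K.V x →ₗ[k] U.V x := fun x => (p x).rangeRestrict
  have hπ : IsHom K U π := fun e v => Subtype.ext (hp e v)
  have hjπ : ∀ x v, j x (π x v) = p x v := fun _ _ => rfl
  have hπj : ∀ x u, π x (j x u) = u := by
    rintro x ⟨_, v, rfl⟩
    exact Subtype.ext (hpp x v)
  have hjinj : ∀ x u, j x u = 0 → u = 0 := fun x u h => by rw [← hπj x u, h, map_zero]
  have hU : Indecomposable U := by
    refine ⟨?_, fun q hq hqq => ?_⟩
    · obtain ⟨x, v, hv⟩ := hpτ
      exact ⟨x, π x (τ x v), fun h => hv (by rw [← hjπ, h, map_zero])⟩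
    · have key : ∀ q : ∀ x, U.V x →ₗ[k] U.V x, IsHom U U q → (∀ x v, q x (q x v) = q x v) →
          (∃ x v, j x (q x (π x (τ x v))) ≠ 0) → ∀ x v, q x v = v := by
        intro q hq hqq hne
        have hr := eq_of_sum_finrank_le (R := fun x => LinearMap.range (j x ∘ₗ q x ∘ₗ π x))
          (S := fun x => LinearMap.range (p x)) (fun x => by
            rintro _ ⟨v, rfl⟩
            exact (q x (π x v)).2)
          (hpmin (fun x => j x ∘ₗ q x ∘ₗ π x) ⟨hj.comp (hq.comp hπ), fun x v => by
            simp only [LinearMap.comp_apply, hπj, hqq], hne⟩)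
        intro x v
        have : j x v ∈ LinearMap.range (j x ∘ₗ q x ∘ₗ π x) := by
          rw [hr x]
          exact v.2
        obtain ⟨w, hw⟩ := this
        rw [← hπj x v, ← hw]
        simp only [LinearMap.comp_apply, hπj, hqq]
      by_cases hne : ∃ x v, j x (q x (π x (τ x v))) ≠ 0
      · exact Or.inr (key q hq hqq hne)
      · left
        push Not at hne
        have := key (fun x => LinearMap.id - q x) ((isHom_id U).sub hq)
          (fun x v => by simp [hqq]) (by
            obtain ⟨x, v, hv⟩ := hpτ
            refine ⟨x, v, ?_⟩
            rw [LinearMap.sub_apply, map_sub, hne, sub_zero]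
            exact hv)
        intro x v
        simpa using this x v
  have hθ'0 : ∃ x v, i x (j x (π x (τ x v))) ≠ 0 := by
    obtain ⟨x, v, hv⟩ := hpτ
    exact ⟨x, v, fun h => hv (Subtype.ext h)⟩
  have hσker : ∀ x, LinearMap.ker (π x ∘ₗ τ x) ≤ LinearMap.ker (θ x) := by
    have h1 := hθmin (fun x => i x ∘ₗ j x ∘ₗ π x ∘ₗ τ x)
      ⟨hi.comp (hj.comp (hπ.comp hτ)), hθ'0, fun x v => by
        have : τ x (i x (j x (π x (τ x v)))) = 0 :=
          Subtype.ext (LinearMap.mem_ker.1 (j x (π x (τ x v))).2)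
        simp only [LinearMap.comp_apply]
        rw [this]
        simp only [map_zero]⟩
    have hsum : ∀ g : ∀ x, M.V x →ₗ[k] M.V x, ∑ x, Module.finrank k (LinearMap.range (g x)) +
        ∑ x, Module.finrank k (LinearMap.ker (g x)) = ∑ x, M.dim x := fun g => by
      rw [← sum_add_distrib]
      exact sum_congr rfl fun x _ => (g x).finrank_range_add_finrank_ker
    have h2 := hsum θ
    have h3 := hsum fun x => i x ∘ₗ j x ∘ₗ π x ∘ₗ τ x
    have h4 := eq_of_sum_finrank_le (R := fun x => LinearMap.ker (θ x))
      (S := fun x => LinearMap.ker (i x ∘ₗ j x ∘ₗ π x ∘ₗ τ x)) (fun x v hv => by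
        have : τ x v = 0 := Subtype.ext hv
        rw [LinearMap.mem_ker]
        simp only [LinearMap.comp_apply]
        rw [this]
        simp only [map_zero]) (by omega)
    intro x v hv
    rw [h4 x, LinearMap.mem_ker, LinearMap.comp_apply, LinearMap.comp_apply,
      LinearMap.mem_ker.1 hv, map_zero, map_zero]
  have hlt : ∑ x, U.dim x < ∑ x, M.dim x := by
    have h1 : ∑ x, U.dim x ≤ ∑ x, Module.finrank k (LinearMap.ker (θ x)) :=
      sum_le_sum fun x _ => (LinearMap.range (p x)).finrank_le
    refine h1.trans_lt (not_le.1 fun h2 => ?_)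
    obtain ⟨x, v, hv⟩ := hθ0
    have h3 := eq_of_sum_finrank_le (R := fun x => LinearMap.ker (θ x)) (S := fun x => ⊤)
      (fun x => le_top) (by simpa only [finrank_top, dim] using h2) x
    exact hv (LinearMap.mem_ker.1 (h3.symm ▸ Submodule.mem_top))
  have hUr : Rigid U := (ih _ hlt hU rfl).1
  choose P hP using fun x => LinearMap.exists_extend (p := LinearMap.ker (θ x)) (π x)
  have hPi : ∀ x v, P x (i x v) = π x v := fun x v => LinearMap.congr_fun (hP x) v
  choose c' hc' using fun e => exists_comp_eq_of_ker_le (π (s e) ∘ₗ τ (s e))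
    (coboundary M U P e) (fun v hv => by
      have hv' := hσker _ hv
      let w : K.V (s e) := ⟨v, hv'⟩
      have h1 : P (s e) v = π (s e) w := hPi (s e) w
      have h2 : M.φ e v = i (t e) (K.φ e w) := rfl
      rw [LinearMap.mem_ker, coboundary_apply, LinearMap.sub_apply, LinearMap.comp_apply,
        LinearMap.comp_apply, h1, h2, hPi, hπ, sub_self])
  obtain ⟨η, hη⟩ := hUr c'
  let r : ∀ x, M.V x →ₗ[k] U.V x := fun x => P x - η x ∘ₗ π x ∘ₗ τ x
  have hr : IsHom M U r := by
    intro e v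
    have h1 := LinearMap.congr_fun (hc' e) v
    rw [← hη, coboundary_apply, coboundary_apply] at h1
    have h2 := (hπ.comp hτ) e v
    simp only [LinearMap.sub_apply, LinearMap.comp_apply] at h1 h2
    simp only [r, LinearMap.sub_apply, LinearMap.comp_apply, map_sub]
    rw [← h2, sub_eq_sub_iff_sub_eq_sub, ← h1]
  have hrj : ∀ x u, r x (i x (j x u)) = u := by
    intro x u
    have : τ x (i x (j x u)) = 0 := Subtype.ext (LinearMap.mem_ker.1 (j x u).2)
    simp only [r, LinearMap.sub_apply, LinearMap.comp_apply]
    rw [this, hPi, hπj, map_zero, map_zero, sub_zero]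
  rcases hM.2 (fun x => i x ∘ₗ j x ∘ₗ r x) (hi.comp (hj.comp hr)) (fun x v => by
    simp only [LinearMap.comp_apply, hrj]) with h0 | h1
  · obtain ⟨x, u, hu⟩ := hU.1
    apply hu
    have := h0 x (i x (j x u))
    simp only [LinearMap.comp_apply, hrj] at this
    exact hjinj x u (Subtype.ext this)
  · obtain ⟨x, v, hv⟩ := hθ0
    apply hv
    rw [← h1 x v]
    exact (j x (r x v)).2

end QuiverRep

end Quiver

end

section

section Quiver

open Finset
open scoped Matrix

namespace QuiverRep

variable {k : Type} [Field k] {X E : Type} {s t : E → X} [Fintype X] [Fintype E]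

open Polynomial in
omit [Fintype X] in
lemma exists_polynomial_of_line [Finite X] {W : Type*} [AddCommGroup W] [Module k W] [FiniteDimensional k W]
    {V : X → Type*} [∀ x, AddCommGroup (V x)] [∀ x, Module k (V x)]
    [∀ x, FiniteDimensional k (V x)] (T : W →ₗ[k] W) (δ : W)
    (S : W →ₗ[k] ∀ x, V x →ₗ[k] V x) :
    ∃ q : k[X], q ≠ 0 ∧ ∀ τ, q.eval τ ≠ 0 → ∃ (D : k) (w : W), (D * τ) • δ = w + τ • T w ∧
      ∀ x, LinearMap.det (D • 1 - S w x) ≠ 0 := by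
  classical
  have := Fintype.ofFinite X
  let b := Module.finBasis k W
  let c := fun x => Module.finBasis k (V x)
  let B : Matrix _ _ k[X] := 1 + (Polynomial.X : k[X]) • (LinearMap.toMatrix b b T).map C
  let w := B.adjugate.mulVec fun i => Polynomial.X * C (b.repr δ i)
  let G : ∀ x, Matrix _ _ k[X] := fun x =>
    B.det • 1 - ∑ i, w i • (LinearMap.toMatrix (c x) (c x) (S (b i) x)).map C
  have hB : ∀ τ, (evalRingHom τ).mapMatrix B = 1 + τ • LinearMap.toMatrix b b T := by
    intro τ
    ext i j
    simp [B, Matrix.one_apply, apply_ite, mul_comm τ]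
  have hw : ∀ τ, (B.det.eval τ * τ) • δ =
      (∑ i, (w i).eval τ • b i) + τ • T (∑ i, (w i).eval τ • b i) := by
    intro τ
    have h1 : B.mulVec w = fun i => B.det * (Polynomial.X * C (b.repr δ i)) := by
      simp only [w, Matrix.mulVec_mulVec, Matrix.mul_adjugate, Matrix.smul_mulVec, Matrix.one_mulVec]
      rfl
    have h2 : (1 + τ • LinearMap.toMatrix b b T).mulVec (fun i => (w i).eval τ) =
        fun i => B.det.eval τ * (τ * b.repr δ i) := by
      rw [← hB]
      ext i
      have := congrArg (eval τ) (congrFun h1 i)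
      simpa [Matrix.mulVec, dotProduct, eval_finsetSum, mul_comm τ] using this
    have h3 : ∀ u : W, LinearMap.toMatrix b b T *ᵥ b.repr u = b.repr (T u) :=
      fun u => LinearMap.toMatrix_mulVec_repr b b T u
    set u := ∑ i, (w i).eval τ • b i with hu
    have h4 : (fun i => (w i).eval τ) = b.repr u := by
      rw [hu, b.repr_sum_self]
    rw [h4, Matrix.add_mulVec, Matrix.one_mulVec, Matrix.smul_mulVec, h3] at h2
    apply b.repr.injective
    ext i
    have := congrFun h2 i
    simp only [Pi.add_apply, Pi.smul_apply] at this
    rw [map_add, map_smul, map_smul, Finsupp.add_apply, Finsupp.smul_apply, Finsupp.smul_apply, this,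
      smul_eq_mul, mul_assoc]
  have hG : ∀ τ x, (G x).det.eval τ =
      LinearMap.det (B.det.eval τ • 1 - S (∑ i, (w i).eval τ • b i) x) := by
    intro τ x
    rw [← LinearMap.det_toMatrix (c x), ← coe_evalRingHom, RingHom.map_det]
    congr 1
    ext i j
    simp [G, Matrix.one_apply, apply_ite, Matrix.sum_apply, eval_finsetSum, LinearMap.toMatrix_one]
  refine ⟨∏ x, (G x).det, fun h => ?_, fun τ hτ => ?_⟩
  · have h0 := congrArg (eval 0) h
    have hB0 : B.det.eval 0 = 1 := by
      rw [← coe_evalRingHom, RingHom.map_det, hB]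
      simp
    have hw0 : ∀ i, (w i).eval 0 = 0 := by
      intro i
      simp [w, Matrix.mulVec, dotProduct, eval_finsetSum]
    simp [eval_prod, hG, hB0, hw0] at h0
  · rw [eval_prod, prod_ne_zero_iff] at hτ
    exact ⟨_, _, hw τ, fun x => hG τ x ▸ hτ x (mem_univ x)⟩

open Polynomial in
omit [Fintype E] in
/-- A rigid representation is isomorphic to all but finitely many representations on a line
through it. -/
lemma Rigid.exists_polynomial {M : QuiverRep k s t} [Finite E] (hM : M.Rigid)
    (Δ : ∀ e, M.V (s e) →ₗ[k] M.V (t e)) :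
    ∃ q : k[X], q ≠ 0 ∧ ∀ τ, q.eval τ ≠ 0 → ∃ f : ∀ x, M.V x ≃ₗ[k] M.V x,
      ∀ e v, (M.φ e + τ • Δ e) (f (s e) v) = f (t e) (M.φ e v) := by
  obtain ⟨σ, hσ⟩ := (coboundary M M).exists_rightInverse_of_surjective (LinearMap.range_eq_top.2 hM)
  let T : (∀ e, M.V (s e) →ₗ[k] M.V (t e)) →ₗ[k] (∀ e, M.V (s e) →ₗ[k] M.V (t e)) :=
    { toFun := fun w e => Δ e ∘ₗ σ w (s e)
      map_add' := fun w w' => by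
        ext e v
        simp
      map_smul' := fun c w => by
        ext e v
        simp }
  obtain ⟨q, hq0, hq⟩ := exists_polynomial_of_line T Δ σ
  refine ⟨q, hq0, fun τ hτ => ?_⟩
  obtain ⟨D, w, hw, hdet⟩ := hq τ hτ
  refine ⟨fun x => LinearEquiv.ofIsUnitDet (f := D • 1 - σ w x) (v := Module.finBasis k _)
    (v' := Module.finBasis k _)
    (by rw [LinearMap.det_toMatrix]; exact (hdet x).isUnit), fun e v => ?_⟩
  have h1 := LinearMap.congr_fun (congrFun hw e) v
  have h2 := LinearMap.congr_fun (congrFun (LinearMap.congr_fun hσ w) e) v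
  simp only [LinearMap.comp_apply, coboundary_apply, LinearMap.sub_apply, LinearMap.id_apply] at h2
  simp only [Pi.smul_apply, Pi.add_apply, LinearMap.smul_apply, LinearMap.add_apply, T, ← h2,
    LinearMap.coe_mk, AddHom.coe_mk, LinearMap.comp_apply] at h1
  simp only [LinearEquiv.ofIsUnitDet_apply, LinearMap.sub_apply, LinearMap.smul_apply,
    Module.End.one_apply, LinearMap.add_apply, map_sub, map_smul, mul_smul] at h1 ⊢
  rw [← sub_eq_zero] at h1 ⊢
  rw [← h1]
  module

/-- Two rigid representations with the same dimension vector are isomorphic. -/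
theorem Rigid.exists_equiv [Infinite k] {M N : QuiverRep k s t} (hM : M.Rigid) (hN : N.Rigid)
    (hdim : M.dim = N.dim) :
    ∃ f : ∀ x, M.V x ≃ₗ[k] N.V x, ∀ e v, N.φ e (f (s e) v) = f (t e) (M.φ e v) := by
  classical
  let g : ∀ x, N.V x ≃ₗ[k] M.V x := fun x =>
    LinearEquiv.ofFinrankEq _ _ (congrFun hdim x).symm
  let N' : QuiverRep k s t :=
    { V := M.V
      φ := fun e => (g (t e)).toLinearMap ∘ₗ N.φ e ∘ₗ (g (s e)).symm.toLinearMap }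
  have hN' : N'.Rigid := by
    intro c
    obtain ⟨η, hη⟩ := hN fun e =>
      (g (t e)).symm.toLinearMap ∘ₗ c e ∘ₗ (g (s e)).toLinearMap
    refine ⟨fun x => (g x).toLinearMap ∘ₗ η x ∘ₗ (g x).symm.toLinearMap, ?_⟩
    ext e v
    have := congrArg (g (t e)) (LinearMap.congr_fun (congrFun hη e) ((g (s e)).symm v))
    simpa [coboundary_apply, N'] using this
  obtain ⟨q, hq0, hq⟩ := hM.exists_polynomial fun e => N'.φ e - M.φ e
  obtain ⟨q', hq'0, hq'⟩ := hN'.exists_polynomial fun e => M.φ e - N'.φ e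
  obtain ⟨τ, hτ⟩ : ∃ τ, τ ∉ {τ | q.IsRoot τ} ∪ (fun τ => 1 - τ) ⁻¹' {τ | q'.IsRoot τ} :=
    ((Polynomial.finite_setOfPred_isRoot hq0).union ((Polynomial.finite_setOfPred_isRoot hq'0).preimage
      (sub_right_injective.injOn))).exists_notMem
  simp only [Set.mem_union, Set.mem_preimage, Set.mem_ofPred_eq, not_or] at hτ
  obtain ⟨f, hf⟩ := hq τ hτ.1
  obtain ⟨f', hf'⟩ := hq' (1 - τ) hτ.2
  refine ⟨fun x => ((f x).trans (f' x).symm).trans (g x).symm, fun e v => ?_⟩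
  have h1 := hf e v
  have h2 := hf' e ((f' (s e)).symm (f (s e) v))
  have h3 : M.φ e + τ • (N'.φ e - M.φ e) = N'.φ e + (1 - τ) • (M.φ e - N'.φ e) := by
    module
  rw [h3] at h1
  have h4 : N'.φ e ((f' (s e)).symm (f (s e) v)) = (f' (t e)).symm (f (t e) (M.φ e v)) := by
    rw [LinearEquiv.eq_symm_apply, ← h2, ← h1]
    congr 1
    exact LinearEquiv.apply_symm_apply _ _
  have h5 := congrArg (g (t e)).symm h4
  simpa [N'] using h5

end QuiverRep

end Quiver

end

section

/-- If finitely many polynomial maps from affine `m`-space cover affine `n`-space over an infinite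
field, then `n ≤ m`. -/
lemma card_le_of_polynomial_cover {k : Type*} [Field k] [Infinite k] {ι σ τ : Type*} [Finite ι]
    [Fintype σ] [Fintype τ] (P : ι → σ → MvPolynomial τ k)
    (h : ∀ y : σ → k, ∃ i x, ∀ s, y s = MvPolynomial.eval x (P i s)) :
    Fintype.card σ ≤ Fintype.card τ := by
  have := Fintype.ofFinite ι
  by_contra hlt
  have hdep : ∀ i, ∃ Q : MvPolynomial σ k, Q ≠ 0 ∧ MvPolynomial.aeval (P i) Q = 0 := by
    intro i
    by_contra! hcon
    have hind : AlgebraicIndependent k (P i) := by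
      rw [algebraicIndependent_iff]
      exact fun Q hQ => by_contra fun hne => hcon Q hne hQ
    have h1 := hind.lift_cardinalMk_le_trdeg
    rw [MvPolynomial.trdeg_of_isDomain] at h1
    simp at h1
    exact hlt h1
  choose Q hQ0 hQ using hdep
  have hprod : ∏ i, Q i = 0 := by
    refine MvPolynomial.funext fun y => ?_
    obtain ⟨i, x, hx⟩ := h y
    rw [map_prod, map_zero]
    refine Finset.prod_eq_zero (Finset.mem_univ i) ?_
    have h1 := congrArg (MvPolynomial.eval x) (hQ i)
    rw [map_zero] at h1
    rw [← h1, ← MvPolynomial.coe_aeval_eq_eval, ← MvPolynomial.coe_aeval_eq_eval]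
    have : y = fun s => MvPolynomial.aeval x (P i s) := funext hx
    rw [this]
    change _ = ((MvPolynomial.aeval x).comp (MvPolynomial.aeval (P i))) (Q i)
    rw [MvPolynomial.comp_aeval]
    rfl
  exact (Finset.prod_ne_zero_iff.2 fun i _ => hQ0 i) hprod

end

section

/-- A system of orthogonal idempotents generating a basic algebra Morita equivalent to `A`. -/
structure IdempotentSystem (k A : Type) [Field k] [Ring A] [Algebra k A] where
  /-- The index set of the idempotents. -/
  I : Type
  [fintypeI : Fintype I]
  [decidableEqI : DecidableEq I]
  /-- The idempotents. -/
  e : I → A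
  orthogonal : OrthogonalIdempotents e
  ne_zero : ∀ i, e i ≠ 0
  exists_scalar : ∀ i a, ∃ c : k, e i * a * e i - c • e i ∈ Ring.jacobson A
  off_diagonal : ∀ i j a, i ≠ j → e i * a * e j ∈ Ring.jacobson A
  /-- The index set of a decomposition of the unit. -/
  S : Type
  [fintypeS : Fintype S]
  /-- Left coefficients in the decomposition of the unit. -/
  l : S → A
  /-- Right coefficients in the decomposition of the unit. -/
  r : S → A
  full : ∑ x, l x * (∑ i, e i) * r x = 1

attribute [instance] IdempotentSystem.fintypeI IdempotentSystem.decidableEqI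
  IdempotentSystem.fintypeS

variable {k A : Type} [Field k] [Ring A] [Algebra k A]

theorem nonempty_idempotentSystem [IsAlgClosed k] [FiniteDimensional k A]
    (hJ : ∀ x ∈ Ring.jacobson A, ∀ y ∈ Ring.jacobson A, x * y = 0) :
    Nonempty (IdempotentSystem k A) := by
  have : IsArtinianRing A := IsArtinianRing.of_finite k A
  obtain ⟨n, d, hd, ⟨Φ⟩⟩ :=
    IsSemisimpleRing.exists_algEquiv_pi_matrix_of_isAlgClosed k (A ⧸ Ring.jacobson A)
  let f : A →ₐ[k] ∀ i, Matrix (Fin (d i)) (Fin (d i)) k :=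
    Φ.toAlgHom.comp (Ideal.Quotient.mkₐ k (Ring.jacobson A))
  have hfs : Function.Surjective f := Φ.surjective.comp (Ideal.Quotient.mkₐ_surjective k _)
  have hfk : ∀ x, f x = 0 ↔ x ∈ Ring.jacobson A := fun x => by
    rw [← Ideal.Quotient.eq_zero_iff_mem]
    exact map_eq_zero_iff Φ Φ.injective
  have hmem : ∀ x y, f x = f y → x - y ∈ Ring.jacobson A := fun x y h => by
    rw [← hfk, map_sub, h, sub_self]
  let E : ∀ i, ∀ i, Matrix (Fin (d i)) (Fin (d i)) k := fun i => Pi.single i (Matrix.single 0 0 1)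
  have hE : OrthogonalIdempotents E := by
    refine ⟨fun i => ?_, fun i j hij => ?_⟩
    · change E i * E i = E i
      rw [← Pi.single_mul]
      simp [E]
    · change E i * E j = 0
      ext x
      by_cases h : x = i
      · subst h
        simp [E, hij]
      · simp [E, h]
  obtain ⟨e, he, hfe⟩ := hE.lift_of_isNilpotent_ker f.toRingHom
    (fun x hx => ⟨2, by
      rw [sq]
      exact hJ _ ((hfk x).1 hx) _ ((hfk x).1 hx)⟩) (fun i => hfs (E i))
  have hfe : ∀ i, f (e i) = E i := fun i => congrFun hfe i
  choose l hl using fun x : Σ i, Fin (d i) =>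
    hfs (Pi.single x.1 (Matrix.single x.2 0 1))
  choose r hr using fun x : Σ i, Fin (d i) =>
    hfs (Pi.single x.1 (Matrix.single 0 x.2 1))
  set u := ∑ x, l x * (∑ i, e i) * r x with hu
  have hfu : f u = 1 := by
    have h1 : ∀ x : Σ i, Fin (d i), f (l x * (∑ i, e i) * r x) =
        Pi.single x.1 (Matrix.single x.2 x.2 1) := by
      intro x
      rw [map_mul, map_mul, map_sum, hl, hr]
      simp only [hfe]
      ext y : 1
      by_cases h : y = x.1
      · subst h
        simp [E]
      · simp [h]
    rw [hu, map_sum, Finset.sum_congr rfl fun x _ => h1 x, Fintype.sum_sigma]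
    have h2 : ∀ i, ∑ a, Pi.single (M := fun i => Matrix (Fin (d i)) (Fin (d i)) k) i
        (Matrix.single a a 1) = Pi.single i ((1 : ∀ i, Matrix (Fin (d i)) (Fin (d i)) k) i) := by
      intro i
      have h3 : ∑ a : Fin (d i), Matrix.single a a (1 : k) = 1 := by
        ext a b
        simp [Matrix.sum_apply, Matrix.single_apply, Matrix.one_apply, ite_and]
      rw [Pi.one_apply, ← h3]
      exact (map_sum (AddMonoidHom.single (fun i => Matrix (Fin (d i)) (Fin (d i)) k) i) _ _).symm
    rw [Finset.sum_congr rfl fun i _ => h2 i]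
    exact Finset.univ_sum_single 1
  refine ⟨⟨Fin n, e, he, fun i h => ?_, fun i a => ?_, fun i j a hij => ?_, Σ i, Fin (d i), l,
    fun x => r x * (2 - u), ?_⟩⟩
  · have := hfe i
    rw [h, map_zero] at this
    have := congrFun (congrFun (congrFun this i) 0) 0
    simp [E] at this
  · refine ⟨f a i 0 0, hmem _ _ ?_⟩
    rw [map_mul, map_mul, map_smul, hfe]
    ext x : 1
    by_cases h : x = i
    · subst h
      simp [E]
    · simp [E, h]
  · rw [← hfk, map_mul, map_mul, hfe, hfe]
    ext x : 1
    by_cases h : x = i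
    · subst h
      simp [E, hij]
    · simp [E, h]
  · have h1 : (u - 1) * (u - 1) = 0 := hJ _ (hmem _ _ (by rw [hfu, map_one])) _
      (hmem _ _ (by rw [hfu, map_one]))
    simp only [← mul_assoc]
    rw [← Finset.sum_mul, ← hu]
    have h2 : u * (2 - u) = 1 - (u - 1) * (u - 1) := by noncomm_ring
    rw [h2, h1, sub_zero]

end

section

section Automorphisms

variable {k A : Type} [Field k] [Ring A] [Algebra k A]

lemma exists_ker_add_lt {M : Type*} [AddCommGroup M] [Module A M] [Module k M]
    [IsScalarTower k A M] [FiniteDimensional k M] [IsSemisimpleModule A M] (g : M →ₗ[A] M)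
    (hg : LinearMap.ker g ≠ ⊥) (L : Submodule A M) (hL : LinearMap.range g ⊔ L = ⊤) :
    ∃ u : M →ₗ[A] L, LinearMap.ker (g + L.subtype ∘ₗ u) < LinearMap.ker g := by
  obtain ⟨S, hS, hSs⟩ :=
    (IsSemisimpleModule.eq_bot_or_exists_simple_le (LinearMap.ker g)).resolve_left hg
  obtain ⟨ρ, hρ⟩ := IsSemisimpleModule.extension_property S.subtype S.subtype_injective
    (LinearMap.id : S →ₗ[A] S)
  have : SMulCommClass A k M := IsScalarTower.to_smulCommClass'
  have : FiniteDimensional k S :=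
    Module.Finite.of_injective (S.subtype.restrictScalars k) S.subtype_injective
  have : FiniteDimensional k (S →ₗ[A] M) :=
    Module.Finite.of_injective (LinearMap.restrictScalarsₗ k A S M k)
      (LinearMap.restrictScalars_injective k)
  let c : (S →ₗ[A] M) →ₗ[k] (S →ₗ[A] M) :=
    { toFun := fun h => g ∘ₗ h
      map_add' := fun _ _ => LinearMap.comp_add _ _ _
      map_smul' := fun a h => by
        ext x
        exact LinearMap.map_smul_of_tower g a (h x) }
  have hSnt : Nontrivial S := IsSimpleModule.nontrivial A S
  have hc : ¬ Function.Surjective c := by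
    rw [← LinearMap.injective_iff_surjective]
    intro hinj
    have h0 : S.subtype = 0 := hinj (by
      rw [map_zero]
      ext x
      exact LinearMap.mem_ker.1 (hS x.2))
    obtain ⟨x, hx⟩ := exists_ne (0 : S)
    exact hx (Subtype.ext (LinearMap.congr_fun h0 x))
  obtain ⟨w, hw⟩ : ∃ w, ∀ h, c h ≠ w := by simpa [Function.Surjective] using hc
  let q := (LinearMap.range g).mkQ
  have hqw : q ∘ₗ w ≠ 0 := by
    intro h0
    have hwr : ∀ x, w x ∈ LinearMap.range g := fun x =>
      (Submodule.Quotient.mk_eq_zero _).1 (LinearMap.congr_fun h0 x)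
    obtain ⟨h, hh⟩ := IsSemisimpleModule.lifting_property g.rangeRestrict
      g.surjective_rangeRestrict (w.codRestrict _ hwr)
    exact hw h (LinearMap.ext fun x => congrArg Subtype.val (LinearMap.congr_fun hh x))
  obtain ⟨v, hv⟩ := IsSemisimpleModule.lifting_property (q ∘ₗ L.subtype) (fun y => by
    obtain ⟨y, rfl⟩ := (LinearMap.range g).mkQ_surjective y
    obtain ⟨a, ha, b, hb, rfl⟩ := Submodule.mem_sup.1 (hL ▸ Submodule.mem_top : y ∈ _)
    refine ⟨⟨b, hb⟩, ?_⟩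
    have : q a = 0 := (Submodule.Quotient.mk_eq_zero _).2 ha
    change q b = q (a + b)
    rw [map_add, this, zero_add]) (q ∘ₗ w)
  have hvinj : Function.Injective (q ∘ₗ L.subtype ∘ₗ v) :=
    LinearMap.injective_of_ne_zero (by rw [← LinearMap.comp_assoc, hv]; exact hqw)
  have hker : ∀ x, x ∈ LinearMap.ker (g + L.subtype ∘ₗ v ∘ₗ ρ) → ρ x = 0 ∧ g x = 0 := by
    intro x hx
    have hx' : g x + (v (ρ x) : M) = 0 := hx
    have h1 : ρ x = 0 := by
      apply hvinj
      rw [map_zero]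
      refine (Submodule.Quotient.mk_eq_zero _).2 ⟨-x, ?_⟩
      rw [map_neg]
      exact neg_eq_of_add_eq_zero_right hx'
    refine ⟨h1, ?_⟩
    rwa [h1, map_zero, ZeroMemClass.coe_zero, add_zero] at hx'
  refine ⟨v ∘ₗ ρ, lt_of_le_of_ne (fun x hx => (hker x hx).2) fun heq => ?_⟩
  obtain ⟨x, hx⟩ := exists_ne (0 : S)
  apply hx
  rw [← LinearMap.id_apply (R := A) x, ← hρ]
  exact (hker x.1 (heq ▸ hS x.2)).1

lemma isSemisimpleModule_quotient_jacobson [FiniteDimensional k A] (P : Type*) [AddCommGroup P]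
    [Module A P] : IsSemisimpleModule A (P ⧸ Ring.jacobson A • (⊤ : Submodule A P)) := by
  have : IsArtinianRing A := IsArtinianRing.of_finite k A
  have h : Module.IsTorsionBySet A (P ⧸ Ring.jacobson A • (⊤ : Submodule A P))
      (Ring.jacobson A) := by
    rw [Module.isTorsionBySet_quotient_iff]
    exact fun m i hi ↦ Submodule.smul_mem_smul hi trivial
  let _ := h.module
  exact (h.semilinearMap.isSemisimpleModule_iff_of_bijective Function.bijective_id).2 inferInstance

/-- Two projective presentations of a module by the same finitely generated projective module
differ by an automorphism. -/
theorem exists_equiv_of_surjective [FiniteDimensional k A] {P Q : Type*} [AddCommGroup P]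
    [Module A P] [Module k P] [IsScalarTower k A P] [Module.Finite A P] [Module.Projective A P]
    [AddCommGroup Q] [Module A Q] {f f' : P →ₗ[A] Q} (hf : Function.Surjective f)
    (hf' : Function.Surjective f') : ∃ g : P ≃ₗ[A] P, f' ∘ₗ g.toLinearMap = f := by
  have : IsArtinianRing A := IsArtinianRing.of_finite k A
  let N := Ring.jacobson A • (⊤ : Submodule A P)
  have := isSemisimpleModule_quotient_jacobson (k := k) (A := A) P
  have : FiniteDimensional k P := Module.Finite.trans A P
  have hN : ∀ h : P →ₗ[A] P, N ≤ N.comap h := fun h => by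
    rw [← Submodule.map_le_iff_le_comap, Submodule.map_smul'']
    exact Submodule.smul_mono le_rfl le_top
  let bar : (P →ₗ[A] P) → (P ⧸ N →ₗ[A] P ⧸ N) := fun h => N.mapQ N h (hN h)
  obtain ⟨g₀, hg₀⟩ := Module.projective_lifting_property f' f hf'
  obtain ⟨_, ⟨g, hg, rfl⟩, hmin⟩ := (IsWellFounded.wf (r := ((· < ·) :
    Submodule A (P ⧸ N) → Submodule A (P ⧸ N) → Prop))).has_min
    {B | ∃ g, f' ∘ₗ g = f ∧ LinearMap.ker (bar g) = B} ⟨_, g₀, hg₀, rfl⟩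
  have hker : LinearMap.ker (bar g) = ⊥ := by
    by_contra hne
    let L := (LinearMap.ker f').map N.mkQ
    obtain ⟨u, hu⟩ := exists_ker_add_lt (k := k) (bar g) hne L (by
      rw [eq_top_iff]
      intro y _
      obtain ⟨y, rfl⟩ := N.mkQ_surjective y
      obtain ⟨x, hx⟩ := hf (f' y)
      rw [← hg, LinearMap.comp_apply] at hx
      refine Submodule.mem_sup.2 ⟨N.mkQ (g x), ⟨N.mkQ x, rfl⟩, N.mkQ (y - g x),
        ⟨y - g x, ?_, rfl⟩, ?_⟩
      · rw [SetLike.mem_coe, LinearMap.mem_ker, map_sub, hx, sub_self]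
      · rw [← map_add, add_sub_cancel])
    obtain ⟨h, hh⟩ := Module.projective_lifting_property
      (N.mkQ.submoduleMap (LinearMap.ker f')) (u ∘ₗ N.mkQ)
      (N.mkQ.submoduleMap_surjective (LinearMap.ker f'))
    refine hmin _ ⟨g + (LinearMap.ker f').subtype ∘ₗ h, ?_, rfl⟩ ?_
    · ext x
      have : f' (h x) = 0 := (h x).2
      simp [← hg, this]
    · have hbar : bar (g + (LinearMap.ker f').subtype ∘ₗ h) = bar g + L.subtype ∘ₗ u := ?_
      · rwa [hbar]
      refine LinearMap.ext fun x => ?_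
      obtain ⟨x, rfl⟩ := N.mkQ_surjective x
      have := congrArg Subtype.val (LinearMap.congr_fun hh x)
      simp only [LinearMap.comp_apply] at this
      change N.mkQ (g x + h x) = N.mkQ (g x) + (u (N.mkQ x) : P ⧸ N)
      rw [← this, map_add]
      rfl
  have hbs : Function.Surjective (bar g) :=
    IsArtinian.surjective_of_injective_endomorphism _ (LinearMap.ker_eq_bot.1 hker)
  have hgs : Function.Surjective g := by
    rw [← LinearMap.range_eq_top, ← Submodule.Quotient.subsingleton_iff,
      ← Submodule.subsingleton_iff A, ← subsingleton_iff_bot_eq_top, eq_comm]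
    refine Submodule.FG.eq_bot_of_le_jacobson_smul Module.Finite.fg_top fun y _ => ?_
    obtain ⟨y, rfl⟩ := (LinearMap.range g).mkQ_surjective y
    obtain ⟨x, hx⟩ := hbs (N.mkQ y)
    obtain ⟨x, rfl⟩ := N.mkQ_surjective x
    have h1 : y - g x ∈ N := (Submodule.Quotient.eq N).1 hx.symm
    have h2 : (LinearMap.range g).mkQ y = (LinearMap.range g).mkQ (y - g x) := by
      rw [map_sub]
      have : (LinearMap.range g).mkQ (g x) = 0 := (Submodule.Quotient.mk_eq_zero _).2 ⟨x, rfl⟩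
      rw [this, sub_zero]
    rw [h2]
    have h3 := Submodule.mem_map_of_mem (f := (LinearMap.range g).mkQ) h1
    rw [Submodule.map_smul''] at h3
    exact Submodule.smul_mono le_rfl le_top h3
  refine ⟨LinearEquiv.ofBijective g ⟨?_, hgs⟩, hg⟩
  have : Function.Injective (g.restrictScalars k) :=
    LinearMap.injective_iff_surjective.2 hgs
  exact this

end Automorphisms

end

section

section RowIdeals

variable {A : Type} [Ring A] {m : Type} [Fintype m] [DecidableEq m]

/-- The left ideal of all matrices whose rows belong to a given submodule. -/
def rowIdeal (K : Submodule A (m → A)) : Submodule (Matrix m m A) (Matrix m m A) where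
  carrier := {M | ∀ i, M i ∈ K}
  add_mem' hM hN i := K.add_mem (hM i) (hN i)
  zero_mem' _ := K.zero_mem
  smul_mem' N M hM i := by
    have : (N • M) i = ∑ j, N i j • M j := by
      ext l
      simp [Matrix.mul_apply]
    rw [this]
    exact K.sum_mem fun j _ => K.smul_mem _ (hM j)

lemma exists_rowIdeal_eq (L : Submodule (Matrix m m A) (Matrix m m A)) :
    ∃ K, rowIdeal K = L := by
  let K : Submodule A (m → A) :=
    { carrier := {x | ∀ i, Matrix.of (fun j => if j = i then x else 0) ∈ L}
      add_mem' := fun {x y} hx hy i => by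
        convert L.add_mem (hx i) (hy i) using 1
        ext a b
        by_cases h : a = i <;> simp [h]
      zero_mem' := fun i => by
        convert L.zero_mem using 1
        ext a b
        simp
      smul_mem' := fun c x hx i => by
        convert L.smul_mem (Matrix.single i i c) (hx i) using 1
        ext a b
        by_cases h : a = i
        · subst h
          simp
        · simp [h] }
  refine ⟨K, le_antisymm (fun M hM => ?_) fun M hM i j => ?_⟩
  · have : M = ∑ i, Matrix.of (fun j => if j = i then M i else 0) := by
      ext a b
      simp [Matrix.sum_apply, ite_apply]
    rw [this]
    exact L.sum_mem fun i _ => hM i i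
  · convert L.smul_mem (Matrix.single j i 1) hM using 1
    ext a b
    by_cases h : a = j
    · subst h
      simp
    · simp [h]

lemma conj_rowIdeal_iff [Nonempty m] {K K' : Submodule A (m → A)} :
    ConjLeftIdeal (Matrix m m A) (rowIdeal K) (rowIdeal K') ↔
      ∃ u : (Matrix m m A)ˣ, ∀ x, x ∈ K ↔ Matrix.vecMul x u.1 ∈ K' := by
  have hrow : ∀ (M N : Matrix m m A) i, (M * N) i = Matrix.vecMul (M i) N := fun _ _ _ => rfl
  constructor
  · rintro ⟨u, hu⟩
    refine ⟨u⁻¹, fun x => ?_⟩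
    obtain ⟨i⟩ := ‹Nonempty m›
    have h1 : x ∈ K ↔ Matrix.of (fun _ => x) ∈ rowIdeal K := ⟨fun h _ => h, fun h => h i⟩
    have h2 : Matrix.vecMul x (u⁻¹).1 ∈ K' ↔ Matrix.of (fun _ => x) * (u⁻¹).1 ∈ rowIdeal K' :=
      ⟨fun h _ => h, fun h => h i⟩
    rw [h1, h2, ← SetLike.mem_coe (A := Submodule (Matrix m m A) (Matrix m m A)) (p := rowIdeal K'), hu]
    constructor
    · intro h
      refine ⟨(u⁻¹).1 * _, (rowIdeal K).smul_mem _ h, ?_⟩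
      simp only [← mul_assoc, Units.mul_inv, one_mul]
    · rintro ⟨Y, hY, h⟩
      have : Matrix.of (fun _ => x) = u.1 * Y := (Units.mul_left_inj u⁻¹).1 h.symm
      rw [this]
      exact (rowIdeal K).smul_mem _ hY
  · rintro ⟨u, hu⟩
    refine ⟨u⁻¹, Set.ext fun Z => ?_⟩
    have h1 : ∀ M, M ∈ rowIdeal K ↔ M * u.1 ∈ rowIdeal K' := fun M =>
      forall_congr' fun i => hu (M i)
    rw [inv_inv]
    constructor
    · intro hZ
      refine ⟨u.1 * (Z * (u⁻¹).1), (rowIdeal K).smul_mem _ ((h1 _).2 ?_), ?_⟩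
      · simpa [mul_assoc] using hZ
      · simp [mul_assoc]
    · rintro ⟨M, hM, rfl⟩
      have := (rowIdeal K').smul_mem (u⁻¹).1 ((h1 M).1 hM)
      simpa [mul_assoc] using this

lemma exists_vecMul_eq (g : (m → A) ≃ₗ[A] (m → A)) :
    ∃ u : (Matrix m m A)ˣ, ∀ x, Matrix.vecMul x u.1 = g x := by
  have h1 : ∀ (f : (m → A) →ₗ[A] (m → A)) x, Matrix.vecMul x (LinearMap.toMatrixRight' f) = f x := by
    intro f x
    rw [← Matrix.toLinearMapRight'_apply]
    simp
  refine ⟨⟨LinearMap.toMatrixRight' g.toLinearMap, LinearMap.toMatrixRight' g.symm.toLinearMap,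
    ?_, ?_⟩, h1 g.toLinearMap⟩
  all_goals
    refine Matrix.ext_of_single_vecMul fun i => ?_
    rw [← Matrix.vecMul_vecMul, h1, h1]
    simp

end RowIdeals

section FiniteType

variable {A : Type} [Ring A]

/-- Over an algebra of finite representation type there are only finitely many isomorphism classes
of modules of bounded length. -/
lemma exists_finite_modules_of_length_le (hA : FiniteRepresentationType A) (n : ℕ) :
    ∃ (ι : Type) (_ : Finite ι) (M : ι → ModuleCat.{0} A),
      ∀ (N : ModuleCat.{0} A), Module.Finite A N → Module.length A N ≤ n →
        ∃ i, Nonempty (N ≃ₗ[A] M i) := by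
  obtain ⟨κ, _, T, hT⟩ := hA
  induction n with
  | zero =>
    refine ⟨Unit, inferInstance, fun _ => ModuleCat.of A PUnit, fun N _ hN => ⟨(), ?_⟩⟩
    have : Subsingleton N := Module.length_eq_zero_iff.1 (le_antisymm hN bot_le)
    exact ⟨0⟩
  | succ n ih =>
    obtain ⟨ι, _, M, hM⟩ := ih
    refine ⟨κ ⊕ ι × ι ⊕ Unit, inferInstance, Sum.elim T (Sum.elim
      (fun p => ModuleCat.of A (M p.1 × M p.2)) fun _ => ModuleCat.of A PUnit), fun N _ hN => ?_⟩
    by_cases h0 : Subsingleton N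
    · exact ⟨Sum.inr (Sum.inr ()), ⟨(0 : N ≃ₗ[A] PUnit)⟩⟩
    by_cases hind : IsIndecomposableModule A N
    · obtain ⟨i, hi⟩ := hT N inferInstance hind
      exact ⟨Sum.inl i, hi⟩
    have : Nontrivial N := not_subsingleton_iff_nontrivial.1 h0
    simp only [IsIndecomposableModule, exists_ne (0 : N), true_and] at hind
    push Not at hind
    obtain ⟨N₁, N₂, hc, h1, h2⟩ := hind
    let e := Submodule.prodEquivOfIsCompl N₁ N₂ hc
    have hfin : Module.Finite A (N₁ × N₂) := Module.Finite.equiv e.symm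
    have hfin1 : Module.Finite A N₁ := Module.Finite.of_surjective (LinearMap.fst A N₁ N₂) Prod.fst_surjective
    have hfin2 : Module.Finite A N₂ := Module.Finite.of_surjective (LinearMap.snd A N₁ N₂) Prod.snd_surjective
    have hlen : Module.length A N₁ + Module.length A N₂ ≤ n + 1 := by
      rw [← Module.length_prod, e.length_eq]
      exact_mod_cast hN
    have h1' : 1 ≤ Module.length A N₁ := Order.one_le_iff_ne_zero.2 fun h =>
      h1 ((Submodule.subsingleton_iff_eq_bot).1 (Module.length_eq_zero_iff.1 h))
    have h2' : 1 ≤ Module.length A N₂ := Order.one_le_iff_ne_zero.2 fun h =>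
      h2 ((Submodule.subsingleton_iff_eq_bot).1 (Module.length_eq_zero_iff.1 h))
    obtain ⟨i, ⟨f⟩⟩ := hM (ModuleCat.of A N₁) hfin1 (by
      refine (ENat.add_le_add_iff_right (k := 1) (by simp)).1 ?_
      exact (add_le_add_right h2' _).trans hlen)
    obtain ⟨j, ⟨g⟩⟩ := hM (ModuleCat.of A N₂) hfin2 (by
      refine (ENat.add_le_add_iff_left (k := 1) (by simp)).1 ?_
      exact ((add_le_add_left h1' _).trans hlen).trans (add_comm _ _).le)
    exact ⟨Sum.inr (Sum.inl (i, j)), ⟨e.symm.trans (f.prodCongr g)⟩⟩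

/-- Over an algebra of finite representation type, all matrix algebras have finitely many conjugacy
classes of left ideals. -/
theorem hasFinitelyManyConjClasses_of_finiteRepresentationType {k : Type} [Field k] [Algebra k A]
    [FiniteDimensional k A] (hA : FiniteRepresentationType A) (m : Type) [Fintype m]
    [DecidableEq m] [Nonempty m] : HasFinitelyManyConjClassesOfLeftIdeals (Matrix m m A) := by
  have : IsArtinianRing A := IsArtinianRing.of_finite k A
  have : IsNoetherianRing A := inferInstance
  obtain ⟨n, hn⟩ : ∃ n : ℕ, Module.length A (m → A) = n :=
    ENat.ne_top_iff_exists.1 Module.length_ne_top |>.imp fun _ h => h.symm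
  obtain ⟨ι, _, M, hM⟩ := exists_finite_modules_of_length_le hA n
  choose K hK using exists_rowIdeal_eq (A := A) (m := m)
  choose i hi using fun L => hM (ModuleCat.of A ((m → A) ⧸ K L)) inferInstance
    (hn ▸ Module.length_le_of_surjective (K L).mkQ (K L).mkQ_surjective)
  refine Finite.of_injective (fun q : Quot (ConjLeftIdeal (Matrix m m A)) => i q.out) ?_
  intro q q' hq
  rw [← q.out_eq, ← q'.out_eq]
  apply Quot.sound
  obtain ⟨f⟩ := hi q.out
  obtain ⟨f'⟩ := hi q'.out
  rw [← hK q.out, ← hK q'.out, conj_rowIdeal_iff]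
  replace hq : i q.out = i q'.out := hq
  rw [← hq] at f'
  obtain ⟨g, hg⟩ := exists_equiv_of_surjective (k := k) (f := f.toLinearMap ∘ₗ (K q.out).mkQ)
    (f' := f'.toLinearMap ∘ₗ (K q'.out).mkQ)
    (f.surjective.comp (K q.out).mkQ_surjective) (f'.surjective.comp (K q'.out).mkQ_surjective)
  obtain ⟨u, hu⟩ := exists_vecMul_eq g
  refine ⟨u, fun x => ?_⟩
  rw [hu]
  have h1 := LinearMap.congr_fun hg x
  simp only [LinearMap.comp_apply, LinearEquiv.coe_coe] at h1
  rw [← Submodule.Quotient.mk_eq_zero (K q.out), ← Submodule.Quotient.mk_eq_zero (K q'.out),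
    ← Submodule.mkQ_apply, ← Submodule.mkQ_apply, ← f.map_eq_zero_iff, ← f'.map_eq_zero_iff]
  rw [← h1]

end FiniteType

end

section

variable {k A : Type} [Field k] [Ring A] [Algebra k A]

/-- The scalar by which an element acts on the top of the projective module of an idempotent. -/
noncomputable def IdempotentSystem.scalar (σ : IdempotentSystem k A) (i : σ.I) (a : A) : k :=
  (σ.exists_scalar i a).choose

lemma IdempotentSystem.sub_scalar_mem (σ : IdempotentSystem k A) (i : σ.I) (a : A) :
    σ.e i * a * σ.e i - σ.scalar i a • σ.e i ∈ Ring.jacobson A :=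
  (σ.exists_scalar i a).choose_spec

lemma IdempotentSystem.e_mul_mul (σ : IdempotentSystem k A)
    (hJ : ∀ x ∈ Ring.jacobson A, ∀ y ∈ Ring.jacobson A, x * y = 0) {x : A} (hx : x ∈ Ring.jacobson A) {j : σ.I} (hxj : σ.e j * x = x) (w : A)
    (i : σ.I) : σ.e i * (w * x) = if i = j then σ.scalar j w • x else 0 := by
  split_ifs with h
  · subst h
    have := hJ _ (σ.sub_scalar_mem i w) _ hx
    rw [sub_mul, sub_eq_zero, smul_mul_assoc, hxj, mul_assoc, hxj, mul_assoc] at this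
    exact this
  · have := hJ _ (σ.off_diagonal i j w h) _ hx
    rwa [mul_assoc, hxj, mul_assoc] at this

/-- Compatible bases of the spaces `e j * J * e i`, where `J` is the Jacobson radical. -/
structure ArrowSystem (σ : IdempotentSystem k A) where
  /-- The index set of the arrows. -/
  E : Type
  [fintypeE : Fintype E]
  [decidableEqE : DecidableEq E]
  /-- The source of an arrow. -/
  s : E → σ.I
  /-- The target of an arrow. -/
  t : E → σ.I
  /-- The basis element of an arrow. -/
  β : E → A
  /-- The coordinate function of an arrow. -/
  c : E → A →ₗ[k] k
  mem_jacobson : ∀ a, β a ∈ Ring.jacobson A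
  e_mul : ∀ a, σ.e (t a) * β a = β a
  mul_e : ∀ a, β a * σ.e (s a) = β a
  c_basis : ∀ a b, c a (β b) = if a = b then 1 else 0
  c_sandwich : ∀ a x, c a (σ.e (t a) * x * σ.e (s a)) = c a x
  expand : ∀ x ∈ Ring.jacobson A, ∀ i j,
    σ.e j * x * σ.e i = ∑ a with s a = i ∧ t a = j, c a x • β a

attribute [instance] ArrowSystem.fintypeE ArrowSystem.decidableEqE

/-- The subspace `e j * J * e i`. -/
def arrowSpace (σ : IdempotentSystem k A) (p : σ.I × σ.I) : Submodule k A where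
  carrier := {x | x ∈ Ring.jacobson A ∧ σ.e p.2 * x = x ∧ x * σ.e p.1 = x}
  add_mem' := fun ⟨h1, h2, h3⟩ ⟨h1', h2', h3'⟩ =>
    ⟨add_mem h1 h1', by rw [mul_add, h2, h2'], by rw [add_mul, h3, h3']⟩
  zero_mem' := ⟨zero_mem _, mul_zero _, zero_mul _⟩
  smul_mem' := fun c x ⟨h1, h2, h3⟩ => ⟨by
    rw [Algebra.smul_def]; exact Ideal.mul_mem_left _ _ h1,
    by rw [mul_smul_comm, h2], by rw [smul_mul_assoc, h3]⟩

lemma nonempty_arrowSystem [FiniteDimensional k A] (σ : IdempotentSystem k A) :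
    Nonempty (ArrowSystem σ) := by
  let B := fun p => Module.finBasis k (arrowSpace σ p)
  have hidem := fun i => (σ.orthogonal.idem i).eq
  choose f hf using fun p (a : Fin (Module.finrank k (arrowSpace σ p))) =>
    LinearMap.exists_extend ((B p).coord a)
  let c : (Σ p, Fin (Module.finrank k (arrowSpace σ p))) → A →ₗ[k] k := fun a =>
    f a.1 a.2 ∘ₗ LinearMap.mulRight k (σ.e a.1.1) ∘ₗ LinearMap.mulLeft k (σ.e a.1.2)
  have hc : ∀ a x, c a x = f a.1 a.2 (σ.e a.1.2 * x * σ.e a.1.1) := fun _ _ => rfl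
  have hmem : ∀ x ∈ Ring.jacobson A, ∀ p : σ.I × σ.I, σ.e p.2 * x * σ.e p.1 ∈ arrowSpace σ p :=
    fun x hx p => ⟨Ideal.mul_mem_right _ _ (Ideal.mul_mem_left _ _ hx),
      by simp only [← mul_assoc, hidem], by simp only [mul_assoc, hidem]⟩
  refine ⟨⟨Σ p, Fin (Module.finrank k (arrowSpace σ p)), fun a => a.1.1, fun a => a.1.2,
    fun a => (B a.1 a.2 : A), c, fun a => (B a.1 a.2).2.1, fun a => (B a.1 a.2).2.2.1,
    fun a => (B a.1 a.2).2.2.2, ?_, ?_, ?_⟩⟩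
  · rintro ⟨p, a⟩ ⟨q, b⟩
    rw [hc]
    dsimp only
    by_cases hpq : p = q
    · subst hpq
      rw [(B p b).2.2.1, (B p b).2.2.2]
      have := LinearMap.congr_fun (hf p a) (B p b)
      simp only [LinearMap.comp_apply, Submodule.subtype_apply] at this
      rw [this, Module.Basis.coord_apply, Module.Basis.repr_self, Finsupp.single_apply]
      simp [eq_comm]
    · have h0 : σ.e p.2 * (B q b : A) * σ.e p.1 = 0 := by
        rw [← (B q b).2.2.1, mul_assoc, mul_assoc, ← (B q b).2.2.2, mul_assoc]
        by_cases h2 : p.2 = q.2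
        · rw [σ.orthogonal.ortho (i := q.1) (j := p.1)
            (fun h1 => hpq (Prod.ext h1.symm h2)), mul_zero, mul_zero, mul_zero]
        · rw [← mul_assoc, σ.orthogonal.ortho h2, zero_mul]
      rw [h0, map_zero, if_neg]
      rintro h
      exact hpq (congrArg Sigma.fst h)
  · intro a x
    rw [hc, hc]
    congr 1
    simp only [mul_assoc, hidem]
    simp only [← mul_assoc, hidem]
  · intro x hx i j
    have h1 := (B (i, j)).sum_repr ⟨_, hmem x hx (i, j)⟩
    have h2 := congrArg Subtype.val h1
    dsimp only at h2
    rw [← h2, AddSubmonoidClass.coe_finsetSum, Finset.sum_filter, Fintype.sum_sigma,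
      Finset.sum_eq_single (i, j)]
    · refine Finset.sum_congr rfl fun a _ => ?_
      rw [if_pos ⟨rfl, rfl⟩, hc]
      have := LinearMap.congr_fun (hf (i, j) a) ⟨_, hmem x hx (i, j)⟩
      simp only [LinearMap.comp_apply, Submodule.subtype_apply] at this
      rw [this]
      rfl
    · intro p _ hp
      refine Finset.sum_eq_zero fun a _ => if_neg ?_
      rintro ⟨rfl, rfl⟩
      exact hp rfl
    · simp

namespace ArrowSystem

variable {σ : IdempotentSystem k A} (Q : ArrowSystem σ)

/-- The quiver of the arrow system, with separated sources and targets. -/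
abbrev src (a : Q.E) : σ.I ⊕ σ.I := Sum.inl (Q.s a)

/-- The quiver of the arrow system, with separated sources and targets. -/
abbrev tgt (a : Q.E) : σ.I ⊕ σ.I := Sum.inr (Q.t a)

variable (hJ : ∀ x ∈ Ring.jacobson A, ∀ y ∈ Ring.jacobson A, x * y = 0)

include hJ

lemma basis_mul_mul_e (a : Q.E) (w : A) (i : σ.I) :
    Q.β a * w * σ.e i = if Q.s a = i then σ.scalar i w • Q.β a else 0 := by
  split_ifs with h
  · subst h
    have := hJ _ (Q.mem_jacobson a) _ (σ.sub_scalar_mem (Q.s a) w)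
    rw [mul_sub, sub_eq_zero, mul_smul_comm, Q.mul_e, ← mul_assoc, ← mul_assoc, Q.mul_e] at this
    exact this
  · have := hJ _ (Q.mem_jacobson a) _ (σ.off_diagonal (Q.s a) i w h)
    rwa [← mul_assoc, ← mul_assoc, Q.mul_e] at this

lemma c_basis_mul (a b : Q.E) (w : A) :
    Q.c b (Q.β a * w) = if b = a then σ.scalar (Q.s a) w else 0 := by
  rw [← Q.c_sandwich, mul_assoc, Q.basis_mul_mul_e hJ]
  split_ifs with h1 h2 h2
  · subst h2
    rw [mul_smul_comm, map_smul, Q.e_mul, Q.c_basis, if_pos rfl, smul_eq_mul, mul_one]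
  · rw [mul_smul_comm, map_smul, ← Q.c_sandwich, ← mul_assoc, (σ.orthogonal.idem _).eq,
      Q.c_sandwich, Q.c_basis, if_neg h2, smul_zero]
  · subst h2; exact absurd rfl h1
  · rw [mul_zero, map_zero]

end ArrowSystem

end

section

variable {k A : Type} [Field k] [Ring A] [Algebra k A] {σ : IdempotentSystem k A}

namespace ArrowSystem

variable (Q : ArrowSystem σ) {m n : Type} [Fintype m]

/-- The evaluation at a vertex attached to a family of vectors. -/
def evalAt (ψ : Q.E → m → n → k) (j : σ.I) : (m → A) →ₗ[k] n → k :=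
  ∑ a with Q.t a = j, ∑ l, (LinearMap.toSpanSingleton k (n → k) (ψ a l)) ∘ₗ Q.c a ∘ₗ
    LinearMap.proj l

lemma evalAt_apply (ψ : Q.E → m → n → k) (j : σ.I) (x : m → A) :
    Q.evalAt ψ j x = ∑ a with Q.t a = j, ∑ l, Q.c a (x l) • ψ a l := by
  simp [evalAt]

/-- The submodule of the radical of a free module attached to a family of vectors. -/
def kernelModule (ψ : Q.E → m → n → k) : Submodule A (m → A) where
  carrier := {x | (∀ l, x l ∈ Ring.jacobson A) ∧ ∀ j (b : A), Q.evalAt ψ j (b • x) = 0}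
  add_mem' := fun ⟨h1, h2⟩ ⟨h1', h2'⟩ => ⟨fun l => add_mem (h1 l) (h1' l), fun j b => by
    rw [smul_add, map_add, h2, h2', add_zero]⟩
  zero_mem' := ⟨fun _ => zero_mem _, fun j b => by rw [smul_zero, map_zero]⟩
  smul_mem' := fun c x ⟨h1, h2⟩ => ⟨fun l => Ideal.mul_mem_left _ _ (h1 l), fun j b => by
    rw [smul_smul, h2]⟩

/-- The vectors with entries in `e j * J`. -/
def radicalVectors (σ : IdempotentSystem k A) (m : Type) (j : σ.I) : Submodule k (m → A) where
  carrier := {x | ∀ l, x l ∈ Ring.jacobson A ∧ σ.e j * x l = x l}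
  add_mem' := fun h h' l => ⟨add_mem (h l).1 (h' l).1, by
    rw [Pi.add_apply, mul_add, (h l).2, (h' l).2]⟩
  zero_mem' := fun _ => ⟨zero_mem _, mul_zero _⟩
  smul_mem' := fun c x h l => ⟨by
    rw [Pi.smul_apply, Algebra.smul_def]; exact Ideal.mul_mem_left _ _ (h l).1, by
    rw [Pi.smul_apply, mul_smul_comm, (h l).2]⟩

section

variable (hJ : ∀ x ∈ Ring.jacobson A, ∀ y ∈ Ring.jacobson A, x * y = 0)

include hJ

lemma mem_kernelModule_iff (ψ : Q.E → m → n → k) {j : σ.I} {x : m → A}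
    (hx : x ∈ radicalVectors σ m j) : x ∈ Q.kernelModule ψ ↔ Q.evalAt ψ j x = 0 := by
  refine ⟨fun h => by simpa using h.2 j 1, fun h => ⟨fun l => (hx l).1, fun i b => ?_⟩⟩
  have hc : ∀ a l, Q.t a = i → Q.c a (b * x l) = if i = j then σ.scalar j b * Q.c a (x l) else 0 := by
    rintro a l rfl
    rw [← Q.c_sandwich, σ.e_mul_mul hJ (hx l).1 (hx l).2]
    split_ifs with h
    · rw [smul_mul_assoc, map_smul, ← Q.c_sandwich a (x l), h, (hx l).2, smul_eq_mul]
    · rw [zero_mul, map_zero]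
  rw [evalAt_apply, Finset.sum_congr rfl fun a ha => Finset.sum_congr rfl fun l _ => by
    rw [Pi.smul_apply, smul_eq_mul, hc a l (Finset.mem_filter.1 ha).2]]
  split_ifs with hij
  · subst hij
    rw [evalAt_apply] at h
    simp only [mul_smul, ← Finset.smul_sum, h, smul_zero]
  · simp

variable [DecidableEq m] [Fintype n] [DecidableEq n]

/-- Conjugate kernel modules come from families of vectors related by linear substitutions. -/
lemma exists_eq_of_vecMul (ψ ψ' : Q.E → m → n → k) (w : Matrix m m A)
    (hw : ∀ x, x ∈ Q.kernelModule ψ ↔ Matrix.vecMul x w ∈ Q.kernelModule ψ') :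
    ∃ (g : σ.I → m → m → k) (h : σ.I → n → n → k), ∀ a l q,
      ψ a l q = ∑ l', ∑ q', g (Q.s a) l l' * h (Q.t a) q' q * ψ' a l' q' := by
  have hmul : ∀ j x, x ∈ radicalVectors σ m j → Matrix.vecMul x w ∈ radicalVectors σ m j := by
    intro j x hx l
    simp only [Matrix.vecMul, dotProduct]
    refine ⟨sum_mem fun l' _ => Ideal.mul_mem_right _ _ (hx l').1, ?_⟩
    rw [Finset.mul_sum]
    exact Finset.sum_congr rfl fun l' _ => by rw [← mul_assoc, (hx l').2]
  let vm : (m → A) →ₗ[k] (m → A) :=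
    { toFun := fun x => Matrix.vecMul x w
      map_add' := fun x y => Matrix.add_vecMul _ _ _
      map_smul' := fun c x => Matrix.smul_vecMul _ _ _ }
  have hex : ∀ j, ∃ c : (n → k) →ₗ[k] (n → k),
      c ∘ₗ (Q.evalAt ψ' j ∘ₗ vm ∘ₗ (radicalVectors σ m j).subtype) =
        Q.evalAt ψ j ∘ₗ (radicalVectors σ m j).subtype := by
    refine fun j => exists_comp_eq_of_ker_le _ _ fun x hx => ?_
    have h1 : Q.evalAt ψ' j (Matrix.vecMul x.1 w) = 0 := hx
    rw [← Q.mem_kernelModule_iff hJ ψ' (hmul j _ x.2), ← hw, Q.mem_kernelModule_iff hJ ψ x.2] at h1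
    exact h1
  choose c hc using hex
  refine ⟨fun i l l' => σ.scalar i (w l l'), fun j q' q => c j (fun p => if q' = p then 1 else 0) q, fun a l q => ?_⟩
  let x : m → A := Pi.single l (Q.β a)
  have hx : x ∈ radicalVectors σ m (Q.t a) := by
    intro l'
    by_cases h : l' = l
    · subst h
      simpa [x] using ⟨Q.mem_jacobson a, Q.e_mul a⟩
    · simp [x, h]
  have h1 : c (Q.t a) (Q.evalAt ψ' (Q.t a) (Matrix.vecMul x w)) = Q.evalAt ψ (Q.t a) x :=
    LinearMap.congr_fun (hc (Q.t a)) ⟨x, hx⟩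
  have h2 : Q.evalAt ψ (Q.t a) x = ψ a l := by
    rw [evalAt_apply, Finset.sum_eq_single a, Finset.sum_eq_single l]
    · simp [x, Q.c_basis]
    · intro l' _ h
      simp [x, h]
    · simp
    · intro b _ hb
      refine Finset.sum_eq_zero fun l' _ => ?_
      by_cases h : l' = l
      · subst h
        simp [x, Q.c_basis, hb]
      · simp [x, h]
    · simp
  have h3 : Q.evalAt ψ' (Q.t a) (Matrix.vecMul x w) =
      ∑ l', σ.scalar (Q.s a) (w l l') • ψ' a l' := by
    rw [evalAt_apply, Finset.sum_eq_single a]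
    · simp [x, Q.c_basis_mul hJ]
    · intro b _ hb
      simp [x, Q.c_basis_mul hJ, hb]
    · simp
  rw [h2, h3] at h1
  rw [← h1, map_sum, Finset.sum_apply]
  refine Finset.sum_congr rfl fun l' _ => ?_
  rw [map_smul, Pi.smul_apply, smul_eq_mul, LinearMap.pi_apply_eq_sum_univ (c (Q.t a)) (ψ' a l')]
  simp only [Finset.sum_apply, Pi.smul_apply, smul_eq_mul, Finset.mul_sum]
  refine Finset.sum_congr rfl fun q' _ => ?_
  rw [mul_comm (ψ' a l' q'), mul_assoc]

end

end ArrowSystem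

end

section

/-- If finitely many polynomial maps cover an affine space over an infinite field even when
restricted to points with some coordinate equal to one, then the dimensions differ strictly. -/
lemma card_lt_of_polynomial_cover {k : Type*} [Field k] [Infinite k] {ι σ τ : Type*} [Finite ι]
    [Fintype σ] [Fintype τ] (P : ι → σ → MvPolynomial τ k)
    (h : ∀ y : σ → k, ∃ i x, (∃ v, x v = 1) ∧ ∀ s, y s = MvPolynomial.eval x (P i s)) :
    Fintype.card σ < Fintype.card τ := by
  classical
  have hcard : ∀ v : τ, Fintype.card {w // w ≠ v} = Fintype.card τ - 1 := fun v => by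
    simp [Fintype.card_subtype_compl]
  let f : ∀ v : τ, {w // w ≠ v} ≃ Fin (Fintype.card τ - 1) := fun v => Fintype.equivFinOfCardEq (hcard v)
  obtain ⟨-, -, ⟨v, -⟩, -⟩ := h 0
  have hpos : 0 < Fintype.card τ := Fintype.card_pos_iff.2 ⟨v⟩
  have key := card_le_of_polynomial_cover (k := k) (ι := ι × τ) (σ := σ)
    (τ := Fin (Fintype.card τ - 1))
    (fun p s => MvPolynomial.bind₁
      (fun w => if hw : w ≠ p.2 then MvPolynomial.X (f p.2 ⟨w, hw⟩) else 1) (P p.1 s))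
    (fun y => by
      obtain ⟨i, x, ⟨v, hv⟩, hx⟩ := h y
      refine ⟨(i, v), fun q => x ((f v).symm q), fun s => ?_⟩
      rw [hx, MvPolynomial.eval, MvPolynomial.eval, MvPolynomial.eval₂Hom_bind₁]
      congr 2
      ext w
      by_cases hw : w = v
      · subst hw
        simp [hv]
      · simp [hw])
  rw [Fintype.card_fin] at key
  omega

lemma equivalence_conjLeftIdeal (A : Type) [Ring A] : Equivalence (ConjLeftIdeal A) where
  refl L := ⟨1, by simp⟩
  symm := by
    rintro L L' ⟨u, hu⟩
    refine ⟨u⁻¹, ?_⟩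
    rw [hu, Set.image_image]
    simp [mul_assoc]
  trans := by
    rintro L L' L'' ⟨u, hu⟩ ⟨v, hv⟩
    refine ⟨v * u, ?_⟩
    rw [hv, hu, Set.image_image]
    simp [mul_assoc]

variable {k A : Type} [Field k] [Ring A] [Algebra k A] {σ : IdempotentSystem k A}

open QuiverRep in
/-- If a matrix algebra over `A` has finitely many conjugacy classes of left ideals, the Tits form
of the separated quiver is positive on small vectors. -/
theorem ArrowSystem.form_pos [Infinite k] (Q : ArrowSystem σ)
    (hJ : ∀ x ∈ Ring.jacobson A, ∀ y ∈ Ring.jacobson A, x * y = 0) (n : ℕ) [NeZero n]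
    (hfin : HasFinitelyManyConjClassesOfLeftIdeals (Matrix (Fin n) (Fin n) A))
    (d : σ.I ⊕ σ.I → ℕ) (hd : d ≠ 0) (hn : ∀ v, d v ≤ n) :
    0 < form (adjacency Q.src Q.tgt) d := by
  classical
  rw [form_adjacency]
  let τ₁ := Σ i : σ.I, Fin (d (Sum.inl i)) × Fin (d (Sum.inl i))
  let τ₂ := Σ i : σ.I, Fin (d (Sum.inr i)) × Fin (d (Sum.inr i))
  let S := Σ a : Q.E, Fin (d (Q.src a)) × Fin (d (Q.tgt a))
  have hτ : (Fintype.card (τ₁ ⊕ τ₂) : ℤ) = ∑ x, (d x : ℤ) ^ 2 := by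
    simp [τ₁, τ₂, Fintype.card_sigma, sq]
  have hS : (Fintype.card S : ℤ) = ∑ a, (d (Q.src a) : ℤ) * d (Q.tgt a) := by
    simp [S, Fintype.card_sigma]
  rw [← hτ, ← hS]
  suffices h : Fintype.card S < Fintype.card (τ₁ ⊕ τ₂) by omega
  by_cases hd1 : ∀ i, d (Sum.inl i) = 0
  · have h0 : Fintype.card S = 0 := by
      simp [S, Fintype.card_sigma, ArrowSystem.src, hd1]
    rw [h0, Fintype.card_pos_iff]
    obtain ⟨v, hv⟩ : ∃ v, d v ≠ 0 := by
      by_contra! hcon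
      exact hd (funext hcon)
    rcases v with i | j
    · exact absurd (hd1 i) hv
    · exact ⟨Sum.inr ⟨j, ⟨0, Nat.pos_of_ne_zero hv⟩, ⟨0, Nat.pos_of_ne_zero hv⟩⟩⟩
  push Not at hd1
  obtain ⟨i₀, hi₀⟩ := hd1
  let v₀ : τ₁ := ⟨i₀, ⟨0, Nat.pos_of_ne_zero hi₀⟩, ⟨0, Nat.pos_of_ne_zero hi₀⟩⟩
  let ψ : (S → k) → Q.E → Fin n → Fin n → k := fun y a l q =>
    if h : l.1 < d (Q.src a) ∧ q.1 < d (Q.tgt a) then y ⟨a, ⟨l, h.1⟩, ⟨q, h.2⟩⟩ else 0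
  have hψ : ∀ y a l q, ψ y a l q ≠ 0 → l.1 < d (Q.src a) ∧ q.1 < d (Q.tgt a) := by
    intro y a l q h
    by_contra hcon
    exact h (dif_neg hcon)
  have hψ' : ∀ y (s : S), y s = ψ y s.1 (Fin.castLE (hn _) s.2.1) (Fin.castLE (hn _) s.2.2) := by
    rintro y ⟨a, l, q⟩
    simp [ψ]
  let cls : (S → k) → Quot (ConjLeftIdeal (Matrix (Fin n) (Fin n) A)) := fun y =>
    Quot.mk _ (rowIdeal (Q.kernelModule (ψ y)))
  let rep : Quot (ConjLeftIdeal (Matrix (Fin n) (Fin n) A)) → S → k := fun q =>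
    if h : ∃ y, cls y = q then h.choose else 0
  have hrep : ∀ y, cls (rep (cls y)) = cls y := fun y => by
    have h : ∃ y', cls y' = cls y := ⟨y, rfl⟩
    simp only [rep, dif_pos h]
    exact h.choose_spec
  let G : σ.I → Fin n → Fin n → MvPolynomial (τ₁ ⊕ τ₂) k := fun i l l' =>
    if h : l.1 < d (Sum.inl i) ∧ l'.1 < d (Sum.inl i) then
      MvPolynomial.X (Sum.inl ⟨i, ⟨l, h.1⟩, ⟨l', h.2⟩⟩) else 0
  let H : σ.I → Fin n → Fin n → MvPolynomial (τ₁ ⊕ τ₂) k := fun i l l' =>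
    if h : l.1 < d (Sum.inr i) ∧ l'.1 < d (Sum.inr i) then
      MvPolynomial.X (Sum.inr ⟨i, ⟨l, h.1⟩, ⟨l', h.2⟩⟩) else 0
  have : Finite (Quot (ConjLeftIdeal (Matrix (Fin n) (Fin n) A))) := hfin
  refine card_lt_of_polynomial_cover (k := k)
    (ι := Quot (ConjLeftIdeal (Matrix (Fin n) (Fin n) A))) (fun c s => ∑ l', ∑ q',
      G (Q.s s.1) (Fin.castLE (hn _) s.2.1) l' * H (Q.t s.1) q' (Fin.castLE (hn _) s.2.2) *
        MvPolynomial.C (ψ (rep c) s.1 l' q')) fun y => ⟨cls y, ?_⟩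
  by_cases hy : y = 0
  · refine ⟨Pi.single (Sum.inl v₀) 1, ⟨Sum.inl v₀, by simp⟩, fun s => ?_⟩
    rw [hy, Pi.zero_apply, map_sum]
    symm
    refine Finset.sum_eq_zero fun l' _ => ?_
    rw [map_sum]
    refine Finset.sum_eq_zero fun q' _ => ?_
    have : MvPolynomial.eval (Pi.single (Sum.inl v₀) 1)
        (H (Q.t s.1) q' (Fin.castLE (hn _) s.2.2)) = 0 := by
      simp only [H]
      split_ifs <;> simp
    rw [map_mul, map_mul, this, mul_zero, zero_mul]
  have hconj := (equivalence_conjLeftIdeal _).eqvGen_iff.1 (Quot.eqvGen_exact (hrep y).symm)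
  obtain ⟨u, hu⟩ := conj_rowIdeal_iff.1 hconj
  obtain ⟨g, h, hgh⟩ := Q.exists_eq_of_vecMul hJ _ _ u.1 hu
  obtain ⟨s₁, hs₁⟩ : ∃ s, y s ≠ 0 := by
    by_contra! hcon
    exact hy (funext hcon)
  rw [hψ' y, hgh] at hs₁
  obtain ⟨l₁, -, hl₁⟩ := Finset.exists_ne_zero_of_sum_ne_zero hs₁
  obtain ⟨q₁, -, hq₁⟩ := Finset.exists_ne_zero_of_sum_ne_zero hl₁
  have hc := left_ne_zero_of_mul (left_ne_zero_of_mul hq₁)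
  set c := g (Q.s s₁.1) (Fin.castLE (hn _) s₁.2.1) l₁ with hcdef
  let x : τ₁ ⊕ τ₂ → k := Sum.elim
    (fun v => c⁻¹ * g v.1 (Fin.castLE (hn _) v.2.1) (Fin.castLE (hn _) v.2.2))
    (fun v => c * h v.1 (Fin.castLE (hn _) v.2.1) (Fin.castLE (hn _) v.2.2))
  refine ⟨x, ⟨Sum.inl ⟨Q.s s₁.1, s₁.2.1, ⟨l₁, (hψ _ _ _ _ (right_ne_zero_of_mul hq₁)).1⟩⟩, ?_⟩,
    fun s => ?_⟩
  · exact inv_mul_cancel₀ hc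
  · rw [hψ' y, hgh, map_sum]
    refine Finset.sum_congr rfl fun l' _ => ?_
    rw [map_sum]
    refine Finset.sum_congr rfl fun q' _ => ?_
    rw [map_mul, map_mul, MvPolynomial.eval_C]
    by_cases h0 : ψ (rep (cls y)) s.1 l' q' = 0
    · rw [h0, mul_zero, mul_zero]
    have h0' := hψ _ _ _ _ h0
    congr 1
    have hG : MvPolynomial.eval x (G (Q.s s.1) (Fin.castLE (hn _) s.2.1) l') =
        c⁻¹ * g (Q.s s.1) (Fin.castLE (hn _) s.2.1) l' := by
      simp only [G]
      rw [dif_pos ⟨s.2.1.2, h0'.1⟩, MvPolynomial.eval_X]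
      rfl
    have hH : MvPolynomial.eval x (H (Q.t s.1) q' (Fin.castLE (hn _) s.2.2)) =
        c * h (Q.t s.1) q' (Fin.castLE (hn _) s.2.2) := by
      simp only [H]
      rw [dif_pos ⟨h0'.2, s.2.2.2⟩, MvPolynomial.eval_X]
      rfl
    rw [hG, hH]
    field_simp

end

section

variable {k A : Type} [Field k] [Ring A] [Algebra k A]

/-- A splitting of the components of a module into a part in the radical and a complement. -/
structure Splitting (σ : IdempotentSystem k A) (M : Type) [AddCommGroup M] [Module A M]
    [Module k M] where
  /-- The radical parts (on the right) and their complements (on the left). -/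
  sub : σ.I ⊕ σ.I → Submodule k M
  /-- The projections onto the parts. -/
  proj : ∀ x, M →ₗ[k] sub x
  proj_add : ∀ i m, (proj (Sum.inl i) m : M) + proj (Sum.inr i) m = σ.e i • m
  e_smul_inl : ∀ i, ∀ m ∈ sub (Sum.inl i), σ.e i • m = m
  mem_inr : ∀ i m, m ∈ sub (Sum.inr i) ↔
    m ∈ Ring.jacobson A • (⊤ : Submodule A M) ∧ σ.e i • m = m
  proj_inl_eq_zero : ∀ i m, σ.e i • m ∈ Ring.jacobson A • (⊤ : Submodule A M) →
    proj (Sum.inl i) m = 0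
  proj_inr_eq_zero : ∀ i, ∀ m ∈ sub (Sum.inl i), proj (Sum.inr i) m = 0

section Modules

variable {σ : IdempotentSystem k A} {M N : Type} [AddCommGroup M] [Module A M] [Module k M]
  [IsScalarTower k A M] [AddCommGroup N] [Module A N] [Module k N] [IsScalarTower k A N]

omit [Module k M] [IsScalarTower k A M] in
lemma IdempotentSystem.e_smul_e_smul (i : σ.I) (m : M) : σ.e i • σ.e i • m = σ.e i • m := by
  rw [smul_smul, (σ.orthogonal.idem i).eq]

variable (σ M) in
lemma nonempty_splitting : Nonempty (Splitting σ M) := by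
  let R := Ring.jacobson A • (⊤ : Submodule A M)
  let W : σ.I → Submodule k M := fun i =>
    { carrier := {m | m ∈ R ∧ σ.e i • m = m}
      add_mem' := fun ⟨h1, h2⟩ ⟨h1', h2'⟩ => ⟨add_mem h1 h1', by rw [smul_add, h2, h2']⟩
      zero_mem' := ⟨zero_mem _, smul_zero _⟩
      smul_mem' := fun c m ⟨h1, h2⟩ => ⟨Submodule.smul_of_tower_mem R c h1, by
        rw [smul_algebra_smul_comm, h2]⟩ }
  have hp : ∀ i, ∃ p : M →ₗ[k] W i, p ∘ₗ (W i).subtype = LinearMap.id := fun i =>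
    LinearMap.exists_leftInverse_of_injective _ (Submodule.ker_subtype _)
  choose p hp using hp
  replace hp : ∀ i (w : W i), p i w = w := fun i w => LinearMap.congr_fun (hp i) w
  let ε : σ.I → M →ₗ[k] M := fun i => Algebra.lsmul k k M (σ.e i)
  let U : σ.I → Submodule k M := fun i => LinearMap.ker (p i) ⊓ LinearMap.ker (ε i - LinearMap.id)
  have hU : ∀ i m, m ∈ U i ↔ p i m = 0 ∧ σ.e i • m = m := fun i m => by
    simp [U, ε, sub_eq_zero]
  let q : ∀ i, M →ₗ[k] U i := fun i =>
    LinearMap.codRestrict (U i) (ε i - (W i).subtype ∘ₗ p i ∘ₗ ε i) fun m => by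
      rw [hU]
      have h1 : (ε i - (W i).subtype ∘ₗ p i ∘ₗ ε i) m = σ.e i • m - (p i (σ.e i • m) : M) := rfl
      rw [h1, map_sub, hp, sub_self, smul_sub, σ.e_smul_e_smul, (p i (σ.e i • m)).2.2]
      exact ⟨rfl, rfl⟩
  refine ⟨⟨Sum.elim U W, Sum.rec q fun i => p i ∘ₗ ε i, fun i m => ?_, fun i m hm => ?_,
    fun i m => Iff.rfl, fun i m hm => ?_, fun i m hm => ?_⟩⟩
  · change σ.e i • m - (p i (σ.e i • m) : M) + (p i (σ.e i • m) : M) = _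
    rw [sub_add_cancel]
  · exact ((hU i m).1 hm).2
  · apply Subtype.ext
    change σ.e i • m - (p i (σ.e i • m) : M) = 0
    rw [hp i ⟨_, hm, σ.e_smul_e_smul i m⟩, sub_self]
  · change p i (σ.e i • m) = 0
    rw [((hU i m).1 hm).2, ((hU i m).1 hm).1]

namespace Splitting

omit [IsScalarTower k A M] in
lemma e_smul (S : Splitting σ M) : ∀ x, ∀ m ∈ S.sub x, σ.e (Sum.elim id id x) • m = m
  | Sum.inl i, m, hm => S.e_smul_inl i m hm
  | Sum.inr i, m, hm => ((S.mem_inr i m).1 hm).2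

omit [IsScalarTower k A M] in
lemma e_smul_of_ne (S : Splitting σ M) {x : σ.I ⊕ σ.I} {i : σ.I} (h : i ≠ Sum.elim id id x) {m : M}
    (hm : m ∈ S.sub x) : σ.e i • m = 0 := by
  rw [← S.e_smul x m hm, smul_smul, σ.orthogonal.ortho h, zero_smul]

omit [IsScalarTower k A M] [Module k N] [IsScalarTower k A N] in
/-- Linear maps agreeing on the parts of a splitting are equal. -/
lemma hom_ext (S : Splitting σ M) {f g : M →ₗ[A] N} (h : ∀ x, ∀ m ∈ S.sub x, f m = g m) :
    f = g := by
  have he : ∀ i m, f (σ.e i • m) = g (σ.e i • m) := fun i m => by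
    rw [← S.proj_add, map_add, map_add, h _ _ (S.proj _ m).2, h _ _ (S.proj _ m).2]
  ext m
  rw [← one_smul A m, ← σ.full]
  simp only [Finset.sum_smul, Finset.mul_sum, Finset.sum_mul, map_sum]
  refine Finset.sum_congr rfl fun x _ => Finset.sum_congr rfl fun i _ => ?_
  rw [mul_assoc, mul_smul, mul_smul, LinearMap.map_smul f (σ.l x), LinearMap.map_smul g (σ.l x), he]

lemma smul_eq_zero_of_mem (hJ : ∀ x ∈ Ring.jacobson A, ∀ y ∈ Ring.jacobson A, x * y = 0) {x : A}
    (hx : x ∈ Ring.jacobson A) {m : M} (hm : m ∈ Ring.jacobson A • (⊤ : Submodule A M)) :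
    x • m = 0 := by
  refine Submodule.smul_induction_on hm (fun y hy n _ => ?_) fun y z hy hz => ?_
  · rw [smul_smul, hJ x hx y hy, zero_smul]
  · rw [smul_add, hy, hz, add_zero]

variable (Q : ArrowSystem σ)

omit [IsScalarTower k A M] in
lemma basis_smul_mem (S : Splitting σ M) (a : Q.E) (m : M) :
    Q.β a • m ∈ S.sub (Q.tgt a) :=
  (S.mem_inr _ _).2 ⟨Submodule.smul_mem_smul (Q.mem_jacobson a) trivial, by
    rw [smul_smul, Q.e_mul]⟩

/-- The representation of the separated quiver attached to a module. -/
def rep (S : Splitting σ M) [FiniteDimensional k M] : QuiverRep k Q.src Q.tgt where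
  V x := S.sub x
  φ a := LinearMap.codRestrict _ ((Algebra.lsmul k k M (Q.β a)) ∘ₗ (S.sub (Q.src a)).subtype)
    fun m => S.basis_smul_mem Q a m

section

variable (S : Splitting σ M)

omit [IsScalarTower k A M] in
lemma proj_congr {x : σ.I ⊕ σ.I} {m m' : M}
    (h : σ.e (Sum.elim id id x) • m = σ.e (Sum.elim id id x) • m') :
    S.proj x m = S.proj x m' := by
  have key : ∀ i, σ.e i • m = σ.e i • m' → S.proj (Sum.inl i) m = S.proj (Sum.inl i) m' := by
    intro i hi
    rw [← sub_eq_zero, ← map_sub]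
    apply S.proj_inl_eq_zero
    rw [smul_sub, hi, sub_self]
    exact zero_mem _
  rcases x with i | i
  · exact key i h
  · have h1 := S.proj_add i m
    rw [key i h, show σ.e i • m = σ.e i • m' from h, ← S.proj_add i m'] at h1
    exact Subtype.ext (add_left_cancel h1)

omit [IsScalarTower k A M] in
lemma proj_eq_zero {x : σ.I ⊕ σ.I} {m : M} (h : σ.e (Sum.elim id id x) • m = 0) :
    S.proj x m = 0 := by
  rw [S.proj_congr (h.trans (smul_zero _).symm), map_zero]

lemma proj_of_ne {x y : σ.I ⊕ σ.I} (hxy : x ≠ y) {m : M} (hm : m ∈ S.sub x) : S.proj y m = 0 := by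
  by_cases h : Sum.elim id id y = Sum.elim id id x
  · rcases x with i | i <;> rcases y with j | j <;> obtain rfl : j = i := h
    · exact absurd rfl hxy
    · exact S.proj_inr_eq_zero _ _ hm
    · exact S.proj_inl_eq_zero _ _ (Submodule.smul_mem _ _ ((S.mem_inr _ m).1 hm).1)
    · exact absurd rfl hxy
  · exact S.proj_eq_zero (S.e_smul_of_ne h hm)

lemma proj_self {x : σ.I ⊕ σ.I} (m : S.sub x) : S.proj x m = m := by
  apply Subtype.ext
  have h := S.proj_add (Sum.elim id id x) m
  rw [S.e_smul x m m.2] at h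
  rcases x with i | i
  · rwa [S.proj_of_ne (y := Sum.inr (Sum.elim id id (Sum.inl i))) (by simp) m.2,
      Submodule.coe_zero, add_zero] at h
  · rwa [S.proj_of_ne (y := Sum.inl (Sum.elim id id (Sum.inr i))) (by simp) m.2,
      Submodule.coe_zero, zero_add] at h

variable (T : Splitting σ N)

/-- The linear map on the components attached to a family of maps between the parts. -/
def componentMap (h : ∀ x, S.sub x →ₗ[k] T.sub x) : M →ₗ[k] N :=
  ∑ x, (T.sub x).subtype ∘ₗ h x ∘ₗ S.proj x

omit [IsScalarTower k A M] [IsScalarTower k A N] in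
lemma componentMap_apply (h : ∀ x, S.sub x →ₗ[k] T.sub x) (m : M) :
    S.componentMap T h m = ∑ x, (h x (S.proj x m) : N) := by
  simp [componentMap]

lemma componentMap_e_smul (h : ∀ x, S.sub x →ₗ[k] T.sub x) (i : σ.I) (m : M) :
    S.componentMap T h (σ.e i • m) = σ.e i • S.componentMap T h m := by
  rw [componentMap_apply, componentMap_apply, Finset.smul_sum]
  refine Finset.sum_congr rfl fun x _ => ?_
  by_cases hx : i = Sum.elim id id x
  · subst hx
    rw [T.e_smul x _ (h x _).2, S.proj_congr (σ.e_smul_e_smul _ m)]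
  · rw [T.e_smul_of_ne hx (h x _).2, S.proj_eq_zero, map_zero, Submodule.coe_zero]
    rw [smul_smul, σ.orthogonal.ortho (Ne.symm hx), zero_smul]

variable (hJ : ∀ x ∈ Ring.jacobson A, ∀ y ∈ Ring.jacobson A, x * y = 0)
  [FiniteDimensional k M] [FiniteDimensional k N] {h : ∀ x, S.sub x →ₗ[k] T.sub x}
  (hh : QuiverRep.IsHom (S.rep Q) (T.rep Q) h)

include hJ hh

lemma componentMap_basis_smul (a : Q.E) (m : M) :
    S.componentMap T h (Q.β a • m) = Q.β a • S.componentMap T h m := by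
  rw [componentMap_apply, componentMap_apply, Finset.smul_sum, Finset.sum_eq_single (Q.tgt a),
    Finset.sum_eq_single (Q.src a)]
  · have h1 : Q.β a • (S.proj (Q.src a) m : M) = Q.β a • m := by
      conv_rhs => rw [← Q.mul_e, mul_smul, ← S.proj_add, smul_add,
        smul_eq_zero_of_mem hJ (Q.mem_jacobson a)
          ((S.mem_inr _ _).1 (S.proj (Sum.inr (Q.s a)) m).2).1, add_zero]
    have h2 := congrArg Subtype.val (hh a (S.proj (Q.src a) m))
    refine Eq.trans ?_ h2.symm
    rw [S.proj_self ⟨_, S.basis_smul_mem Q a m⟩]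
    congr 2
    exact Subtype.ext h1.symm
  · rintro (i | i) _ hi
    · rw [← Q.mul_e, mul_smul, T.e_smul_of_ne _ (h (Sum.inl i) _).2, smul_zero]
      rintro rfl
      exact hi rfl
    · exact smul_eq_zero_of_mem hJ (Q.mem_jacobson a) ((T.mem_inr _ _).1 (h _ _).2).1
  · simp
  · intro x _ hx
    rw [S.proj_of_ne hx.symm (S.basis_smul_mem Q a m), map_zero, Submodule.coe_zero]
  · simp

lemma componentMap_sandwich_smul (i j : σ.I) (c : A) (m : M) :
    S.componentMap T h ((σ.e j * c * σ.e i) • m) = (σ.e j * c * σ.e i) • S.componentMap T h m := by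
  have key : ∀ c ∈ Ring.jacobson A, ∀ m, S.componentMap T h ((σ.e j * c * σ.e i) • m) =
      (σ.e j * c * σ.e i) • S.componentMap T h m := by
    intro c hc m
    rw [Q.expand c hc, Finset.sum_smul, Finset.sum_smul, map_sum]
    refine Finset.sum_congr rfl fun a _ => ?_
    rw [smul_assoc, smul_assoc, LinearMap.map_smul, S.componentMap_basis_smul Q T hJ hh]
  have hidem := fun i => (σ.orthogonal.idem i).eq
  by_cases hij : j = i
  · subst hij
    have h1 := key _ (σ.sub_scalar_mem j c) m
    have h2 : σ.e j * (σ.e j * c * σ.e j - σ.scalar j c • σ.e j) * σ.e j =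
        σ.e j * c * σ.e j - σ.scalar j c • σ.e j := by
      simp only [mul_sub, sub_mul, mul_smul_comm, smul_mul_assoc, hidem, mul_assoc]
      simp only [← mul_assoc, hidem]
    rw [h2, sub_smul, sub_smul, map_sub, smul_assoc, smul_assoc, LinearMap.map_smul,
      S.componentMap_e_smul] at h1
    exact sub_left_injective h1
  · have h1 := key _ (σ.off_diagonal j i c hij) m
    have h2 : σ.e j * (σ.e j * c * σ.e i) * σ.e i = σ.e j * c * σ.e i := by
      simp only [hidem, mul_assoc]
      simp only [← mul_assoc, hidem]
    rwa [h2] at h1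

/-- Homomorphisms of representations come from homomorphisms of modules. -/
lemma exists_linearMap : ∃ L : M →ₗ[A] N, ∀ x (m : S.sub x), L m = h x m := by
  set F := S.componentMap T h with hF
  have hcomm := S.componentMap_sandwich_smul Q T hJ hh
  rw [← hF] at hcomm
  have he : ∀ i m, F (σ.e i • m) = σ.e i • F m := S.componentMap_e_smul T h
  have hFe : ∀ m, F ((∑ i, σ.e i) • m) = F m := fun m => by
    rw [hF, componentMap_apply, componentMap_apply]
    refine Finset.sum_congr rfl fun x _ => ?_
    rw [S.proj_congr (m' := m)]
    rw [smul_smul, σ.orthogonal.mul_sum_of_mem (Finset.mem_univ _)]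
  have heF : ∀ m, (∑ i, σ.e i) • F m = F m := fun m => by
    rw [Finset.sum_smul, ← Finset.sum_congr rfl fun i _ => he i m, ← map_sum, ← Finset.sum_smul, hFe]
  have hcomm' : ∀ c m, F (((∑ i, σ.e i) * c * (∑ i, σ.e i)) • m) =
      ((∑ i, σ.e i) * c * (∑ i, σ.e i)) • F m := fun c m => by
    simp only [Finset.sum_mul, Finset.mul_sum, Finset.sum_smul, map_sum, hcomm]
  set ε := ∑ i, σ.e i
  have hcomm'' : ∀ c m, F (c • ε • m) = (ε * c) • F m := fun c m => by
    rw [← hFe, smul_smul, smul_smul, hcomm', mul_smul, heF]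
  let L : M →ₗ[A] N :=
    { toFun := fun m => ∑ x, σ.l x • F (σ.r x • m)
      map_add' := fun m m' => by simp only [smul_add, map_add, Finset.sum_add_distrib]
      map_smul' := fun a m => by
        rw [RingHom.id_apply]
        have h1 : ∀ x, σ.l x • F (σ.r x • a • m) =
            ∑ y, (σ.l x * ε * σ.r x * (a * σ.l y)) • F (σ.r y • m) := fun x => by
          have : σ.r x • a • m = ∑ y, (σ.r x * (a * σ.l y)) • ε • σ.r y • m := by
            conv_lhs => rw [← one_smul A m, ← σ.full]
            simp only [Finset.sum_smul, Finset.smul_sum, smul_smul, mul_assoc, ε]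
          rw [this, map_sum, Finset.smul_sum]
          refine Finset.sum_congr rfl fun y _ => ?_
          rw [hcomm'', smul_smul]
          simp only [mul_assoc]
        rw [Finset.sum_congr rfl fun x _ => h1 x, Finset.sum_comm, Finset.smul_sum]
        refine Finset.sum_congr rfl fun y _ => ?_
        rw [← Finset.sum_smul, ← Finset.sum_mul, σ.full, one_mul, smul_smul] }
  refine ⟨L, fun x m => ?_⟩
  have h1 : ∀ i m, σ.e i • L m = F (σ.e i • m) := fun i m => by
    have h2 : ∀ x, σ.e i • σ.l x • F (σ.r x • m) = F (σ.e i • σ.l x • ε • σ.r x • m) := by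
      intro x
      rw [he, hcomm'', smul_smul, smul_smul, ← mul_assoc,
        σ.orthogonal.mul_sum_of_mem (Finset.mem_univ _)]
    change σ.e i • (∑ x, σ.l x • F (σ.r x • m)) = _
    rw [Finset.smul_sum, Finset.sum_congr rfl fun x _ => h2 x, ← map_sum, ← Finset.smul_sum]
    conv_rhs => rw [← one_smul A m, ← σ.full]
    simp only [Finset.sum_smul, mul_smul, ε]
  have h3 : F m = h x m := by
    rw [hF, componentMap_apply, Finset.sum_eq_single x]
    · rw [S.proj_self]
    · intro y _ hy
      rw [S.proj_of_ne hy.symm m.2, map_zero, Submodule.coe_zero]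
    · simp
  rw [← h3, ← S.e_smul x m m.2, LinearMap.map_smul, h1]

end

end Splitting

end Modules

end

section

variable {k A : Type} [Field k] [Ring A] [Algebra k A] {σ : IdempotentSystem k A}

namespace Splitting

variable {M N : Type} [AddCommGroup M] [Module A M] [Module k M]
  [IsScalarTower k A M] [AddCommGroup N] [Module A N] [Module k N] [IsScalarTower k A N]
  [FiniteDimensional k M] [FiniteDimensional k N] (Q : ArrowSystem σ)
  (hJ : ∀ x ∈ Ring.jacobson A, ∀ y ∈ Ring.jacobson A, x * y = 0)

include hJ

lemma indecomposable_rep (S : Splitting σ M) (hM : IsIndecomposableModule A M) :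
    (S.rep Q).Indecomposable := by
  refine ⟨?_, fun p hp hidem => ?_⟩
  · by_contra! hcon
    obtain ⟨v, hv⟩ := hM.1
    have h : (LinearMap.id : M →ₗ[A] M) = 0 := S.hom_ext fun x m hm =>
      congrArg Subtype.val (hcon x ⟨m, hm⟩)
    exact hv (LinearMap.congr_fun h v)
  · obtain ⟨L, hL⟩ := S.exists_linearMap Q S hJ hp
    have hLL : IsIdempotentElem L := S.hom_ext fun x m hm => by
      have h1 := hL x ⟨m, hm⟩
      exact (congrArg L h1).trans ((hL x (p x ⟨m, hm⟩)).trans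
        ((congrArg Subtype.val (hidem x ⟨m, hm⟩)).trans h1.symm))
    rcases hM.2 _ _ (LinearMap.IsIdempotentElem.isCompl hLL) with h | h
    · left
      intro x m
      refine Subtype.ext ((hL x m).symm.trans ?_)
      rw [LinearMap.range_eq_bot.1 h, LinearMap.zero_apply]
      rfl
    · right
      intro x m
      refine Subtype.ext ((hL x m).symm.trans (LinearMap.ker_eq_bot.1 h ?_))
      exact LinearMap.congr_fun hLL (Subtype.val (p := (· ∈ S.sub x)) m)

lemma nonempty_linearEquiv (S : Splitting σ M) (T : Splitting σ N)
    (f : ∀ x, S.sub x ≃ₗ[k] T.sub x)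
    (hf : QuiverRep.IsHom (S.rep Q) (T.rep Q) fun x => (f x).toLinearMap) :
    Nonempty (M ≃ₗ[A] N) := by
  obtain ⟨L, hL⟩ := S.exists_linearMap Q T hJ hf
  obtain ⟨L', hL'⟩ := T.exists_linearMap Q S (h := fun x => (f x).symm.toLinearMap) hJ
    fun a v => by
      apply (f (Q.tgt a)).injective
      have h1 := hf a ((f (Q.src a)).symm v)
      have h2 := congrArg ((T.rep Q).φ a) ((f (Q.src a)).apply_symm_apply v)
      exact (h1.symm.trans h2).trans ((f (Q.tgt a)).apply_symm_apply ((T.rep Q).φ a v)).symm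
  refine ⟨LinearEquiv.ofLinearMap L L' (T.hom_ext fun x m hm => ?_) (S.hom_ext fun x m hm => ?_)⟩
  · have h1 := hL' x ⟨m, hm⟩
    have h2 := hL x ((f x).symm ⟨m, hm⟩)
    rw [LinearMap.comp_apply, h1]
    refine h2.trans ?_
    simp
  · have h1 := hL x ⟨m, hm⟩
    have h2 := hL' x (f x ⟨m, hm⟩)
    rw [LinearMap.comp_apply, h1]
    refine h2.trans ?_
    simp

end Splitting

open QuiverRep in
/-- If the Tits form of the separated quiver is weakly positive, then the algebra is of finite
representation type. -/
theorem ArrowSystem.finiteRepresentationType [IsAlgClosed k] [FiniteDimensional k A]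
    (Q : ArrowSystem σ) (hJ : ∀ x ∈ Ring.jacobson A, ∀ y ∈ Ring.jacobson A, x * y = 0)
    (hpos : ∀ d, d ≠ 0 → 0 < form (adjacency Q.src Q.tgt) d) : FiniteRepresentationType A := by
  classical
  have hself : ∀ a, Q.src a ≠ Q.tgt a := fun _ => Sum.inl_ne_inr
  have : Infinite k := IsAlgClosed.instInfinite
  let P : (σ.I ⊕ σ.I → ℕ) → ModuleCat.{0} A → Prop := fun d N =>
    ∃ (_ : Module k N) (_ : IsScalarTower k A N) (_ : FiniteDimensional k N) (S : Splitting σ N),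
      (S.rep Q).Indecomposable ∧ (S.rep Q).dim = d
  refine ⟨{d | form (adjacency Q.src Q.tgt) d = 2},
    finite_roots (adjacency_comm (s := Q.src) (t := Q.tgt)) (adjacency_self hself) hpos,
    fun d => if h : ∃ N, P d N then h.choose else ModuleCat.of A PUnit, fun N hN hind => ?_⟩
  let _ : Module k N := Module.compHom N (algebraMap k A)
  have _ : IsScalarTower k A N := ⟨fun c a n => by
    change (c • a) • n = algebraMap k A c • (a • n)
    rw [smul_smul, Algebra.smul_def]⟩
  have _ : FiniteDimensional k N := Module.Finite.trans A N
  obtain ⟨S⟩ := nonempty_splitting σ N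
  have hS := S.indecomposable_rep Q hJ hind
  refine ⟨⟨(S.rep Q).dim, (hS.rigid hpos).2⟩, ?_⟩
  have hex : ∃ N', P (S.rep Q).dim N' := ⟨N, _, ‹_›, ‹_›, S, hS, rfl⟩
  obtain ⟨_, _, _, T, hT, hdim⟩ := hex.choose_spec
  obtain ⟨f, hf⟩ := (hS.rigid hpos).1.exists_equiv (hT.rigid hpos).1 hdim.symm
  beta_reduce
  rw [dif_pos hex]
  exact S.nonempty_linearEquiv Q hJ T f hf

end

end RadSquareZero

open RadSquareZero in
/-- let `k` be an algebraically closed field and `A` a finite-dimensional unital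
`k`-algebra with `J(A)² = 0`.  Then `A` is of finite representation type iff the matrix
algebra `M₆(A)` has finitely many conjugacy classes of left ideals. -/
theorem finiteRepType_iff_finConjClasses_matrixSix
    (k : Type) [Field k] [IsAlgClosed k]
    (A : Type) [Ring A] [Algebra k A] [FiniteDimensional k A]
    (hJ2 : ∀ x ∈ (⊥ : Ideal A).jacobson, ∀ y ∈ (⊥ : Ideal A).jacobson, x * y = 0) :
    FiniteRepresentationType A ↔
      HasFinitelyManyConjClassesOfLeftIdeals (Matrix (Fin 6) (Fin 6) A) := by
  refine ⟨fun h => hasFinitelyManyConjClasses_of_finiteRepresentationType (k := k) h (Fin 6),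
    fun h => ?_⟩
  rw [Ideal.jacobson_bot] at hJ2
  obtain ⟨σ⟩ := nonempty_idempotentSystem (k := k) hJ2
  obtain ⟨Q⟩ := nonempty_arrowSystem σ
  have : Infinite k := IsAlgClosed.instInfinite
  exact Q.finiteRepresentationType hJ2 (form_pos_of_le_six QuiverRep.adjacency_comm
    (QuiverRep.adjacency_self fun _ => Sum.inl_ne_inr) (Q.form_pos hJ2 6 h))
end

section
/- Let k be an algebraically closed field and let A be a finite-dimensional unital associative k-algebra such that A/J(A) is isomorphic as a k-algebra to a finite product k × k × ⋯ × k (m copies), J(A)² = 0, and the lattice of two-sided ideals of A is distributive. Let e_1, …, e_m be orthogonal primitive idempotents of A with e_1 + ⋯ + e_m = 1. Then A has finitely many conjugacy classes of left ideals if and only if both of the following hold: (a) the simple graph on the vertex set {1, …, m} × {0, 1} in which (i, 0) is adjacent to (j, 1) exactly when e_i J(A) e_j ≠ 0 (and there are no other adjacencies) contains no cycle; and (b) dim_k(e_i J(A)) ≤ 3 for every i = 1, …, m. -/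
/-- An idempotent `e` is primitive if `e ≠ 0` and `e` is not the sum of two nonzero orthogonal
idempotents. -/
def IsPrimitiveIdempotent (A : Type) [Ring A] (e : A) : Prop :=
  IsIdempotentElem e ∧ e ≠ 0 ∧
    ¬ ∃ f g : A, IsIdempotentElem f ∧ IsIdempotentElem g ∧ f ≠ 0 ∧ g ≠ 0 ∧
        f * g = 0 ∧ g * f = 0 ∧ e = f + g

/-- The separated graph of `A` (with respect to idempotents `e 0, …, e (m-1)`): the simple
graph on `Fin m × Bool` in which `(i, false)` is adjacent to `(j, true)` exactly when
`eᵢ J(A) eⱼ ≠ 0`, and there are no other adjacencies. -/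
def SeparatedGraph (A : Type) [Ring A] (m : ℕ) (e : Fin m → A) :
    SimpleGraph (Fin m × Bool) :=
  SimpleGraph.fromRel (fun v w =>
    v.2 = false ∧ w.2 = true ∧ ∃ x ∈ (⊥ : Ideal A).jacobson, e v.1 * x * e w.1 ≠ 0)

namespace RadSqZero

open Module

section Conjugation

variable {A : Type} [Ring A]

/-- Since `u L = L` for a unit `u`, conjugation of left ideals is right multiplication. -/
lemma conjLeftIdeal_iff {L L' : Submodule A A} :
    ConjLeftIdeal A L L' ↔ ∃ u : Aˣ, ∀ z, z ∈ L' ↔ z * u ∈ L := by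
  refine exists_congr fun u => ?_
  rw [Set.ext_iff]
  refine forall_congr' fun z => ?_
  have key : z ∈ (fun x => (u : A) * x * ((u⁻¹ : Aˣ) : A)) '' (L : Set A) ↔ z * u ∈ L := by
    constructor
    · rintro ⟨x, hx, rfl⟩
      simpa [mul_assoc] using L.smul_mem (u : A) hx
    · intro h
      exact ⟨((u⁻¹ : Aˣ) : A) * (z * u), L.smul_mem _ h, by simp [mul_assoc]⟩
  rw [key, SetLike.mem_coe]

lemma conjLeftIdeal_equivalence : Equivalence (ConjLeftIdeal A) where
  refl L := conjLeftIdeal_iff.2 ⟨1, by simp⟩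
  symm h := by
    obtain ⟨u, hu⟩ := conjLeftIdeal_iff.1 h
    exact conjLeftIdeal_iff.2 ⟨u⁻¹, fun z => by simp [hu]⟩
  trans h h' := by
    obtain ⟨u, hu⟩ := conjLeftIdeal_iff.1 h
    obtain ⟨v, hv⟩ := conjLeftIdeal_iff.1 h'
    exact conjLeftIdeal_iff.2 ⟨v * u, fun z => by simp [hu, hv, mul_assoc]⟩

lemma conjLeftIdeal_comap (L : Submodule A A) (u : Aˣ) :
    ConjLeftIdeal A L (L.comap (LinearMap.toSpanSingleton A A (u : A))) :=
  conjLeftIdeal_iff.2 ⟨u, fun z => by simp⟩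

lemma not_hasFinitelyManyConjClasses {k : Type} [Infinite k] (F : k → Submodule A A)
    (hF : ∀ a b, ConjLeftIdeal A (F a) (F b) → a = b) :
    ¬ HasFinitelyManyConjClassesOfLeftIdeals A := by
  intro h
  have : Finite (Quot (ConjLeftIdeal A)) := h
  refine not_injective_infinite_finite (fun a => Quot.mk (ConjLeftIdeal A) (F a)) fun a b hab => ?_
  exact hF a b (conjLeftIdeal_equivalence.eqvGen_iff.1 (Quot.eqvGen_exact hab))

lemma hasFinitelyManyConjClasses_of_finite {B : Set A} (hB : B.Finite)
    (h : ∀ L : Submodule A A, ∃ L', ConjLeftIdeal A L L' ∧ L' ≤ Submodule.span A (B ∩ L')) :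
    HasFinitelyManyConjClassesOfLeftIdeals A := by
  have : Finite B.powerset := hB.finite_subsets
  refine Finite.of_surjective
    (fun T : B.powerset => Quot.mk (ConjLeftIdeal A) (Submodule.span A T.1)) ?_
  rintro ⟨L⟩
  obtain ⟨L', hL, hL'⟩ := h L
  refine ⟨⟨B ∩ L', Set.inter_subset_left⟩, ?_⟩
  have : Submodule.span A (B ∩ L') = L' :=
    le_antisymm (Submodule.span_le.2 Set.inter_subset_right) hL'
  simp only [this]
  exact (Quot.sound hL).symm

end Conjugation

lemma eq_of_reachable {V α : Type*} {G : SimpleGraph V} (f : V → α)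
    (hf : ∀ v w, G.Adj v w → f v = f w) {v w : V} (h : G.Reachable v w) : f v = f w := by
  obtain ⟨p⟩ := h
  induction p with
  | nil => rfl
  | cons hadj _ ih => exact (hf _ _ hadj).trans ih

/-- On a forest, every multiplicative `1`-cochain is a coboundary. -/
lemma exists_potential {V K : Type*} [Finite V] [CommGroup K] (G : SimpleGraph V)
    (hG : G.IsAcyclic) (d : V → V → K) (hd : ∀ v w, d w v = (d v w)⁻¹) :
    ∃ f : V → K, ∀ v w, G.Adj v w → f w = d v w * f v := by
  classical
  induction G using WellFoundedLT.induction with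
  | ind G ih =>
  by_cases hne : ∃ v w, G.Adj v w
  swap
  · exact ⟨1, fun v w h => (hne ⟨v, w, h⟩).elim⟩
  obtain ⟨v, w, hvw⟩ := hne
  set G' := G.deleteEdges {s(v, w)} with hG'
  have hle : G' ≤ G := SimpleGraph.deleteEdges_le _
  have hlt : G' < G := by
    refine lt_of_le_of_ne hle fun h => ?_
    rw [← h, hG', SimpleGraph.deleteEdges_adj] at hvw
    exact hvw.2 rfl
  have hbr : ¬ G'.Reachable v w :=
    SimpleGraph.isBridge_iff.1 (SimpleGraph.isAcyclic_iff_forall_adj_isBridge.1 hG hvw)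
  obtain ⟨f, hf⟩ := ih G' hlt (hG.anti hle)
  refine ⟨fun x => if G'.Reachable w x then d v w * f v / f w * f x else f x, fun a b hab => ?_⟩
  have hwv : ¬ G'.Reachable w v := fun h => hbr h.symm
  by_cases he : s(a, b) = s(v, w)
  · rcases Sym2.eq_iff.1 he with ⟨rfl, rfl⟩ | ⟨rfl, rfl⟩
    · simp [hwv]
    · simp [hwv, hd b a]
  · have hab' : G'.Adj a b := by
      rw [hG', SimpleGraph.deleteEdges_adj]
      exact ⟨hab, he⟩
    have hr : G'.Reachable w a ↔ G'.Reachable w b :=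
      ⟨fun h => h.trans hab'.reachable, fun h => h.trans hab'.symm.reachable⟩
    by_cases h : G'.Reachable w a
    · simp only [h, hr.1 h, if_true, hf a b hab']
      exact mul_left_comm _ _ _
    · simp only [h, mt hr.2 h, if_false, hf a b hab']

section Subspaces

variable {k : Type*} [Field k]

lemma eq_ker_of_card_le_finrank_add_one {ι : Type*} [Fintype ι] (W : Submodule k (ι → k))
    (h : Fintype.card ι ≤ finrank k W + 1) : ∃ f : (ι → k) →ₗ[k] k, W = LinearMap.ker f := by
  by_cases hW : W = ⊤
  · exact ⟨0, by simp [hW]⟩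
  obtain ⟨f, hf, hle⟩ := W.exists_le_ker_of_lt_top (lt_top_iff_ne_top.2 hW)
  refine ⟨f, Submodule.eq_of_le_of_finrank_le hle ?_⟩
  have h1 := LinearMap.finrank_range_add_finrank_ker f
  have h2 : finrank k (LinearMap.range f) ≠ 0 := by
    rw [Ne, Submodule.finrank_eq_zero, LinearMap.range_eq_bot]
    exact hf
  rw [Module.finrank_fintype_fun_eq_card] at h1
  omega

/-- Up to rescaling the coordinates, a subspace of `k ^ n` with `n ≤ 3` is spanned by vectors with
entries in `{0, 1, -1}`. -/
lemma exists_scaling_of_card_le_three {ι : Type*} [Fintype ι] (hι : Fintype.card ι ≤ 3)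
    (W : Submodule k (ι → k)) :
    ∃ (s : ι → kˣ) (T : Set (ι → k)), (∀ τ ∈ T, ∀ j, τ j ∈ ({0, 1, -1} : Set k)) ∧
      W = Submodule.span k ((fun τ j => (s j : k) * τ j) '' T) := by
  classical
  by_cases h1 : finrank k W ≤ 1
  · obtain ⟨v, hv⟩ := (Submodule.finrank_le_one_iff_isPrincipal W).1 h1
    refine ⟨fun j => if h : v j = 0 then 1 else Units.mk0 (v j) h,
      {fun j => if v j = 0 then 0 else 1}, ?_, ?_⟩
    · rintro τ rfl j
      by_cases h : v j = 0 <;> simp [h]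
    · rw [hv, Set.image_singleton]
      congr 2
      funext j
      by_cases h : v j = 0 <;> simp [h]
  · obtain ⟨f, rfl⟩ := eq_ker_of_card_le_finrank_add_one W (by omega)
    have hf : ∀ c, f c = ∑ j, c j * f (Pi.single j 1) := fun c => by
      conv_lhs => rw [pi_eq_sum_univ' c]
      simp
    let s : ι → kˣ := fun j =>
      if h : f (Pi.single j 1) = 0 then 1 else (Units.mk0 (f (Pi.single j 1)) h)⁻¹
    let ε : ι → k := fun j => if f (Pi.single j 1) = 0 then 0 else 1
    have hε : ∀ j, (s j : k) * f (Pi.single j 1) = ε j := fun j => by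
      by_cases h : f (Pi.single j 1) = 0 <;> simp [s, ε, h]
    obtain ⟨r, hr, hεr⟩ : ∃ r : ι → k, (∀ l, r l = 0 ∨ r l = 1) ∧
        ∀ j, ε j * f (fun l => (s l : k) * r l) = ε j := by
      by_cases h : ∃ j, f (Pi.single j 1) ≠ 0
      · obtain ⟨j₀, hj₀⟩ := h
        refine ⟨Pi.single j₀ 1, fun l => ?_, fun j => ?_⟩
        · by_cases hl : l = j₀
          · subst hl; simp
          · simp [hl]
        · have : f (fun l => (s l : k) * (Pi.single j₀ 1 : ι → k) l) = 1 := by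
            rw [hf, Finset.sum_eq_single j₀ (fun l _ hl => by simp [hl]) (by simp)]
            simp [s, hj₀]
          rw [this, mul_one]
      · push Not at h
        exact ⟨0, by simp, fun j => by simp [ε, h j]⟩
    let τ : ι → ι → k := fun j l => (Pi.single j 1 : ι → k) l - ε j * r l
    refine ⟨s, Set.range τ, ?_, le_antisymm (fun c hc => ?_) (Submodule.span_le.2 ?_)⟩
    · rintro _ ⟨j, rfl⟩ l
      have hε' : ε j = 0 ∨ ε j = 1 := by
        by_cases h : f (Pi.single j 1) = 0 <;> simp [ε, h]
      by_cases hl : l = j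
      · subst hl
        rcases hr l with h | h <;> rcases hε' with h' | h' <;> simp [τ, h, h']
      · rcases hr l with h | h <;> rcases hε' with h' | h' <;> simp [τ, h, h', hl]
    · have hc' : ∑ j, c j * f (Pi.single j 1) = 0 := (hf c).symm.trans hc
      have : c = ∑ j, (c j * (s j : k)⁻¹) • (fun l => (s l : k) * τ j l) := by
        funext l
        have h1 : ∑ j, c j * (s j : k)⁻¹ * ε j = 0 := by
          rw [← hc']
          refine Finset.sum_congr rfl fun j _ => ?_
          rw [← hε, mul_assoc, inv_mul_cancel_left₀ (s j).ne_zero]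
        have h2 : ∑ j, c j * (s j : k)⁻¹ * (Pi.single j 1 : ι → k) l = c l * (s l : k)⁻¹ := by
          rw [Finset.sum_eq_single l (fun j _ hj => by simp [hj.symm]) (by simp)]
          simp
        calc c l = s l * (c l * (s l : k)⁻¹) - s l * r l * 0 := by
              have := (s l).ne_zero
              field_simp
              simp
          _ = _ := by
              rw [← h1, ← h2, Finset.mul_sum, Finset.mul_sum, ← Finset.sum_sub_distrib,
                Finset.sum_apply]
              refine Finset.sum_congr rfl fun j _ => ?_
              simp only [τ, Pi.smul_apply, smul_eq_mul]
              ring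
      rw [this]
      exact Submodule.sum_mem _ fun j _ => Submodule.smul_mem _ _
        (Submodule.subset_span ⟨τ j, ⟨j, rfl⟩, rfl⟩)
    · rintro _ ⟨_, ⟨j, rfl⟩, rfl⟩
      have : (fun l => (s l : k) * τ j l) =
          (s j : k) • (Pi.single j 1 : ι → k) - ε j • fun l => (s l : k) * r l := by
        funext l
        by_cases hl : l = j
        · subst hl
          simp [τ]
          ring
        · simp [τ, hl]
          ring
      simp only [this, SetLike.mem_coe, LinearMap.mem_ker, map_sub, map_smul, smul_eq_mul, hε, hεr,
        sub_self]

/-- A version of `exists_scaling_of_card_le_three` for subspaces spanned by at most three vectors of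
a family. -/
lemma exists_scaling {V ι : Type*} [AddCommGroup V] [Module k V] [Fintype ι] (x : ι → V)
    (hx : Nat.card {j // x j ≠ 0} ≤ 3) (W : Submodule k V)
    (hW : W ≤ Submodule.span k (Set.range x)) :
    ∃ (s : ι → kˣ) (T : Set (ι → k)), (∀ τ ∈ T, ∀ j, τ j ∈ ({0, 1, -1} : Set k)) ∧
      W = Submodule.span k ((fun τ => ∑ j, ((s j : k) * τ j) • x j) '' T) := by
  classical
  let X : ({j // x j ≠ 0} → k) →ₗ[k] V := Fintype.linearCombination k (fun j => x j.1)
  have hXW : (W.comap X).map X = W := by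
    rw [Submodule.map_comap_eq, inf_eq_right, Fintype.range_linearCombination]
    refine hW.trans (Submodule.span_le.2 ?_)
    rintro _ ⟨j, rfl⟩
    by_cases h : x j = 0
    · simp [h]
    · exact Submodule.subset_span ⟨⟨j, h⟩, rfl⟩
  obtain ⟨s, T, hT, hs⟩ :=
    exists_scaling_of_card_le_three (Nat.card_eq_fintype_card (α := {j // x j ≠ 0}) ▸ hx)
      (W.comap X)
  refine ⟨fun j => if h : x j ≠ 0 then s ⟨j, h⟩ else 1,
    (fun (τ : {j // x j ≠ 0} → k) j => if h : x j ≠ 0 then τ ⟨j, h⟩ else 0) '' T, ?_, ?_⟩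
  · rintro _ ⟨τ, hτ, rfl⟩ j
    by_cases h : x j ≠ 0
    · simpa only [h, dif_pos, ne_eq, not_false_eq_true] using hT τ hτ ⟨j, h⟩
    · simp [h]
  · rw [← hXW, hs, Submodule.map_span, Set.image_image, Set.image_image]
    congr 1
    refine Set.image_congr fun τ _ => ?_
    rw [Fintype.linearCombination_apply,
      ← Fintype.sum_subtype_add_sum_subtype (fun j => x j ≠ 0)]
    refine (add_zero _).symm.trans (congrArg₂ (· + ·) (Finset.sum_congr rfl fun j _ => ?_)
      (Finset.sum_eq_zero fun j _ => ?_).symm)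
    · simp [j.2]
    · simp [not_not.1 j.2]

end Subspaces

/-- Characters `χ` of an algebra, with joint kernel `J` of square zero, together with a complete
system of orthogonal idempotents dual to `χ`. -/
structure DualIdempotents (k A : Type) [Field k] [Ring A] [Algebra k A] (ι : Type) [Fintype ι]
    [DecidableEq ι] where
  χ : A →ₐ[k] (ι → k)
  e : ι → A
  χ_e : ∀ i, χ (e i) = Pi.single i 1
  e_mul_e : ∀ i j, i ≠ j → e i * e j = 0
  sum_e : ∑ i, e i = 1
  ker_mul_ker : ∀ a b, χ a = 0 → χ b = 0 → a * b = 0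

namespace DualIdempotents

variable {k A : Type} [Field k] [Ring A] [Algebra k A] {ι : Type} [Fintype ι] [DecidableEq ι]
  (B : DualIdempotents k A ι)

lemma e_mul_self (i : ι) : B.e i * B.e i = B.e i := by
  have h := congrArg (B.e i * ·) B.sum_e
  simp only [Finset.mul_sum, mul_one] at h
  rwa [Finset.sum_eq_single i (fun j _ hj => B.e_mul_e i j hj.symm) (by simp)] at h

lemma χ_sub (a : A) : B.χ (a - ∑ i, B.χ a i • B.e i) = 0 := by
  funext j
  simp [B.χ_e, Pi.single_apply]

lemma mul_eq_smul (a : A) {z : A} {i : ι} (hz : B.χ z = 0) (hi : B.e i * z = z) :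
    a * z = B.χ a i • z := by
  have h := B.ker_mul_ker _ z (B.χ_sub a) hz
  rw [sub_mul, sub_eq_zero] at h
  rw [h, Finset.sum_mul, Finset.sum_eq_single i]
  · rw [smul_mul_assoc, hi]
  · intro l _ hl
    rw [smul_mul_assoc, ← hi, ← mul_assoc, B.e_mul_e l i hl, zero_mul, smul_zero]
  · simp

lemma mul_eq_smul' (a : A) {z : A} {j : ι} (hz : B.χ z = 0) (hj : z * B.e j = z) :
    z * a = B.χ a j • z := by
  have h := B.ker_mul_ker z _ hz (B.χ_sub a)
  rw [mul_sub, sub_eq_zero] at h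
  rw [h, Finset.mul_sum, Finset.sum_eq_single j]
  · rw [mul_smul_comm, hj]
  · intro l _ hl
    rw [mul_smul_comm, ← hj, mul_assoc, B.e_mul_e j l hl.symm, mul_zero, smul_zero]
  · simp

/-- The line spanned by an element of `e i * J * e j` is a two-sided ideal. -/
def line {i j : ι} (z : A) (hz : B.χ z = 0) (hi : B.e i * z = z) (hj : z * B.e j = z) :
    TwoSidedIdeal A :=
  .mk' (Set.range fun c : k => c • z) ⟨0, by simp⟩
    (by rintro _ _ ⟨c, rfl⟩ ⟨d, rfl⟩; exact ⟨c + d, add_smul ..⟩)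
    (by rintro _ ⟨c, rfl⟩; exact ⟨-c, neg_smul ..⟩)
    (by
      rintro a _ ⟨c, rfl⟩
      exact ⟨c * B.χ a i, by simp only [mul_smul_comm, B.mul_eq_smul a hz hi, smul_smul]⟩)
    (by
      rintro _ a ⟨c, rfl⟩
      exact ⟨c * B.χ a j, by simp only [smul_mul_assoc, B.mul_eq_smul' a hz hj, smul_smul]⟩)

lemma mem_line {i j : ι} {z : A} {hz : B.χ z = 0} {hi : B.e i * z = z} {hj : z * B.e j = z}
    {a : A} : a ∈ B.line z hz hi hj ↔ ∃ c : k, c • z = a :=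
  TwoSidedIdeal.mem_mk' ..

lemma exists_eq_smul_of_distrib
    (hdistrib : ∀ I J L : TwoSidedIdeal A, I ⊓ (J ⊔ L) = (I ⊓ J) ⊔ (I ⊓ L)) {i j : ι} {x y : A}
    (hx : B.χ x = 0) (hix : B.e i * x = x) (hxj : x * B.e j = x) (hx0 : x ≠ 0)
    (hy : B.χ y = 0) (hiy : B.e i * y = y) (hyj : y * B.e j = y) : ∃ c : k, y = c • x := by
  let I := B.line (x + y) (by simp [hx, hy]) (by rw [mul_add, hix, hiy])
    (by rw [add_mul, hxj, hyj])
  have h : x + y ∈ I ⊓ (B.line x hx hix hxj ⊔ B.line y hy hiy hyj) :=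
    (TwoSidedIdeal.mem_inf A).2 ⟨B.mem_line.2 ⟨1, one_smul ..⟩, TwoSidedIdeal.mem_sup.2
      ⟨x, B.mem_line.2 ⟨1, one_smul ..⟩, y, B.mem_line.2 ⟨1, one_smul ..⟩, rfl⟩⟩
  rw [hdistrib, TwoSidedIdeal.mem_sup] at h
  obtain ⟨p, hp, q, hq, hpq⟩ := h
  obtain ⟨α, hα⟩ := B.mem_line.1 ((TwoSidedIdeal.mem_inf A).1 hp).1
  obtain ⟨β, hβ⟩ := B.mem_line.1 ((TwoSidedIdeal.mem_inf A).1 hp).2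
  obtain ⟨δ, hδ⟩ := B.mem_line.1 ((TwoSidedIdeal.mem_inf A).1 hq).2
  by_cases hα0 : α = 0
  · have hxy : x = (δ - 1) • y := by
      rw [sub_smul, one_smul, hδ, eq_sub_iff_add_eq, ← hpq, ← hα, hα0, zero_smul, zero_add]
    have hδ1 : δ - 1 ≠ 0 := by
      rintro h
      exact hx0 (by rw [hxy, h, zero_smul])
    exact ⟨(δ - 1)⁻¹, by rw [hxy, smul_smul, inv_mul_cancel₀ hδ1, one_smul]⟩
  · refine ⟨α⁻¹ * (β - α), ?_⟩
    have hxy : α • y = (β - α) • x := by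
      rw [sub_smul, hβ, ← hα, smul_add, add_sub_cancel_left]
    rw [mul_smul, ← hxy, smul_smul, inv_mul_cancel₀ hα0, one_smul]

end DualIdempotents

/-- A multiplicative basis of an algebra with radical square zero: dual idempotents, together with
elements `x i j` spanning `e i * J * e j`. -/
structure ArrowBasis (k A : Type) [Field k] [Ring A] [Algebra k A] (ι : Type) [Fintype ι]
    [DecidableEq ι] extends DualIdempotents k A ι where
  x : ι → ι → A
  χ_x : ∀ i j, χ (x i j) = 0
  e_mul_x : ∀ i j, e i * x i j = x i j
  x_mul_e : ∀ i j, x i j * e j = x i j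
  exists_smul : ∀ a, χ a = 0 → ∀ i j, ∃ c : k, e i * a * e j = c • x i j

lemma DualIdempotents.exists_arrowBasis {k A : Type} [Field k] [Ring A] [Algebra k A] {ι : Type}
    [Fintype ι] [DecidableEq ι] (B : DualIdempotents k A ι)
    (hdistrib : ∀ I J L : TwoSidedIdeal A, I ⊓ (J ⊔ L) = (I ⊓ J) ⊔ (I ⊓ L)) :
    ∃ B' : ArrowBasis k A ι, B'.toDualIdempotents = B := by
  have key : ∀ i j, ∃ x, B.χ x = 0 ∧ B.e i * x = x ∧ x * B.e j = x ∧
      ∀ a, B.χ a = 0 → ∃ c : k, B.e i * a * B.e j = c • x := by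
    intro i j
    have hmem : ∀ a, B.χ a = 0 → B.χ (B.e i * a * B.e j) = 0 ∧
        B.e i * (B.e i * a * B.e j) = B.e i * a * B.e j ∧
        B.e i * a * B.e j * B.e j = B.e i * a * B.e j := fun a ha => by
      refine ⟨by simp [ha], ?_, ?_⟩
      · rw [← mul_assoc, ← mul_assoc, B.e_mul_self]
      · rw [mul_assoc, B.e_mul_self]
    by_cases h : ∃ a, B.χ a = 0 ∧ B.e i * a * B.e j ≠ 0
    · obtain ⟨a, ha, ha0⟩ := h
      obtain ⟨h1, h2, h3⟩ := hmem a ha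
      refine ⟨_, h1, h2, h3, fun b hb => ?_⟩
      obtain ⟨h1', h2', h3'⟩ := hmem b hb
      exact B.exists_eq_smul_of_distrib hdistrib h1 h2 h3 ha0 h1' h2' h3'
    · push Not at h
      exact ⟨0, by simp, by simp, by simp, fun a ha => ⟨0, by simp [h a ha]⟩⟩
  choose x h1 h2 h3 h4 using key
  exact ⟨⟨B, x, h1, h2, h3, fun a ha i j => h4 i j a ha⟩, rfl⟩

namespace ArrowBasis

variable {k A : Type} [Field k] [Ring A] [Algebra k A] {ι : Type} [Fintype ι] [DecidableEq ι]
  (B : ArrowBasis k A ι)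

lemma mul_x (a : A) (i j : ι) : a * B.x i j = B.χ a i • B.x i j :=
  B.mul_eq_smul a (B.χ_x i j) (B.e_mul_x i j)

lemma x_mul (a : A) (i j : ι) : B.x i j * a = B.χ a j • B.x i j :=
  B.mul_eq_smul' a (B.χ_x i j) (B.x_mul_e i j)

/-- The element of `e i * J` with coordinates `c`. -/
def row (i : ι) : (ι → k) →ₗ[k] A := Fintype.linearCombination k (B.x i)

lemma row_apply (i : ι) (c : ι → k) : B.row i c = ∑ j, c j • B.x i j :=
  Fintype.linearCombination_apply ..

lemma χ_row (i : ι) (c : ι → k) : B.χ (B.row i c) = 0 := by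
  simp [row_apply, B.χ_x]

lemma mul_row (a : A) (i : ι) (c : ι → k) : a * B.row i c = B.χ a i • B.row i c := by
  simp only [row_apply, Finset.mul_sum, mul_smul_comm, B.mul_x, Finset.smul_sum]
  exact Finset.sum_congr rfl fun j _ => smul_comm _ _ _

lemma row_mul (a : A) (i : ι) (c : ι → k) : B.row i c * a = B.row i (c * B.χ a) := by
  simp only [row_apply, Finset.sum_mul, smul_mul_assoc, B.x_mul, Pi.mul_apply, mul_smul]

lemma row_injective {i : ι} {c d : ι → k} (h : B.row i c = B.row i d) {j : ι}
    (hj : B.x i j ≠ 0) : c j = d j := by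
  have key : ∀ c : ι → k, B.row i c * B.e j = c j • B.x i j := fun c => by
    rw [row_mul, row_apply, B.χ_e, Finset.sum_eq_single j (fun l _ hl => by simp [hl]) (by simp)]
    simp
  have := key d
  rw [← h, key c] at this
  exact smul_left_injective k hj this

lemma exists_row {a : A} (h : B.χ a = 0) (i : ι) : ∃ c, B.e i * a = B.row i c := by
  choose c hc using B.exists_smul a h i
  refine ⟨c, ?_⟩
  rw [row_apply, ← Finset.sum_congr rfl (fun j _ => hc j), ← Finset.mul_sum, B.sum_e, mul_one]

lemma χ_unit_ne_zero (u : Aˣ) (j : ι) : B.χ (u : A) j ≠ 0 := by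
  intro h
  have := congrFun (congrArg B.χ u.mul_inv) j
  rw [map_mul, map_one, Pi.mul_apply, h, zero_mul] at this
  exact zero_ne_one this

/-- The unit of the diagonal torus with given coordinates. -/
def diag (t : ι → kˣ) : Aˣ where
  val := ∑ i, (t i : k) • B.e i
  inv := ∑ i, ((t i)⁻¹ : kˣ).val • B.e i
  val_inv := by
    rw [← B.sum_e, Finset.sum_mul]
    refine Finset.sum_congr rfl fun i _ => ?_
    rw [Finset.mul_sum, Finset.sum_eq_single i]
    · simp [smul_smul, B.e_mul_self]
    · intro j _ hj
      simp [B.e_mul_e i j hj.symm]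
    · simp
  inv_val := by
    rw [← B.sum_e, Finset.sum_mul]
    refine Finset.sum_congr rfl fun i _ => ?_
    rw [Finset.mul_sum, Finset.sum_eq_single i]
    · simp [smul_smul, B.e_mul_self]
    · intro j _ hj
      simp [B.e_mul_e i j hj.symm]
    · simp

lemma e_mul_diag (t : ι → kˣ) (i : ι) : B.e i * B.diag t = (t i : k) • B.e i := by
  simp only [diag, Finset.mul_sum]
  rw [Finset.sum_eq_single i]
  · simp [B.e_mul_self]
  · intro j _ hj
    simp [B.e_mul_e i j hj.symm]
  · simp

lemma χ_diag (t : ι → kˣ) : B.χ (B.diag t : A) = fun i => (t i : k) := by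
  funext i
  simp [diag, B.χ_e, Pi.single_apply]

/-- The unit `1 + n` for `n` in the radical. -/
def oneAdd (n : A) (hn : B.χ n = 0) : Aˣ where
  val := 1 + n
  inv := 1 - n
  val_inv := by
    have := B.ker_mul_ker n n hn hn
    simp [mul_sub, add_mul, this]
  inv_val := by
    have := B.ker_mul_ker n n hn hn
    simp [mul_add, sub_mul, this]

/-- The separated graph of the basis. -/
def graph : SimpleGraph (ι × Bool) :=
  SimpleGraph.fromRel fun v w => v.2 = false ∧ w.2 = true ∧ B.x v.1 w.1 ≠ 0

lemma graph_adj (i j : ι) : B.graph.Adj (i, false) (j, true) ↔ B.x i j ≠ 0 := by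
  simp [graph, SimpleGraph.fromRel_adj]

lemma card_row_le_three [Infinite k] (hfin : HasFinitelyManyConjClassesOfLeftIdeals A) (i : ι) :
    Nat.card {j // B.x i j ≠ 0} ≤ 3 := by
  classical
  by_contra! hlt
  rw [Nat.card_eq_fintype_card] at hlt
  obtain ⟨g⟩ := Function.Embedding.nonempty_of_card_le
    (α := Fin 4) (β := {j // B.x i j ≠ 0}) (by rw [Fintype.card_fin]; omega)
  have hg : ∀ p q : Fin 4, p ≠ q → (g p : ι) ≠ g q := fun p q hpq h =>
    hpq (g.injective (Subtype.ext h))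
  let v : ι → k := Pi.single (g 0 : ι) 1 + Pi.single (g 2 : ι) 1 + Pi.single (g 3 : ι) 1
  let w : k → ι → k := fun a =>
    Pi.single (g 1 : ι) 1 + Pi.single (g 2 : ι) 1 + Pi.single (g 3 : ι) a
  let F : k → Submodule A A := fun a => Submodule.span A {B.row i v, B.row i (w a)}
  have hF : ∀ a z, z ∈ F a → ∃ p q : k, z = B.row i (p • v + q • w a) := by
    intro a z hz
    obtain ⟨p, q, rfl⟩ := Submodule.mem_span_pair.1 hz
    exact ⟨B.χ p i, B.χ q i, by simp [B.mul_row]⟩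
  refine not_hasFinitelyManyConjClasses F (fun a b hab => ?_) hfin
  obtain ⟨u, hu⟩ := conjLeftIdeal_iff.1 hab
  obtain ⟨p, q, hpq⟩ := hF a _ ((hu _).1 (Submodule.subset_span (Set.mem_insert _ _)))
  obtain ⟨p', q', hpq'⟩ := hF a _
    ((hu _).1 (Submodule.subset_span (Set.mem_insert_of_mem _ rfl)))
  rw [B.row_mul] at hpq hpq'
  have h := fun l => B.row_injective hpq (g l).2
  have h' := fun l => B.row_injective hpq' (g l).2
  have e0 := h 0
  have e1 := h 1
  have e2 := h 2
  have e3 := h 3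
  have e0' := h' 0
  have e1' := h' 1
  have e2' := h' 2
  have e3' := h' 3
  simp [v, w, g.injective.eq_iff, Subtype.ext_iff.symm] at e0 e1 e2 e3 e0' e1' e2' e3'
  have hu0 := B.χ_unit_ne_zero u (g 0)
  grind

lemma isBridge [Infinite k] (hfin : HasFinitelyManyConjClassesOfLeftIdeals A) {i₀ j₀ : ι}
    (h₀ : B.x i₀ j₀ ≠ 0) : B.graph.IsBridge s((i₀, false), (j₀, true)) := by
  rw [SimpleGraph.isBridge_iff]
  intro hreach
  let c : k → ι → ι → k := fun a i j => if i = i₀ ∧ j = j₀ then a else 1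
  let F : k → Submodule A A := fun a => Submodule.span A (Set.range fun i => B.row i (c a i))
  have hF : ∀ a z, z ∈ F a → ∀ i, ∃ p : k, B.e i * z = B.row i (p • c a i) := by
    intro a z hz i
    obtain ⟨y, rfl⟩ := (Submodule.mem_span_range_iff_exists_fun A).1 hz
    refine ⟨B.χ (y i) i, ?_⟩
    simp only [smul_eq_mul, B.mul_row, Finset.mul_sum, mul_smul_comm, B.χ_e, map_smul]
    rw [Finset.sum_eq_single i (fun l _ hl => by simp [hl]) (by simp)]
    simp
  refine not_hasFinitelyManyConjClasses F (fun a b hab => ?_) hfin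
  obtain ⟨u, hu⟩ := conjLeftIdeal_iff.1 hab
  choose p hp using fun i => hF a _ ((hu _).1 (Submodule.subset_span ⟨i, rfl⟩)) i
  have key : ∀ i j, B.x i j ≠ 0 → c b i j * B.χ (u : A) j = p i * c a i j := fun i j hij => by
    have := hp i
    simp only [B.mul_row, B.χ_e, Pi.single_eq_same, one_smul, B.row_mul] at this
    exact B.row_injective this hij
  let f : ι × Bool → k := fun v => if v.2 then B.χ (u : A) v.1 else p v.1
  have hf : ∀ v w, (B.graph.deleteEdges {s((i₀, false), (j₀, true))}).Adj v w → f v = f w := by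
    have aux : ∀ i j, B.x i j ≠ 0 → ¬ (i = i₀ ∧ j = j₀) → B.χ (u : A) j = p i :=
      fun i j hij hne => by simpa [c, hne] using key i j hij
    rintro ⟨i, bi⟩ ⟨j, bj⟩ hadj
    rw [SimpleGraph.deleteEdges_adj, graph, SimpleGraph.fromRel_adj] at hadj
    obtain ⟨⟨-, ⟨h1, h2, hx⟩ | ⟨h1, h2, hx⟩⟩, hne⟩ := hadj
    · simp only at h1 h2 hx
      subst h1 h2
      exact (aux i j hx (by simpa using hne)).symm
    · simp only at h1 h2 hx
      subst h1 h2
      exact aux j i hx (by rintro ⟨rfl, rfl⟩; exact hne Sym2.eq_swap)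
  have hf₀ : p i₀ = B.χ (u : A) j₀ := eq_of_reachable f hf hreach
  have := key i₀ j₀ h₀
  rw [hf₀, mul_comm] at this
  simpa [c] using (mul_left_cancel₀ (B.χ_unit_ne_zero u j₀) this).symm

lemma graph_isAcyclic [Infinite k] (hfin : HasFinitelyManyConjClassesOfLeftIdeals A) :
    B.graph.IsAcyclic := by
  rw [SimpleGraph.isAcyclic_iff_forall_adj_isBridge]
  rintro ⟨i, bi⟩ ⟨j, bj⟩ hadj
  rw [graph, SimpleGraph.fromRel_adj] at hadj
  obtain ⟨-, ⟨h1, h2, hx⟩ | ⟨h1, h2, hx⟩⟩ := hadj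
  · simp only at h1 h2 hx
    subst h1 h2
    exact B.isBridge hfin hx
  · simp only at h1 h2 hx
    subst h1 h2
    rw [Sym2.eq_swap]
    exact B.isBridge hfin hx

/-- Every left ideal is conjugate to one that contains `e j` as soon as it contains an element with
nonzero `j`-th character. -/
lemma exists_conj_e_mem (L : Submodule A A) :
    ∃ L', ConjLeftIdeal A L L' ∧ ∀ z ∈ L', ∀ j, B.χ z j ≠ 0 → B.e j ∈ L' := by
  classical
  have hy : ∀ j, ∃ n : A, B.χ n = 0 ∧ B.e j * n = n ∧
      ((∃ z ∈ L, B.χ z j ≠ 0) → B.e j + n ∈ L) := by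
    intro j
    by_cases h : ∃ z ∈ L, B.χ z j ≠ 0
    · obtain ⟨z, hz, hzj⟩ := h
      refine ⟨B.e j * ((B.χ z j)⁻¹ • z) - B.e j, ?_, ?_, fun _ => ?_⟩
      · funext l
        by_cases hl : l = j
        · subst hl; simp [B.χ_e, hzj]
        · simp [B.χ_e, hl]
      · rw [mul_sub, ← mul_assoc, B.e_mul_self]
      · rw [add_sub_cancel, mul_smul_comm, ← smul_mul_assoc]
        exact L.smul_mem _ hz
    · exact ⟨0, by simp, by simp, fun h' => (h h').elim⟩
  choose n hn hen hnL using hy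
  have hsum : B.χ (∑ j, n j) = 0 := by simp [hn]
  let u := B.oneAdd (∑ j, n j) hsum
  refine ⟨_, conjLeftIdeal_comap L u, fun z hz j hj => ?_⟩
  have hχu : B.χ (u : A) = 1 := by simp [u, oneAdd, hn]
  have heu : B.e j * u = B.e j + n j := by
    simp only [u, oneAdd, mul_add, mul_one, Finset.mul_sum]
    rw [Finset.sum_eq_single j, hen]
    · intro l _ hl
      rw [← hen l, ← mul_assoc, B.e_mul_e j l hl.symm, zero_mul]
    · simp
  simp only [Submodule.mem_comap, LinearMap.toSpanSingleton_apply, smul_eq_mul] at hz ⊢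
  rw [heu]
  exact hnL j ⟨_, hz, by simpa [hχu] using hj⟩

/-- The idempotents, together with the elements of the `e i * J` with coordinates in
`{0, 1, -1}`. -/
def normalGenerators : Set A :=
  Set.range B.e ∪ ⋃ i, B.row i '' {τ | ∀ j, τ j ∈ ({0, 1, -1} : Set k)}

lemma normalGenerators_finite : B.normalGenerators.Finite :=
  (Set.finite_range _).union (Set.finite_iUnion fun _ =>
    (Set.Finite.pi' fun _ => Set.toFinite _).image _)

lemma exists_torus_scaling (hG : B.graph.IsAcyclic) (s : ι → ι → kˣ) :
    ∃ t f : ι → kˣ, ∀ i j, B.x i j ≠ 0 → t j = s i j * f i := by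
  obtain ⟨F, hF⟩ := exists_potential B.graph hG
    (fun v w => if v.2 then (if w.2 then 1 else (s w.1 v.1)⁻¹) else
      if w.2 then s v.1 w.1 else 1) (by
        rintro ⟨i, _ | _⟩ ⟨j, _ | _⟩ <;> simp)
  refine ⟨fun j => F (j, true), fun i => F (i, false), fun i j hij => ?_⟩
  simpa using hF _ _ ((B.graph_adj i j).2 hij)

lemma hasFinitelyManyConjClasses (hG : B.graph.IsAcyclic)
    (hcard : ∀ i, Nat.card {j // B.x i j ≠ 0} ≤ 3) :
    HasFinitelyManyConjClassesOfLeftIdeals A := by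
  refine hasFinitelyManyConjClasses_of_finite B.normalGenerators_finite fun L₀ => ?_
  obtain ⟨L, hL₀, hL⟩ := B.exists_conj_e_mem L₀
  let W : ι → Submodule k A := fun i => L.restrictScalars k ⊓ LinearMap.range (B.row i)
  have hW : ∀ i, W i ≤ Submodule.span k (Set.range (B.x i)) := fun i => by
    rw [← Fintype.range_linearCombination]
    exact inf_le_right
  choose s T hT hs using fun i => exists_scaling (B.x i) (hcard i) (W i) (hW i)
  obtain ⟨t, f, htf⟩ := B.exists_torus_scaling hG s
  let u := B.diag t
  refine ⟨_, conjLeftIdeal_equivalence.trans hL₀ (conjLeftIdeal_comap L u), fun z hz => ?_⟩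
  set L' := L.comap (LinearMap.toSpanSingleton A A (u : A))
  have hmem : ∀ {y}, y ∈ L' ↔ y * u ∈ L := by simp [L']
  set S := Submodule.span A (B.normalGenerators ∩ L')
  have heL' : ∀ j, B.χ z j ≠ 0 → B.e j ∈ L' := by
    intro j hj
    rw [hmem, B.e_mul_diag]
    refine L.smul_of_tower_mem (t j : k) (hL _ (hmem.1 hz) j ?_)
    simpa [u, χ_diag] using hj
  have hrow : ∀ i c, B.row i c ∈ L' → B.row i c ∈ S := by
    intro i c hc
    have h1 : B.row i c * u ∈ W i :=
      ⟨hmem.1 hc, by rw [B.row_mul]; exact ⟨_, rfl⟩⟩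
    let R : A →ₗ[k] A := LinearMap.mulRight k ((u⁻¹ : Aˣ) : A)
    have h2 : W i ≤ (S.restrictScalars k).comap R := by
      rw [hs i, Submodule.span_le]
      rintro _ ⟨τ, hτ, rfl⟩
      have h3 : (∑ j, ((s i j : k) * τ j) • B.x i j) =
          B.row i (((f i)⁻¹ : kˣ).val • τ) * u := by
        rw [B.row_mul, B.row_apply]
        refine Finset.sum_congr rfl fun j _ => ?_
        by_cases hj : B.x i j = 0
        · simp [hj]
        · simp only [u, χ_diag, Pi.mul_apply, Pi.smul_apply, smul_eq_mul, htf i j hj,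
            Units.val_mul]
          congr 1
          have := (f i).ne_zero
          rw [Units.val_inv_eq_inv_val]
          field_simp
      have h4 : (∑ j, ((s i j : k) * τ j) • B.x i j) ∈ W i := by
        rw [hs i]
        exact Submodule.subset_span ⟨τ, hτ, rfl⟩
      have h5 : B.row i τ ∈ L' := by
        have h6 := hmem.2 (h3 ▸ h4.1)
        simpa [smul_smul] using L'.smul_of_tower_mem (f i : k) h6
      simp only [Submodule.comap_coe, Set.mem_preimage, h3, R, LinearMap.mulRight_apply, mul_assoc,
        Units.mul_inv, mul_one, map_smul]
      exact S.smul_of_tower_mem _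
        (Submodule.subset_span ⟨Or.inr (Set.mem_iUnion.2 ⟨i, τ, hT i τ hτ, rfl⟩), h5⟩)
    simpa [R, mul_assoc] using h2 h1
  rw [← one_mul z, ← B.sum_e, Finset.sum_mul]
  refine Submodule.sum_mem _ fun i _ => ?_
  obtain ⟨c, hc⟩ := B.exists_row (B.χ_sub z) i
  have hei : B.e i * z = B.row i c + B.χ z i • B.e i := by
    rw [← hc, mul_sub, Finset.mul_sum, Finset.sum_eq_single i, mul_smul_comm, B.e_mul_self,
      sub_add_cancel]
    · intro j _ hj
      rw [mul_smul_comm, B.e_mul_e i j hj.symm, smul_zero]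
    · simp
  have hsmul : B.χ z i • B.e i ∈ L' ∧ B.χ z i • B.e i ∈ S := by
    by_cases hi : B.χ z i = 0
    · simp [hi]
    · exact ⟨L'.smul_of_tower_mem _ (heL' i hi), S.smul_of_tower_mem _
        (Submodule.subset_span ⟨Or.inl ⟨i, rfl⟩, heL' i hi⟩)⟩
  rw [hei]
  refine add_mem (hrow i c ?_) hsmul.2
  rw [eq_sub_of_add_eq hei.symm]
  exact sub_mem (L'.smul_mem _ hz) hsmul.1

lemma x_ne_zero_iff (i j : ι) : B.x i j ≠ 0 ↔ ∃ a, B.χ a = 0 ∧ B.e i * a * B.e j ≠ 0 := by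
  constructor
  · exact fun h => ⟨B.x i j, B.χ_x i j, by rwa [B.e_mul_x, B.x_mul_e]⟩
  · rintro ⟨a, ha, h⟩ h0
    obtain ⟨c, hc⟩ := B.exists_smul a ha i j
    exact h (by rw [hc, h0, smul_zero])

lemma linearIndependent_x (i : ι) :
    LinearIndependent k (fun j : {j // B.x i j ≠ 0} => B.x i j) := by
  classical
  refine Fintype.linearIndependent_iff.2 fun g hg j => ?_
  have h := congrArg (· * B.e j) hg
  simp only [Finset.sum_mul, smul_mul_assoc, B.x_mul, B.χ_e, zero_mul] at h
  rw [Finset.sum_eq_single j (fun l _ hl => by simp [Subtype.coe_injective.ne hl]) (by simp)] at h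
  simpa [j.2] using h

lemma finrank_map_mulLeft (i : ι) (J : Submodule k A) (hJ : ∀ a, a ∈ J ↔ B.χ a = 0) :
    finrank k (J.map (LinearMap.mulLeft k (B.e i))) = Nat.card {j // B.x i j ≠ 0} := by
  classical
  rw [Nat.card_eq_fintype_card, ← finrank_span_eq_card (B.linearIndependent_x i)]
  have : J.map (LinearMap.mulLeft k (B.e i)) =
      Submodule.span k (Set.range fun j : {j // B.x i j ≠ 0} => B.x i j) := by
    apply le_antisymm
    · rintro _ ⟨a, ha, rfl⟩
      obtain ⟨c, hc⟩ := B.exists_row ((hJ a).1 ha) i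
      rw [LinearMap.mulLeft_apply, hc, row_apply]
      refine Submodule.sum_mem _ fun j _ => Submodule.smul_mem _ _ ?_
      by_cases h : B.x i j = 0
      · simp [h]
      · exact Submodule.subset_span ⟨⟨j, h⟩, rfl⟩
    · rw [Submodule.span_le]
      rintro _ ⟨j, rfl⟩
      exact ⟨B.x i j, (hJ _).2 (B.χ_x i j), B.e_mul_x i j⟩
  rw [this]

end ArrowBasis

lemma exists_dualIdempotents {k A : Type} [Field k] [Ring A] [Algebra k A] {m : ℕ}
    (φ : A →ₐ[k] (Fin m → k)) (hφ : ∀ a b, φ a = 0 → φ b = 0 → a * b = 0) (e : Fin m → A)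
    (hidem : ∀ i, IsIdempotentElem (e i)) (hne : ∀ i, e i ≠ 0)
    (horth : ∀ i j, i ≠ j → e i * e j = 0) (hsum : ∑ i, e i = 1) :
    ∃ B : DualIdempotents k A (Fin m), B.e = e ∧ ∀ a, B.χ a = 0 ↔ φ a = 0 := by
  have hnz : ∀ i, ∃ l, φ (e i) l ≠ 0 := by
    intro i
    by_contra! h
    have h0 : φ (e i) = 0 := funext h
    exact hne i ((hidem i).symm.trans (hφ _ _ h0 h0))
  choose σ hσ using hnz
  have horthφ : ∀ i j, i ≠ j → ∀ l, φ (e i) l * φ (e j) l = 0 := fun i j hij l => by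
    rw [← Pi.mul_apply, ← map_mul, horth i j hij, map_zero, Pi.zero_apply]
  have hinj : Function.Injective σ := fun i j hij => by
    by_contra h
    have := horthφ i j h (σ i)
    exact mul_ne_zero (hσ i) (hij ▸ hσ j) this
  have hsurj : Function.Surjective σ := Finite.surjective_of_injective hinj
  let χ : A →ₐ[k] (Fin m → k) :=
    AlgHom.pi fun i => (Pi.evalAlgHom k (fun _ => k) (σ i)).comp φ
  have hχ : ∀ a i, χ a i = φ a (σ i) := fun _ _ => rfl
  have hker : ∀ a, χ a = 0 ↔ φ a = 0 := fun a => by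
    simp only [funext_iff, hχ, Pi.zero_apply]
    exact (hsurj.forall (p := fun l => φ a l = 0)).symm
  refine ⟨⟨χ, e, fun i => funext fun j => ?_, horth, hsum, fun a b ha hb =>
    hφ a b ((hker a).1 ha) ((hker b).1 hb)⟩, rfl, hker⟩
  rw [hχ]
  by_cases hij : j = i
  · subst hij
    have := congrFun (congrArg φ (hidem j)) (σ j)
    rw [map_mul, Pi.mul_apply] at this
    rw [Pi.single_eq_same]
    exact mul_left_cancel₀ (hσ j) (this.trans (mul_one _).symm)
  · rw [Pi.single_eq_of_ne hij]
    exact (mul_eq_zero.1 (horthφ i j (Ne.symm hij) (σ j))).resolve_right (hσ j)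

end RadSqZero

/-- let `A` be a finite-dimensional basic algebra (`A/J(A) ≅ k × ⋯ × k`) over an
algebraically closed field `k`, with `J(A)² = 0` and distributive lattice of two-sided ideals,
and let `e₁, …, e_m` be orthogonal primitive idempotents summing to `1`.  Then `A` has finitely
many conjugacy classes of left ideals iff the separated graph of `A` has no cycles and
`dim_k (eᵢ J(A)) ≤ 3` for every `i`. -/
theorem finConjClasses_iff_acyclic_and_dim_le_three
    (k : Type) [Field k] [IsAlgClosed k]
    (A : Type) [Ring A] [Algebra k A] [FiniteDimensional k A]
    (m : ℕ)
    (hbasic : ∃ φ : A →ₐ[k] (Fin m → k),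
      Function.Surjective φ ∧ RingHom.ker φ.toRingHom = (⊥ : Ideal A).jacobson)
    (hJ2 : ∀ x ∈ (⊥ : Ideal A).jacobson, ∀ y ∈ (⊥ : Ideal A).jacobson, x * y = 0)
    (hdistrib : ∀ I J L : TwoSidedIdeal A, I ⊓ (J ⊔ L) = (I ⊓ J) ⊔ (I ⊓ L))
    (e : Fin m → A)
    (hprim : ∀ i, IsPrimitiveIdempotent A (e i))
    (horth : ∀ i j, i ≠ j → e i * e j = 0)
    (hsum : ∑ i, e i = 1) :
    HasFinitelyManyConjClassesOfLeftIdeals A ↔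
      ((SeparatedGraph A m e).IsAcyclic ∧
        ∀ i, Module.finrank k
          (Submodule.map (LinearMap.mulLeft k (e i))
            (((⊥ : Ideal A).jacobson).restrictScalars k)) ≤ 3) := by
  obtain ⟨φ, -, hφ⟩ := hbasic
  have hker : ∀ a, a ∈ (⊥ : Ideal A).jacobson ↔ φ a = 0 := fun a => by
    rw [← hφ]; exact RingHom.mem_ker
  obtain ⟨B₀, he, hχ⟩ := RadSqZero.exists_dualIdempotents φ
    (fun a b ha hb => hJ2 a ((hker a).2 ha) b ((hker b).2 hb)) e (fun i => (hprim i).1)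
    (fun i => (hprim i).2.1) horth hsum
  obtain ⟨B, rfl⟩ := B₀.exists_arrowBasis hdistrib
  subst he
  have hJ : ∀ a, a ∈ (⊥ : Ideal A).jacobson ↔ B.χ a = 0 := fun a => (hker a).trans (hχ a).symm
  have hgraph : SeparatedGraph A m B.e = B.graph := by
    simp only [SeparatedGraph, RadSqZero.ArrowBasis.graph, B.x_ne_zero_iff, hJ]
  have hrank := fun i =>
    B.finrank_map_mulLeft i ((⊥ : Ideal A).jacobson.restrictScalars k) hJ
  simp only [hgraph, hrank]
  exact ⟨fun h => ⟨B.graph_isAcyclic h, B.card_row_le_three h⟩,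
    fun h => B.hasFinitelyManyConjClasses h.1 h.2⟩
end
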